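/- Fix integers N ≥ 2, d ≥ 2 and n ≥ 2 with N > 2^d·(d−1), and let F ∈ ℤ[x₀,…,x_N] be homogeneous of degree d defining a smooth hypersurface, i.e. for every nonzero z ∈ ℂ^{N+1} with F(z) = 0 the gradient (∂F/∂x₀(z),…,∂F/∂x_N(z)) is nonzero. Let g be a polynomial with rational coefficients in n·(N+1) variables, written in n blocks of N+1 variables and homogeneous in each block, such that there exist nonzero vectors z⁽¹⁾, …, z⁽ⁿ⁾ ∈ ℂ^{N+1} with F(z⁽ʲ⁾) = 0 for all j and g(z⁽¹⁾,…,z⁽ⁿ⁾) ≠ 0. Then there exist γ ∈ [0,1) and C > 0 such that for all B ≥ 2, the number of n-tuples (x⁽¹⁾, …, x⁽ⁿ⁾) of primitive vectors in ℤ^{N+1} satisfying F(x⁽ʲ⁾) = 0 for all j, g(x⁽¹⁾,…,x⁽ⁿ⁾) = 0, and ∏_{j=1}^n ‖x⁽ʲ⁾‖∞^{N+1−d} ≤ B is at most C·B·(log B)^{n−2+γ}. -/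

import Mathlib

noncomputable section
open MvPolynomial

/-- A vector of integers is primitive if the gcd of its coordinates is `1`. -/
def IsPrimitiveVec {k : ℕ} (x : Fin k → ℤ) : Prop := Finset.gcd Finset.univ x = 1

/-- The sup-norm `max_i |x_i|` of an integer vector. -/
def supNorm {k : ℕ} (x : Fin k → ℤ) : ℕ := Finset.univ.sup fun i => (x i).natAbs

/-- integer box -/
def bx (m : ℕ) (P : ℝ) : Finset (Fin m → ℤ) :=
  Fintype.piFinset fun _ => Finset.Icc (-⌊P⌋) ⌊P⌋

lemma mem_bx {m : ℕ} {P : ℝ} {u : Fin m → ℤ} : u ∈ bx m P ↔ ∀ i, |(u i : ℝ)| ≤ P := by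
  simp only [bx, Fintype.mem_piFinset, Finset.mem_Icc]
  refine forall_congr' fun i => ?_
  have h1 : -⌊P⌋ ≤ u i ↔ -P ≤ (u i : ℝ) := by
    rw [neg_le, Int.le_floor, Int.cast_neg, neg_le]
  rw [abs_le, ← h1, Int.le_floor]

/-- distance to the nearest integer -/
def dz (x : ℝ) : ℝ := |x - round x|

lemma dz_le (x : ℝ) (n : ℤ) : dz x ≤ |x - n| := round_le x n

lemma dz_nonneg (x : ℝ) : 0 ≤ dz x := abs_nonneg _

/-- the counting set in the shrinking lemma -/
def sh {m : ℕ} (Λ : Fin m → Fin m → ℝ) (P δ : ℝ) : Finset (Fin m → ℤ) := by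
  classical exact (bx m P).filter fun u => ∀ i, dz (∑ j, Λ i j * u j) ≤ δ

lemma mem_sh {m : ℕ} {Λ : Fin m → Fin m → ℝ} {P δ : ℝ} {u : Fin m → ℤ} :
    u ∈ sh Λ P δ ↔ (∀ i, |(u i : ℝ)| ≤ P) ∧ ∀ i, dz (∑ j, Λ i j * u j) ≤ δ := by
  classical
  simp [sh, mem_bx]

open MeasureTheory Module in
lemma packing {E : Type*} [NormedAddCommGroup E] [NormedSpace ℝ E] [FiniteDimensional ℝ E]
    (s : Finset E) (κ : ℝ) (hκ : 0 < κ) (hκ1 : κ ≤ 1) (hs : ∀ c ∈ s, ‖c‖ ≤ 1)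
    (h : ∀ c ∈ s, ∀ d ∈ s, c ≠ d → κ ≤ ‖c - d‖) : (s.card : ℝ) ≤ (3 / κ) ^ finrank ℝ E := by
  borelize E
  let μ : Measure E := Measure.addHaar
  let δ : ℝ := κ / 2
  let ρ : ℝ := 3 / 2
  have δpos : 0 < δ := by positivity
  have ρpos : 0 < ρ := by norm_num [ρ]
  set A := ⋃ c ∈ s, Metric.ball (c : E) δ with hA
  have D : Set.Pairwise (s : Set E) (Function.onFun Disjoint fun c => Metric.ball (c : E) δ) := by
    rintro c hc d hd hcd
    apply Metric.ball_disjoint_ball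
    rw [dist_eq_norm]
    have := h c hc d hd hcd
    simp only [δ]; linarith
  have A_subset : A ⊆ Metric.ball (0 : E) ρ := by
    refine Set.iUnion₂_subset fun x hx => ?_
    apply Metric.ball_subset_ball'
    have := hs x hx
    rw [dist_zero_right]
    simp only [δ, ρ]; linarith
  have I : (s.card : ENNReal) * ENNReal.ofReal (δ ^ finrank ℝ E) * μ (Metric.ball 0 1) ≤
      ENNReal.ofReal (ρ ^ finrank ℝ E) * μ (Metric.ball 0 1) := by
    calc
      (s.card : ENNReal) * ENNReal.ofReal (δ ^ finrank ℝ E) * μ (Metric.ball 0 1) = μ A := by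
        rw [hA, measure_biUnion_finset D fun c _ => measurableSet_ball]
        have I : 0 < δ := δpos
        simp only [μ.addHaar_ball_of_pos _ I, Finset.sum_const, nsmul_eq_mul, mul_assoc]
      _ ≤ μ (Metric.ball (0 : E) ρ) := measure_mono A_subset
      _ = ENNReal.ofReal (ρ ^ finrank ℝ E) * μ (Metric.ball 0 1) := by
        simp only [μ.addHaar_ball_of_pos _ ρpos]
  have J : (s.card : ENNReal) * ENNReal.ofReal (δ ^ finrank ℝ E) ≤ ENNReal.ofReal (ρ ^ finrank ℝ E) :=
    (ENNReal.mul_le_mul_iff_left (Metric.measure_ball_pos _ _ zero_lt_one).ne' measure_ball_lt_top.ne).1 I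
  have K : (s.card : ℝ) * δ ^ finrank ℝ E ≤ ρ ^ finrank ℝ E := by
    have := ENNReal.toReal_le_of_le_ofReal (pow_nonneg ρpos.le _) J
    simpa [ENNReal.toReal_mul, abs_of_nonneg, δpos.le] using this
  have : (3 / κ) = ρ / δ := by simp only [ρ, δ]; field_simp
  rw [this, div_pow, le_div_iff₀ (by positivity)]
  exact K

/-- standard symplectic form -/
def sympl (m : ℕ) : LinearMap.BilinForm ℝ (Fin m ⊕ Fin m → ℝ) :=
  LinearMap.mk₂ ℝ (fun v w => ∑ i, (v (Sum.inl i) * w (Sum.inr i) - w (Sum.inl i) * v (Sum.inr i)))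
    (by intro a b c; rw [← Finset.sum_add_distrib]; refine Finset.sum_congr rfl fun i _ => ?_
        simp only [Pi.add_apply]; ring)
    (by intro a b c; rw [smul_eq_mul, Finset.mul_sum]; refine Finset.sum_congr rfl fun i _ => ?_
        simp only [Pi.smul_apply, smul_eq_mul]; ring)
    (by intro a b c; rw [← Finset.sum_add_distrib]; refine Finset.sum_congr rfl fun i _ => ?_
        simp only [Pi.add_apply]; ring)
    (by intro a b c; rw [smul_eq_mul, Finset.mul_sum]; refine Finset.sum_congr rfl fun i _ => ?_
        simp only [Pi.smul_apply, smul_eq_mul]; ring)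

lemma sympl_apply {m : ℕ} (v w : Fin m ⊕ Fin m → ℝ) : sympl m v w =
    ∑ i, (v (Sum.inl i) * w (Sum.inr i) - w (Sum.inl i) * v (Sum.inr i)) := rfl

lemma isotropic_finrank {m : ℕ} (V : Submodule ℝ (Fin m ⊕ Fin m → ℝ))
    (h : ∀ v ∈ V, ∀ w ∈ V, sympl m v w = 0) : Module.finrank ℝ V ≤ m := by
  have hr : (sympl m).IsRefl := by
    intro v w h
    rw [sympl_apply] at h ⊢
    rw [← neg_eq_zero, ← h, ← Finset.sum_neg_distrib]
    refine Finset.sum_congr rfl fun i _ => by ring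
  have h1 := LinearMap.BilinForm.finrank_add_finrank_orthogonal hr V
  have h2 : (sympl m).orthogonal ⊤ = ⊥ := by
    rw [eq_bot_iff]
    intro v hv
    rw [LinearMap.BilinForm.mem_orthogonal_iff] at hv
    have hv' : ∀ w, sympl m w v = 0 := fun w => hv w trivial
    rw [Submodule.mem_bot]
    funext x
    rcases x with i | i
    · have := hv' (Pi.single (Sum.inr i) 1)
      rw [sympl_apply] at this
      simpa [Pi.single_apply] using this
    · have := hv' (Pi.single (Sum.inl i) 1)
      rw [sympl_apply] at this
      simpa [Pi.single_apply] using this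
  rw [h2, inf_bot_eq, finrank_bot] at h1
  have h3 : V ≤ (sympl m).orthogonal V := by
    intro v hv
    rw [LinearMap.BilinForm.mem_orthogonal_iff]
    exact fun w hw => h w hw v hv
  have h4 := Submodule.finrank_mono h3
  simp at h1
  omega

lemma shrink {m : ℕ} (Λ : Fin m → Fin m → ℝ) (hΛ : ∀ i j, Λ i j = Λ j i) (P δ κ : ℝ)
    (hP : 0 < P) (hδ : 0 < δ) (hPδ : 2 * m * (P * δ) < 1) (hκ : 0 < κ) (hκ1 : κ ≤ 1) :
    ((sh Λ P δ).card : ℝ) ≤ (3 / κ) ^ m * (sh Λ (κ * P) (κ * δ)).card := by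
  classical
  set L : (Fin m → ℤ) → Fin m → ℝ := fun u i => ∑ j, Λ i j * u j with hL
  have Lsub : ∀ u u' i, L (u - u') i = L u i - L u' i := by
    intro u u' i
    simp only [hL, ← Finset.sum_sub_distrib]
    refine Finset.sum_congr rfl fun j _ => ?_
    simp only [Pi.sub_apply]; push_cast; ring
  set v : (Fin m → ℤ) → (Fin m ⊕ Fin m → ℝ) := fun u =>
    Sum.elim (fun i => u i / P) (fun i => (L u i - round (L u i)) / δ) with hv
  set S := sh Λ P δ with hS
  have hvS : ∀ u ∈ S, ‖v u‖ ≤ 1 := by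
    intro u hu
    rw [hS, mem_sh] at hu
    rw [pi_norm_le_iff_of_nonneg zero_le_one]
    rintro (i | i)
    · simp only [hv, Sum.elim_inl, Real.norm_eq_abs, abs_div, abs_of_pos hP]
      rw [div_le_one hP]; exact hu.1 i
    · simp only [hv, Sum.elim_inr, Real.norm_eq_abs, abs_div, abs_of_pos hδ]
      rw [div_le_one hδ]; exact hu.2 i
  set V := Submodule.span ℝ (v '' S) with hV
  have hiso0 : ∀ u ∈ S, ∀ u' ∈ S, sympl m (v u) (v u') = 0 := by
    intro u hu u' hu'
    have hb : |sympl m (v u) (v u')| ≤ 2 * m := by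
      rw [sympl_apply]
      refine (Finset.abs_sum_le_sum_abs _ _).trans ?_
      have : ∀ i ∈ (Finset.univ : Finset (Fin m)),
          |v u (Sum.inl i) * v u' (Sum.inr i) - v u' (Sum.inl i) * v u (Sum.inr i)| ≤ 2 := by
        intro i _
        have h1 := (norm_le_pi_norm (v u) (Sum.inl i)).trans (hvS u hu)
        have h2 := (norm_le_pi_norm (v u) (Sum.inr i)).trans (hvS u hu)
        have h3 := (norm_le_pi_norm (v u') (Sum.inl i)).trans (hvS u' hu')
        have h4 := (norm_le_pi_norm (v u') (Sum.inr i)).trans (hvS u' hu')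
        rw [Real.norm_eq_abs] at h1 h2 h3 h4
        refine (abs_sub _ _).trans ?_
        rw [abs_mul, abs_mul]
        nlinarith [mul_le_mul h1 h4 (abs_nonneg _) zero_le_one, mul_le_mul h3 h2 (abs_nonneg _) zero_le_one]
      refine (Finset.sum_le_sum this).trans ?_
      simp; linarith
    have hint : ∃ z : ℤ, P * δ * sympl m (v u) (v u') = z := by
      refine ⟨∑ i, (u' i * round (L u i) - u i * round (L u' i)), ?_⟩
      have e1 : P * δ * sympl m (v u) (v u') = ∑ i, (u i * (L u' i - round (L u' i)) -
          u' i * (L u i - round (L u i))) := by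
        rw [sympl_apply, Finset.mul_sum]
        refine Finset.sum_congr rfl fun i _ => ?_
        simp only [hv, Sum.elim_inl, Sum.elim_inr]
        field_simp
      have e2 : ∑ i, (u i : ℝ) * L u' i = ∑ i, (u' i : ℝ) * L u i := by
        simp only [hL, Finset.mul_sum]
        rw [Finset.sum_comm]
        refine Finset.sum_congr rfl fun i _ => Finset.sum_congr rfl fun j _ => ?_
        rw [hΛ i j]; ring
      rw [e1]
      push_cast
      have : ∀ i, (u i * (L u' i - round (L u' i)) - u' i * (L u i - round (L u i)) : ℝ)
        = (u i * L u' i - u' i * L u i) + (u' i * round (L u i) - u i * round (L u' i)) := fun i => by ring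
      simp only [this]
      rw [Finset.sum_add_distrib, Finset.sum_sub_distrib, e2, sub_self, zero_add]
    obtain ⟨z, hz⟩ := hint
    have hz1 : |(z : ℝ)| < 1 := by
      rw [← hz, abs_mul, abs_of_pos (by positivity)]
      calc P * δ * |sympl m (v u) (v u')| ≤ P * δ * (2 * m) := by gcongr
        _ = 2 * m * (P * δ) := by ring
        _ < 1 := hPδ
    have hz0 : z = 0 := by
      rw [← Int.cast_abs] at hz1
      exact Int.abs_lt_one_iff.1 (by exact_mod_cast hz1)
    rw [hz0] at hz
    have hne : P * δ ≠ 0 := by positivity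
    simpa [hne, hP.ne', hδ.ne'] using hz
  have hrank : Module.finrank ℝ V ≤ m := by
    apply isotropic_finrank
    intro a ha b hb
    induction ha using Submodule.span_induction with
    | zero => simp
    | add x y _ _ hx hy => simp [hx, hy]
    | smul c x _ hx => simp [hx]
    | mem x hx =>
      obtain ⟨u, hu, rfl⟩ := hx
      induction hb using Submodule.span_induction with
      | zero => simp
      | add x y _ _ hx hy => simp [hx, hy]
      | smul c x _ hx => simp [hx]
      | mem x hx =>
        obtain ⟨u', hu', rfl⟩ := hx
        exact hiso0 u hu u' hu'
  -- maximal separated subset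
  obtain ⟨Q, hQ⟩ : ∃ Q : Finset (Fin m → ℤ) → Prop, ∀ s, Q s ↔
    ∀ a ∈ s, ∀ b ∈ s, a ≠ b → κ ≤ ‖v a - v b‖ := ⟨_, fun _ => Iff.rfl⟩
  obtain ⟨S', hS'mem, hS'max⟩ := Finset.exists_max_image
    (S.powerset.filter Q) Finset.card
    ⟨∅, by simp [hQ]⟩
  rw [Finset.mem_filter, Finset.mem_powerset, hQ] at hS'mem
  obtain ⟨hsub, hsep⟩ := hS'mem
  have hcov : ∀ u ∈ S, ∃ a ∈ S', ‖v u - v a‖ ≤ κ := by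
    intro u hu
    by_contra hcon
    push Not at hcon
    have hnot : u ∉ S' := fun hmem => by
      have := hcon u hmem
      simp at this; linarith
    have := hS'max (insert u S') (by
      rw [Finset.mem_filter, Finset.mem_powerset, hQ]
      refine ⟨Finset.insert_subset hu hsub, ?_⟩
      intro a ha b hb hab
      rw [Finset.mem_insert] at ha hb
      rcases ha with rfl | ha <;> rcases hb with rfl | hb
      · exact absurd rfl hab
      · exact (hcon b hb).le
      · rw [norm_sub_rev]; exact (hcon a ha).le
      · exact hsep a ha b hb hab)
    rw [Finset.card_insert_of_notMem hnot] at this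
    omega
  have hcard' : (S'.card : ℝ) ≤ (3 / κ) ^ m := by
    have hmemV : ∀ u ∈ S', v u ∈ V := fun u hu => Submodule.subset_span ⟨u, hsub hu, rfl⟩
    let f : S' → V := fun u => ⟨v u, hmemV u u.2⟩
    have finj : Function.Injective f := by
      intro a b hab
      by_contra hne
      have := hsep a a.2 b b.2 (fun h => hne (Subtype.ext h))
      have h2 : v a = v b := congrArg Subtype.val hab
      rw [h2] at this; simp at this; linarith
    have := packing (Finset.univ.image f) κ hκ hκ1 (by
      intro c hc
      obtain ⟨a, -, rfl⟩ := Finset.mem_image.1 hc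
      exact hvS a (hsub a.2)) (by
      intro c hc d hd hcd
      obtain ⟨a, -, rfl⟩ := Finset.mem_image.1 hc
      obtain ⟨b, -, rfl⟩ := Finset.mem_image.1 hd
      exact hsep a a.2 b b.2 (fun h => hcd (by rw [Subtype.ext h])))
    rw [Finset.card_image_of_injective _ finj, Finset.card_univ, Fintype.card_coe] at this
    refine this.trans (pow_le_pow_right₀ ?_ hrank)
    rw [le_div_iff₀ hκ]; linarith
  -- covering
  have hle : S.card ≤ S'.card * (sh Λ (κ * P) (κ * δ)).card := by
    choose! a ha1 ha2 using hcov
    have : S ⊆ (S' ×ˢ sh Λ (κ * P) (κ * δ)).image (fun x => x.1 + x.2) := by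
      intro u hu
      rw [Finset.mem_image]
      refine ⟨(a u, u - a u), ?_, by simp⟩
      rw [Finset.mem_product]
      refine ⟨ha1 u hu, ?_⟩
      rw [mem_sh]
      constructor
      · intro i
        have := (norm_le_pi_norm _ (Sum.inl i)).trans (ha2 u hu)
        simp only [hv, Pi.sub_apply, Sum.elim_inl, Real.norm_eq_abs] at this
        rw [← sub_div, abs_div, abs_of_pos hP, div_le_iff₀ hP] at this
        simpa using this
      · intro i
        have := (norm_le_pi_norm _ (Sum.inr i)).trans (ha2 u hu)
        simp only [hv, Pi.sub_apply, Sum.elim_inr, Real.norm_eq_abs] at this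
        rw [← sub_div, abs_div, abs_of_pos hδ, div_le_iff₀ hδ] at this
        refine (dz_le _ (round (L u i) - round (L (a u) i))).trans (le_trans (le_of_eq ?_) this)
        have h1 := Lsub u (a u) i
        simp only [hL] at h1
        rw [h1]
        push_cast
        congr 1
        simp only [hL]
        ring
    refine (Finset.card_le_card this).trans (Finset.card_image_le.trans ?_)
    rw [Finset.card_product]
  calc (S.card : ℝ) ≤ S'.card * (sh Λ (κ * P) (κ * δ)).card := by exact_mod_cast hle
    _ ≤ _ := by gcongr

section Diff
variable {G R : Type*} [AddCommGroup G] [CommRing R]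

/-- iterated differences -/
def DK : (k : ℕ) → (G → R) → (Fin k → G) → G → R
  | 0, f, _ => f
  | k + 1, f, h => DK k (fwdDiff (h 0) f) (Fin.tail h)

/-- difference degree at most `k` -/
def dle : ℕ → (G → R) → Prop
  | 0, f => ∀ h, fwdDiff h f = 0
  | k + 1, f => ∀ h, dle k (fwdDiff h f)

lemma fwdDiff_comm' (a b : G) (f : G → R) :
    fwdDiff a (fwdDiff b f) = fwdDiff b (fwdDiff a f) := by
  funext x; simp only [fwdDiff]; rw [add_right_comm]; ring

lemma DK_add (k : ℕ) (f g : G → R) (h : Fin k → G) : DK k (f + g) h = DK k f h + DK k g h := by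
  induction k generalizing f g with
  | zero => rfl
  | succ k ih => simp only [DK]; rw [fwdDiff_add, ih]

lemma DK_fwdDiff (k : ℕ) (f : G → R) (h : Fin k → G) (a : G) :
    DK k (fwdDiff a f) h = fwdDiff a (DK k f h) := by
  induction k generalizing f with
  | zero => rfl
  | succ k ih => simp only [DK]; rw [fwdDiff_comm', ih]

lemma DK_smul (k : ℕ) (c : R) (f : G → R) (h : Fin k → G) (x : G) :
    DK k (fun y => c * f y) h x = c * DK k f h x := by
  induction k generalizing f x with
  | zero => rfl
  | succ k ih =>
    simp only [DK]; rw [← ih]; congr 1; funext y; simp only [fwdDiff]; ring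

lemma DK_shift (k : ℕ) (f : G → R) (h : Fin k → G) (a x : G) :
    DK k (fun y => f (y + a)) h x = DK k f h (x + a) := by
  induction k generalizing f x with
  | zero => rfl
  | succ k ih =>
    simp only [DK]; rw [← ih]; congr 1; funext y; simp only [fwdDiff]; rw [add_right_comm]

lemma dle_zero (k : ℕ) : dle k (0 : G → R) := by
  induction k with
  | zero => intro h; funext x; simp [fwdDiff]
  | succ k ih => intro h; have : fwdDiff h (0 : G → R) = 0 := by funext x; simp [fwdDiff]
                 rw [this]; exact ih

lemma dle_succ {k : ℕ} {f : G → R} (hf : dle k f) : dle (k + 1) f := by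
  induction k generalizing f with
  | zero => intro h; rw [hf h]; exact dle_zero _
  | succ k ih => intro h; exact ih (hf h)

lemma dle_mono {k l : ℕ} (hkl : k ≤ l) {f : G → R} (hf : dle k f) : dle l f := by
  induction hkl with
  | refl => exact hf
  | step _ ih => exact dle_succ ih

lemma dle_add {k : ℕ} {f g : G → R} (hf : dle k f) (hg : dle k g) : dle k (f + g) := by
  induction k generalizing f g with
  | zero => intro h; rw [fwdDiff_add, hf h, hg h, add_zero]
  | succ k ih => intro h; rw [fwdDiff_add]; exact ih (hf h) (hg h)

lemma dle_shift {k : ℕ} {f : G → R} (hf : dle k f) (a : G) : dle k (fun x => f (x + a)) := by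
  induction k generalizing f with
  | zero => intro h; funext x; have := congrFun (hf h) (x + a)
            simp only [fwdDiff] at this ⊢; rw [add_right_comm]; exact this
  | succ k ih => intro h
                 have := ih (hf h)
                 convert this using 1
                 funext x; simp only [fwdDiff]; rw [add_right_comm]

lemma dle_const_mul {k : ℕ} (c : R) {f : G → R} (hf : dle k f) : dle k (fun x => c * f x) := by
  induction k generalizing f with
  | zero => intro h; funext x; have := congrFun (hf h) x
            simp only [fwdDiff, Pi.zero_apply] at this ⊢; rw [← mul_sub, this, mul_zero]
  | succ k ih => intro h
                 have := ih (hf h)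
                 convert this using 1
                 funext x; simp only [fwdDiff]; ring

lemma dle_zero_const {f : G → R} (hf : dle 0 f) (x : G) : f x = f 0 := by
  have := congrFun (hf x) 0
  simp only [fwdDiff, zero_add, Pi.zero_apply] at this
  exact sub_eq_zero.1 this

lemma dle_mul {a b : ℕ} {f g : G → R} (hf : dle a f) (hg : dle b g) : dle (a + b) (f * g) := by
  obtain ⟨s, hs⟩ : ∃ s, s = a + b := ⟨_, rfl⟩
  induction s generalizing a b f g with
  | zero =>
    obtain ⟨rfl, rfl⟩ : a = 0 ∧ b = 0 := by omega
    intro h; funext x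
    simp [fwdDiff, dle_zero_const hf (x + h), dle_zero_const hg (x + h), dle_zero_const hf x,
      dle_zero_const hg x]
  | succ s ih =>
    rw [← hs]
    intro h
    have key : fwdDiff h (f * g) = fwdDiff h f * (fun x => g (x + h)) + f * fwdDiff h g := by
      funext x; simp [fwdDiff]; ring
    rw [key]
    apply dle_add
    · rcases a with _ | a
      · rw [hf h, zero_mul]; exact dle_zero _
      · have := ih (hf h) (dle_shift hg h) (by omega)
        rwa [show s = a + b by omega]
    · rcases b with _ | b
      · rw [hg h, mul_zero]; exact dle_zero _
      · have := ih hf (hg h) (by omega)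
        rwa [show s = a + b by omega]

lemma dle_pow {a : ℕ} {f : G → R} (hf : dle a f) (e : ℕ) : dle (e * a) (f ^ e) := by
  induction e with
  | zero => rw [zero_mul, pow_zero]; intro h; funext x; simp [fwdDiff]
  | succ e ih => rw [pow_succ, Nat.succ_mul]; exact dle_mul ih hf

lemma dle_prod {ι : Type*} (s : Finset ι) (a : ι → ℕ) (f : ι → G → R) (hf : ∀ i ∈ s, dle (a i) (f i)) :
    dle (∑ i ∈ s, a i) (∏ i ∈ s, f i) := by
  classical
  induction s using Finset.induction_on with
  | empty => intro h; funext x; simp [fwdDiff]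
  | insert i s his ih =>
    rw [Finset.sum_insert his, Finset.prod_insert his]
    exact dle_mul (hf _ (Finset.mem_insert_self _ _)) (ih fun j hj => hf j (Finset.mem_insert_of_mem hj))

lemma dle_sum {ι : Type*} (s : Finset ι) (a : ℕ) (f : ι → G → R) (hf : ∀ i ∈ s, dle a (f i)) :
    dle a (∑ i ∈ s, f i) := by
  classical
  induction s using Finset.induction_on with
  | empty => exact dle_zero _
  | insert i s his ih =>
    rw [Finset.sum_insert his]
    exact dle_add (hf _ (Finset.mem_insert_self _ _)) (ih fun j hj => hf j (Finset.mem_insert_of_mem hj))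

lemma DK_top {k : ℕ} {f : G → R} (hf : dle k f) (h : Fin k → G) (x : G) :
    DK k f h x = DK k f h 0 := by
  induction k generalizing f with
  | zero => exact dle_zero_const hf x
  | succ k ih => exact ih (hf _) _

lemma DK_zero_of_dle {k : ℕ} {f : G → R} (hf : dle k f) (h : Fin (k + 1) → G) :
    DK (k + 1) f h = 0 := by
  induction k generalizing f with
  | zero => exact hf _
  | succ k ih => exact ih (hf _) _

lemma DK_update_add {k : ℕ} {f : G → R} (hf : dle k f) (h : Fin k → G) (i : Fin k) (a b : G) (x : G) :
    DK k f (Function.update h i (a + b)) x =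
      DK k f (Function.update h i a) x + DK k f (Function.update h i b) x := by
  induction k generalizing f with
  | zero => exact i.elim0
  | succ k ih =>
    simp only [DK]
    refine Fin.cases ?_ (fun j => ?_) i
    · simp only [Function.update_self, Fin.tail_update_zero]
      have : fwdDiff (a + b) f = (fun y => fwdDiff a f (y + b)) + fwdDiff b f := by
        funext y; simp only [fwdDiff, Pi.add_apply]; rw [add_comm a b, add_assoc]; ring
      rw [this, DK_add, Pi.add_apply, DK_shift, DK_top (hf a), DK_top (hf a) _ x]
    · have h0 : ∀ c, Function.update h j.succ c 0 = h 0 := fun c =>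
        Function.update_of_ne (Fin.succ_ne_zero j).symm _ _
      simp only [h0, Fin.tail_update_succ]
      exact ih (hf _) _ _

lemma DK_formula (k : ℕ) (f : G → R) (h : Fin k → G) (x : G) :
    DK k f h x = ∑ ω : Fin k → Bool, (∏ i, if ω i then (1 : R) else -1) *
      f (x + ∑ i, if ω i then h i else 0) := by
  induction k generalizing f x with
  | zero => simp [DK]
  | succ k ih =>
    simp only [DK]
    rw [ih, ← (Fin.consEquiv (fun _ => Bool)).sum_comp, Fintype.sum_prod_type]
    simp only [Fintype.sum_bool, ← Finset.sum_add_distrib]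
    refine Finset.sum_congr rfl fun ω _ => ?_
    simp only [Fin.consEquiv_apply, Fin.prod_univ_succ, Fin.sum_univ_succ, Fin.cons_zero, Fin.cons_succ,
      fwdDiff, Fin.tail, if_true]
    rw [show x + (h 0 + ∑ i : Fin k, if ω i = true then h i.succ else 0) =
      (x + ∑ i : Fin k, if ω i = true then h i.succ else 0) + h 0 by abel]
    simp
    ring

lemma DK_perm (k : ℕ) (f : G → R) (h : Fin k → G) (x : G) (σ : Equiv.Perm (Fin k)) :
    DK k f (h ∘ σ) x = DK k f h x := by
  rw [DK_formula, DK_formula, ← (σ.arrowCongr (Equiv.refl Bool)).symm.sum_comp]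
  refine Finset.sum_congr rfl fun ω _ => ?_
  congr 1
  · exact Equiv.prod_comp σ (fun i => if ω i then (1 : R) else -1)
  · congr 2
    exact Equiv.sum_comp σ (fun i => if ω i then h i else 0)

lemma DK_cons {k : ℕ} (f : G → R) (h : Fin k → G) (y : G) :
    DK k f h y = DK k f h 0 + DK (k + 1) f (Fin.cons y h) 0 := by
  have : DK (k + 1) f (Fin.cons y h) = DK k (fwdDiff y f) h := by simp [DK]
  rw [this, DK_fwdDiff]; simp [fwdDiff]

end Diff

lemma dle_eval {m d : ℕ} (F : MvPolynomial (Fin m) ℤ) (hF : F.IsHomogeneous d) :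
    dle d (fun x : Fin m → ℤ => eval x F) := by
  have e : (fun x : Fin m → ℤ => eval x F) =
      ∑ s ∈ F.support, fun x => F.coeff s * (∏ i, (fun x : Fin m → ℤ => x i) ^ (s i)) x := by
    funext x
    rw [eval_eq', Finset.sum_apply]
    refine Finset.sum_congr rfl fun s _ => ?_
    simp [Finset.prod_apply]
  rw [e]
  apply dle_sum
  intro s hs
  apply dle_const_mul
  have hs' := hF (mem_support_iff.1 hs)
  have : d = ∑ i, s i * 1 := by
    rw [← hs']; simp [Finsupp.weight_apply, Finsupp.sum_fintype]
  rw [this]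
  apply dle_prod
  intro i _
  apply dle_pow
  intro a b
  funext x
  simp [fwdDiff]

lemma hom_eval_mul {m d : ℕ} {R : Type*} [CommRing R] (F : MvPolynomial (Fin m) R) (hF : F.IsHomogeneous d)
    (t : R) (x : Fin m → R) : eval (fun i => t * x i) F = t ^ d * eval x F := by
  rw [eval_eq', eval_eq', Finset.mul_sum]
  refine Finset.sum_congr rfl fun s hs => ?_
  have hs' := hF (mem_support_iff.1 hs)
  have : d = ∑ i, s i := by
    rw [← hs']; simp [Finsupp.weight_apply, Finsupp.sum_fintype]
  simp only [mul_pow]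
  rw [Finset.prod_mul_distrib, Finset.prod_pow_eq_pow_sum, ← this]; ring

lemma DK_const {m d : ℕ} (F : MvPolynomial (Fin m) ℤ) (hF : F.IsHomogeneous d) (x : Fin m → ℤ) :
    DK d (fun x : Fin m → ℤ => eval x F) (fun _ => x) 0 = d.factorial * eval x F := by
  have h1 : ∀ (k : ℕ) (f : (Fin m → ℤ) → ℤ) (y : Fin m → ℤ) (t : ℤ),
      DK k f (fun _ => x) (t • x) = (fwdDiff 1)^[k] (fun r : ℤ => f (r • x)) t := by
    intro k
    induction k with
    | zero => intro f y t; rfl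
    | succ k ih =>
      intro f y t
      simp only [DK]
      have : Fin.tail (fun _ : Fin (k + 1) => x) = fun _ => x := rfl
      rw [this, ih _ y, Function.iterate_succ_apply]
      have e : (fun r : ℤ => fwdDiff x f (r • x)) = fwdDiff 1 (fun r : ℤ => f (r • x)) := by
        funext r; simp only [fwdDiff]; rw [add_smul, one_smul]
      rw [e]
  have h2 := h1 d (fun x : Fin m → ℤ => eval x F) 0 0
  rw [zero_smul] at h2
  rw [h2]
  have h3 : (fun r : ℤ => eval (r • x) F) = fun r : ℤ => (eval x F) • (r ^ d) := by
    funext r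
    have := hom_eval_mul F hF r x
    rw [smul_eq_mul, mul_comm, ← this]; rfl
  rw [h3]
  have h4 := fwdDiff_iter_const_smul (h := (1 : ℤ)) (eval x F) (fun r : ℤ => r ^ d) d
  rw [show (fun r : ℤ => (eval x F) • (r ^ d)) = (eval x F) • (fun r : ℤ => r ^ d) from rfl, h4,
    fwdDiff_iter_eq_factorial]
  simp [mul_comm]

/-- the polar form -/
lemma polar {m k : ℕ} (F : MvPolynomial (Fin m) ℤ) (hF : F.IsHomogeneous (k + 1)) :
    ∃ c : (Fin (k + 1) → Fin m) → ℤ, (∀ ι (σ : Equiv.Perm (Fin (k + 1))), c (ι ∘ σ) = c ι) ∧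
      (C ((k + 1).factorial : ℤ) * F = ∑ ι, C (c ι) * ∏ j, X (ι j)) ∧
      (∀ (h : Fin k → Fin m → ℤ) y, DK k (fun x : Fin m → ℤ => eval x F) h y =
        DK k (fun x : Fin m → ℤ => eval x F) h 0 +
        ∑ ι : Fin (k + 1) → Fin m, c ι * (y (ι 0) * ∏ j : Fin k, h j (ι j.succ))) := by
  set f : (Fin m → ℤ) → ℤ := fun x => eval x F with hf
  have hdle : dle (k + 1) f := dle_eval F hF
  let M : MultilinearMap ℤ (fun _ : Fin (k + 1) => Fin m → ℤ) ℤ :=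
    { toFun := fun h => DK (k + 1) f h 0
      map_update_add' := by
        intro inst h i a b
        have : inst = instDecidableEqFin (k + 1) := Subsingleton.elim _ _
        subst this
        exact DK_update_add hdle h i a b 0
      map_update_smul' := by
        intro inst h i a b
        have : inst = instDecidableEqFin (k + 1) := Subsingleton.elim _ _
        subst this
        let φ : (Fin m → ℤ) →+ ℤ := AddMonoidHom.mk' (fun b => DK (k + 1) f (Function.update h i b) 0)
          (fun a b => DK_update_add hdle h i a b 0)
        exact map_zsmul φ a b }
  have hM : ∀ h, M h = DK (k + 1) f h 0 := fun h => rfl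
  let c : (Fin (k + 1) → Fin m) → ℤ := fun ι => M (fun j => Pi.single (ι j) 1)
  have hexp : ∀ h, M h = ∑ ι, c ι * ∏ j, h j (ι j) := by
    intro h
    have e : h = fun j => ∑ i, h j i • (Pi.single i (1 : ℤ) : Fin m → ℤ) := by
      funext j i
      simp [Pi.single_apply]
    conv_lhs => rw [e]
    rw [M.map_sum]
    refine Finset.sum_congr rfl fun ι _ => ?_
    rw [M.map_smul_univ (fun j => h j (ι j)) (fun j => Pi.single (ι j) 1), smul_eq_mul, mul_comm]
  refine ⟨c, ?_, ?_, ?_⟩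
  · intro ι σ
    have := DK_perm (k + 1) f (fun j => Pi.single (ι j) 1) 0 σ
    exact this
  · apply MvPolynomial.funext
    intro x
    have h1 := DK_const F hF x
    have h2 := hexp (fun _ => x)
    rw [hM, h1] at h2
    simp only [map_mul, eval_C, map_sum, map_prod, eval_X]
    exact h2
  · intro h y
    rw [DK_cons, ← hM, hexp]
    congr 1
    refine Finset.sum_congr rfl fun ι _ => ?_
    rw [Fin.prod_univ_succ]; simp

lemma pderiv_prod {σ ι R : Type*} [CommRing R] [DecidableEq ι] (i : σ) (s : Finset ι) (f : ι → MvPolynomial σ R) :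
    pderiv i (∏ j ∈ s, f j) = ∑ j ∈ s, (∏ l ∈ s.erase j, f l) * pderiv i (f j) := by
  induction s using Finset.induction_on with
  | empty => simp
  | insert a s has ih =>
    rw [Finset.prod_insert has, pderiv_mul, ih, Finset.sum_insert has, Finset.erase_insert has,
      Finset.mul_sum]
    congr 1
    · ring
    · refine Finset.sum_congr rfl fun j hj => ?_
      have : a ≠ j := fun h => has (h ▸ hj)
      rw [Finset.erase_insert_of_ne this, Finset.prod_insert (fun h => has (Finset.mem_of_mem_erase h))]
      ring

lemma polar_pderiv {m k : ℕ} (F : MvPolynomial (Fin m) ℤ) (c : (Fin (k + 1) → Fin m) → ℤ)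
    (hsym : ∀ ι (σ : Equiv.Perm (Fin (k + 1))), c (ι ∘ σ) = c ι)
    (hpoly : C ((k + 1).factorial : ℤ) * F = ∑ ι, C (c ι) * ∏ j, X (ι j)) (i : Fin m) :
    C (k.factorial : ℤ) * pderiv i F = ∑ κ : Fin k → Fin m, C (c (Fin.cons i κ)) * ∏ j, X (κ j) := by
  have h1 := congrArg (pderiv i) hpoly
  rw [pderiv_C_mul, map_sum] at h1
  simp only [pderiv_C_mul, pderiv_prod, pderiv_X, Finset.mul_sum] at h1
  rw [Finset.sum_comm] at h1
  have h2 : ∀ j : Fin (k + 1), (∑ ι : Fin (k + 1) → Fin m, C (c ι) * ((∏ l ∈ Finset.univ.erase j, X (ι l)) *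
      (Pi.single i 1 : Fin m → MvPolynomial (Fin m) ℤ) (ι j))) =
      ∑ κ : Fin k → Fin m, C (c (Fin.cons i κ)) * ∏ j, X (κ j) := by
    intro j
    rw [← ((Equiv.swap 0 j).arrowCongr (Equiv.refl (Fin m))).symm.sum_comp]
    have h3 : ∀ ι : Fin (k + 1) → Fin m, ((Equiv.swap 0 j).arrowCongr (Equiv.refl (Fin m))).symm ι
      = ι ∘ Equiv.swap 0 j := fun ι => rfl
    simp only [h3, hsym, Function.comp_apply, Equiv.swap_apply_right]
    have h4 : ∀ ι : Fin (k + 1) → Fin m, ∏ l ∈ Finset.univ.erase j, (X (ι (Equiv.swap 0 j l)) : MvPolynomial (Fin m) ℤ)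
      = ∏ l : Fin k, X (ι l.succ) := by
      intro ι
      rw [← Finset.prod_image (s := Finset.univ.erase j) (g := Equiv.swap 0 j) (f := fun l => (X (ι l) : MvPolynomial (Fin m) ℤ))
        (fun a _ b _ h => (Equiv.swap 0 j).injective h)]
      have : (Finset.univ.erase j).image (Equiv.swap 0 j) = (Finset.univ : Finset (Fin k)).image Fin.succ := by
        ext l
        simp only [Finset.mem_image, Finset.mem_erase, Finset.mem_univ, and_true, true_and]
        constructor
        · rintro ⟨a, ha, rfl⟩
          apply Fin.exists_succ_eq.2
          intro h0
          apply ha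
          rw [Equiv.swap_apply_eq_iff, Equiv.swap_apply_left] at h0
          exact h0
        · rintro ⟨a, rfl⟩
          refine ⟨Equiv.swap 0 j a.succ, ?_, by simp⟩
          intro h
          rw [Equiv.swap_apply_eq_iff] at h
          simp at h
      rw [this, Finset.prod_image (fun a _ b _ h => Fin.succ_injective _ h)]
    simp only [h4]
    rw [← (Fin.consEquiv (fun _ => Fin m)).sum_comp, Fintype.sum_prod_type, Finset.sum_comm]
    refine Finset.sum_congr rfl fun κ _ => ?_
    simp [Pi.single_apply]
    exact Or.inl rfl
  rw [Finset.sum_congr rfl (fun j _ => h2 j)] at h1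
  rw [Finset.sum_const, Finset.card_univ, Fintype.card_fin, nsmul_eq_mul] at h1
  have h5 : ((k + 1 : ℕ) : MvPolynomial (Fin m) ℤ) ≠ 0 := by exact_mod_cast Nat.succ_ne_zero k
  apply mul_left_cancel₀ h5
  rw [← h1, Nat.factorial_succ]
  push_cast
  simp only [map_mul, map_add, map_natCast, map_one]
  ring

def evZ {m : ℕ} {K : Type*} [Field K] (Z : Finset (Fin m → K)) :
    MvPolynomial (Fin m) K →ₗ[K] (Z → K) :=
  LinearMap.pi fun z => (aeval (R := K) (z : Fin m → K)).toLinearMap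

lemma evZ_apply {m : ℕ} {K : Type*} [Field K] (Z : Finset (Fin m → K)) (p) (z : Z) :
    evZ Z p z = eval (z : Fin m → K) p := by
  simp [evZ, aeval_eq_eval]

lemma evZ_surj {m : ℕ} {K : Type*} [Field K] (Z : Finset (Fin m → K)) :
    LinearMap.range (evZ Z) = ⊤ := by
  classical
  rw [eq_top_iff]
  intro f _
  have hs : ∀ z : Z, Pi.single z (1 : K) ∈ LinearMap.range (evZ Z) := by
    intro z
    have : ∀ w : Z, w ≠ z → ∃ i, (w : Fin m → K) i ≠ (z : Fin m → K) i := by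
      intro w hw
      by_contra! h
      exact hw (Subtype.ext (funext h))
    let P : MvPolynomial (Fin m) K := ∏ w : Z, if h : w = z then 1 else
      (X (this w h).choose - C ((w : Fin m → K) (this w h).choose))
    have h1 : eval (z : Fin m → K) P ≠ 0 := by
      simp only [P, map_prod]
      rw [Finset.prod_ne_zero_iff]
      intro w _
      split_ifs with h
      · simp
      · simp only [map_sub, eval_X, eval_C]
        exact sub_ne_zero.mpr (this w h).choose_spec.symm
    have h2 : ∀ w : Z, w ≠ z → eval (w : Fin m → K) P = 0 := by
      intro w hw
      simp only [P, map_prod]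
      apply Finset.prod_eq_zero (Finset.mem_univ w)
      simp [hw]
    refine ⟨C (eval (z : Fin m → K) P)⁻¹ * P, ?_⟩
    ext w
    rw [evZ_apply]
    by_cases h : w = z
    · subst h; simp [h1]
    · simp [h, h2 w h]
  have : f = ∑ z, f z • Pi.single z (1 : K) := by
    ext w; simp [Finset.sum_apply, Pi.single_apply]
  rw [this]
  exact Submodule.sum_mem _ fun z _ => Submodule.smul_mem _ _ (hs z)

lemma bdd_zeros {m M : ℕ} {K : Type*} [Field K] (Z : Finset (Fin m → K))
    (hr : ∀ j : Fin m, ∃ r : MvPolynomial (Fin m) K, r.totalDegree < M ∧ ∀ z ∈ Z, z j ^ M = eval z r) :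
    Z.card ≤ M ^ m := by
  classical
  choose r hrd hr using hr
  let b : (Fin m → Fin M) → (Z → K) := fun e => evZ Z (monomial (Finsupp.equivFunOnFinite.symm fun i => (e i : ℕ)) 1)
  let W := Submodule.span K (Set.range b)
  have key : ∀ n : ℕ, ∀ p : MvPolynomial (Fin m) K, p.totalDegree ≤ n → evZ Z p ∈ W := by
    intro n
    induction n using Nat.strong_induction_on with
    | _ n ih =>
    intro p hp
    rw [p.as_sum, map_sum]
    refine Submodule.sum_mem _ fun s hs => ?_
    have hsd : s.degree ≤ n := (le_totalDegree hs).trans hp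
    rw [show monomial s (coeff s p) = coeff s p • monomial s (1:K) by simp [smul_monomial], map_smul]
    refine Submodule.smul_mem _ _ ?_
    by_cases h : ∀ i, s i < M
    · refine Submodule.subset_span ⟨fun i => ⟨s i, h i⟩, ?_⟩
      simp only [b]
      congr 2
      ext i; simp
    · push Not at h
      obtain ⟨j, hj⟩ := h
      have e1 : s = (s - Finsupp.single j M) + Finsupp.single j M := by
        rw [tsub_add_cancel_of_le]; simpa using hj
      have e2 : evZ Z (monomial s 1) = evZ Z (monomial (s - Finsupp.single j M) 1 * r j) := by
        ext z
        rw [evZ_apply, evZ_apply, map_mul, ← hr j z z.2]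
        conv_lhs => rw [e1]
        rw [monomial_add_single, map_mul, map_pow, eval_X]
      rw [e2]
      have hdeg : s.degree = (s - Finsupp.single j M).degree + M := by
        conv_lhs => rw [e1]
        rw [map_add, Finsupp.degree_single]
      have hm : (monomial (s - Finsupp.single j M) (1:K)).totalDegree ≤ (s - Finsupp.single j M).degree :=
        totalDegree_monomial_le _ _
      have := totalDegree_mul (monomial (s - Finsupp.single j M) (1:K)) (r j)
      have h3 := hrd j
      exact ih _ (by omega) _ le_rfl
  have hW : W = ⊤ := by
    rw [eq_top_iff, ← evZ_surj Z]
    rintro _ ⟨p, rfl⟩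
    exact key _ p le_rfl
  have h1 := finrank_range_le_card (R := K) b
  have h2 : Set.finrank K (Set.range b) = Z.card := by
    change Module.finrank K W = _
    rw [hW, finrank_top]; simp
  rw [h2] at h1
  simpa using h1

lemma clear_den {σ : Type*} (b : MvPolynomial σ ℚ) :
    ∃ D : ℤ, D ≠ 0 ∧ ∃ b' : MvPolynomial σ ℤ, map (Int.castRingHom ℚ) b' = C (D : ℚ) * b := by
  classical
  induction b using MvPolynomial.induction_on' with
  | monomial s a =>
    refine ⟨a.den, by exact_mod_cast a.den_ne_zero, monomial s a.num, ?_⟩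
    rw [map_monomial, C_mul_monomial]
    congr 1
    simp [Rat.den_mul_eq_num]
  | add p q hp hq =>
    obtain ⟨D, hD, b, hb⟩ := hp
    obtain ⟨E, hE, c, hc⟩ := hq
    refine ⟨D * E, mul_ne_zero hD hE, C E * b + C D * c, ?_⟩
    rw [map_add, map_mul, map_mul, hb, hc]
    simp only [map_C, Int.cast_mul, C_mul]
    simp
    ring

lemma null_general {σ ι : Type*} [Finite σ] [Fintype ι] (q : ι → MvPolynomial σ ℤ) (f : MvPolynomial σ ℤ)
    (h : ∀ z : σ → ℂ, (∀ i, aeval z (q i) = 0) → aeval z f = 0) :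
    ∃ D : ℤ, D ≠ 0 ∧ ∃ (M : ℕ) (a : ι → MvPolynomial σ ℤ), C D * f ^ M = ∑ i, a i * q i := by
  classical
  let φ := map (σ := σ) (Int.castRingHom ℚ)
  have hφ : ∀ (z : σ → ℂ) p, aeval z (φ p) = aeval z p := by
    intro z p
    simp only [φ]
    rw [show (Int.castRingHom ℚ) = algebraMap ℤ ℚ from rfl, aeval_map_algebraMap]
  let I : Ideal (MvPolynomial σ ℚ) := Ideal.span (Set.range fun i => φ (q i))
  have h1 : φ f ∈ vanishingIdeal ℚ (zeroLocus ℂ I) := by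
    rw [mem_vanishingIdeal_iff]
    intro z hz
    rw [mem_zeroLocus_iff] at hz
    rw [hφ]
    apply h
    intro i
    rw [← hφ]
    exact hz _ (Ideal.subset_span ⟨i, rfl⟩)
  rw [vanishingIdeal_zeroLocus_eq_radical] at h1
  obtain ⟨M, hM⟩ := h1
  rw [Ideal.mem_span_range_iff_exists_fun] at hM
  obtain ⟨c, hc⟩ := hM
  choose D hD b hb using fun i => clear_den (c i)
  refine ⟨∏ i, D i, Finset.prod_ne_zero_iff.mpr fun i _ => hD i, M,
    fun i => C (∏ j ∈ Finset.univ.erase i, D j) * b i, ?_⟩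
  apply map_injective (Int.castRingHom ℚ) Int.cast_injective
  rw [map_mul, map_pow, map_sum]
  change _ * (φ f) ^ M = _
  rw [← hc, Finset.mul_sum]
  refine Finset.sum_congr rfl fun i _ => ?_
  rw [map_mul, map_mul, hb, ← Finset.mul_prod_erase Finset.univ D (Finset.mem_univ i)]
  simp [φ]
  ring

lemma card_bx_le (m : ℕ) (P : ℝ) (hP : 0 ≤ P) : ((bx m P).card : ℝ) ≤ (2 * P + 1) ^ m := by
  rw [bx, Fintype.card_piFinset]
  simp only [Finset.prod_const, Finset.card_univ, Fintype.card_fin, Int.card_Icc]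
  push_cast
  gcongr
  have h0 : 0 ≤ ⌊P⌋ := Int.floor_nonneg.mpr hP
  have h1 := Int.floor_le P
  rw [← Int.cast_natCast, Int.toNat_of_nonneg (by omega)]
  push_cast
  linarith

lemma homcomp_mul {σ R : Type*} [CommRing R] (k n : ℕ) (hk : k ≤ n) (a b : MvPolynomial σ R) (hb : b.IsHomogeneous k) :
   homogeneousComponent n (a * b) = homogeneousComponent (n - k) a * b := by
  classical
  let : GradedAlgebra (homogeneousSubmodule σ R) := MvPolynomial.gradedAlgebra
  have := DirectSum.coe_decompose_mul_of_right_mem_of_le (homogeneousSubmodule σ R)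
    (a := a) (b := b) (n := n) (i := k) ((mem_homogeneousSubmodule _ _).mpr hb) hk
  rw [← decomposition.decompose'_apply, ← decomposition.decompose'_apply]
  exact this

lemma smooth_id {m k : ℕ} (F : MvPolynomial (Fin m) ℤ) (hF : F.IsHomogeneous (k + 1))
    (hsmooth : ∀ z : Fin m → ℂ, z ≠ 0 → eval z (map (Int.castRingHom ℂ) F) = 0 →
      ∃ i, eval z (pderiv i (map (Int.castRingHom ℂ) F)) ≠ 0) :
    ∃ D : ℤ, D ≠ 0 ∧ ∃ M : ℕ, k ≤ M ∧ ∃ a : Fin m → Fin m → MvPolynomial (Fin m) ℤ,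
      (∀ j, C D * X j ^ M = ∑ i, a j i * pderiv i F) ∧ ∀ j i, (a j i).IsHomogeneous (M - k) := by
  classical
  have hev : ∀ (z : Fin m → ℂ) (p : MvPolynomial (Fin m) ℤ), aeval z p = eval z (map (Int.castRingHom ℂ) p) := by
    intro z p
    rw [eval_map, aeval_def]
    rfl
  have h0 : ∀ z : Fin m → ℂ, (∀ i, aeval z (pderiv i F) = 0) → z = 0 := by
    intro z hz
    by_contra hne
    have he := congrArg (aeval z) hF.sum_X_mul_pderiv
    rw [map_sum] at he
    simp only [map_mul, hz, mul_zero, Finset.sum_const_zero, map_nsmul] at he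
    have hF0 : aeval z F = 0 := by
      rw [nsmul_eq_mul] at he
      rcases mul_eq_zero.mp he.symm with h | h
      · exact absurd h (by exact_mod_cast Nat.succ_ne_zero k)
      · exact h
    rw [hev] at hF0
    obtain ⟨i, hi⟩ := hsmooth z hne hF0
    apply hi
    rw [← hz i, hev, pderiv_map]
  have h1 : ∀ j : Fin m, ∃ D : ℤ, D ≠ 0 ∧ ∃ (M : ℕ) (a : Fin m → MvPolynomial (Fin m) ℤ),
      C D * X j ^ M = ∑ i, a i * pderiv i F := by
    intro j
    apply null_general
    intro z hz
    rw [h0 z hz]; simp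
  choose D hD M a ha using h1
  let M0 := (∑ j, M j) + k
  have hM : ∀ j, M j ≤ M0 := fun j => by
    have := Finset.single_le_sum (f := M) (fun _ _ => Nat.zero_le _) (Finset.mem_univ j)
    omega
  let b : Fin m → Fin m → MvPolynomial (Fin m) ℤ := fun j i =>
    C (∏ l ∈ Finset.univ.erase j, D l) * X j ^ (M0 - M j) * a j i
  have hb : ∀ j, C (∏ l, D l) * X j ^ M0 = ∑ i, b j i * pderiv i F := by
    intro j
    simp only [b, mul_assoc]
    rw [← Finset.mul_sum, ← Finset.mul_sum, ← ha j, ← Finset.mul_prod_erase Finset.univ D (Finset.mem_univ j)]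
    conv_lhs => rw [← Nat.sub_add_cancel (hM j), pow_add]
    rw [C_mul]; ring
  refine ⟨∏ l, D l, Finset.prod_ne_zero_iff.mpr fun i _ => hD i, M0, Nat.le_add_left _ _,
    fun j i => homogeneousComponent (M0 - k) (b j i), ?_, fun j i => homogeneousComponent_isHomogeneous _ _⟩
  intro j
  have h2 := congrArg (homogeneousComponent M0) (hb j)
  rw [homogeneousComponent_C_mul, homogeneousComponent_of_mem (isHomogeneous_X_pow j M0), if_pos rfl, map_sum] at h2
  rw [h2]
  refine Finset.sum_congr rfl fun i _ => ?_
  have hp : (pderiv i F).IsHomogeneous k := by simpa using hF.pderiv (i := i)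
  exact homcomp_mul k M0 (Nat.le_add_left _ _) _ _ hp

/-- the multilinear forms -/
def psi {m k : ℕ} (c : (Fin (k + 1) → Fin m) → ℤ) (h : Fin k → Fin m → ℤ) (i : Fin m) : ℤ :=
  ∑ κ : Fin k → Fin m, c (Fin.cons i κ) * ∏ j, h j (κ j)

lemma prod_low {m k : ℕ} {K : Type*} [Field K] (s : Finset (Fin k)) (κ : Fin k → Fin m) (v : Fin k → K) :
    (∏ j ∈ s, (X (κ j) + C (v j)) - ∏ j ∈ s, X (κ j) : MvPolynomial (Fin m) K).totalDegree ≤ s.card - 1 := by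
  classical
  induction s using Finset.induction_on with
  | empty => simp
  | insert j s hj ih =>
    rw [Finset.prod_insert hj, Finset.prod_insert hj, Finset.card_insert_of_notMem hj]
    have e : ((X (κ j) + C (v j)) * ∏ j ∈ s, (X (κ j) + C (v j)) - X (κ j) * ∏ j ∈ s, X (κ j) : MvPolynomial (Fin m) K)
      = X (κ j) * (∏ j ∈ s, (X (κ j) + C (v j)) - ∏ j ∈ s, X (κ j)) + C (v j) * ∏ j ∈ s, (X (κ j) + C (v j)) := by ring
    rw [e]
    rcases s.eq_empty_or_nonempty with rfl | hs
    · simp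
    have hc := hs.card_pos
    refine (totalDegree_add _ _).trans (max_le ?_ ?_)
    · refine (totalDegree_mul _ _).trans ?_
      rw [totalDegree_X]; omega
    · refine (totalDegree_mul _ _).trans ?_
      rw [totalDegree_C, zero_add]
      refine (totalDegree_finsetProd _ _).trans ?_
      have : ∀ i ∈ s, (X (κ i) + C (v i) : MvPolynomial (Fin m) K).totalDegree ≤ 1 := by
        intro i _
        refine (totalDegree_add _ _).trans ?_
        simp
      refine (Finset.sum_le_sum this).trans ?_
      simp

lemma psi_count {m k : ℕ} (F : MvPolynomial (Fin m) ℤ) (hF : F.IsHomogeneous (k + 1 + 1))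
    (hsmooth : ∀ z : Fin m → ℂ, z ≠ 0 → eval z (map (Int.castRingHom ℂ) F) = 0 →
      ∃ i, eval z (pderiv i (map (Int.castRingHom ℂ) F)) ≠ 0)
    (c : (Fin (k + 1 + 1) → Fin m) → ℤ)
    (hsym : ∀ ι (σ : Equiv.Perm (Fin (k + 1 + 1))), c (ι ∘ σ) = c ι)
    (hpoly : C ((k + 1 + 1).factorial : ℤ) * F = ∑ ι, C (c ι) * ∏ j, X (ι j)) :
    ∃ C0 : ℝ, 0 < C0 ∧ ∀ U : ℝ, 1 ≤ U → ∀ S : Finset (Fin (k + 1) → Fin m → ℤ),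
      (∀ h ∈ S, (∀ j, h j ∈ bx m U) ∧ ∀ i, psi c h i = 0) → (S.card : ℝ) ≤ C0 * U ^ (m * k) := by
  classical
  obtain ⟨D, hD, M, hkM, a, ha, hah⟩ := smooth_id F hF hsmooth
  refine ⟨M ^ m * 5 ^ (m * k) + 1, by positivity, ?_⟩
  intro U hU S hS
  let v : (Fin (k + 1) → Fin m → ℤ) → (Fin k → Fin m → ℤ) := fun h j => h j.succ - h 0
  let T : Finset (Fin k → Fin m → ℤ) := Fintype.piFinset fun _ => bx m (2 * U)
  have hmaps : ∀ h ∈ S, v h ∈ T := by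
    intro h hh
    simp only [T, Fintype.mem_piFinset, mem_bx]
    intro j i
    have h1 := mem_bx.mp ((hS h hh).1 j.succ) i
    have h2 := mem_bx.mp ((hS h hh).1 0) i
    simp only [v, Pi.sub_apply, Int.cast_sub]
    refine (abs_sub _ _).trans ?_
    linarith
  have hfib : ∀ w ∈ T, (S.filter fun h => v h = w).card ≤ M ^ m := by
    intro w _
    let ρ : (Fin (k + 1) → Fin m → ℤ) → (Fin m → ℚ) := fun h i => (h 0 i : ℚ)
    have hinj : Set.InjOn ρ (S.filter fun h => v h = w) := by
      intro h hh h' hh' he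
      simp only [Finset.coe_filter, Set.mem_ofPred_eq] at hh hh'
      have h0 : h 0 = h' 0 := by
        ext i
        have := congrFun he i
        simpa [ρ] using this
      funext j
      refine Fin.cases h0 (fun j => ?_) j
      have := congrFun (hh.2.trans hh'.2.symm) j
      simp only [v, h0] at this
      exact sub_left_injective this
    rw [← Finset.card_image_of_injOn hinj]
    apply bdd_zeros
    intro j
    let w' : Fin (k + 1) → Fin m → ℤ := Fin.cons 0 w
    let q : Fin m → MvPolynomial (Fin m) ℚ := fun i =>
      ∑ κ : Fin (k + 1) → Fin m, C (c (Fin.cons i κ) : ℚ) * ∏ j, (X (κ j) + C (w' j (κ j) : ℚ))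
    let q0 : Fin m → MvPolynomial (Fin m) ℚ := fun i =>
      ∑ κ : Fin (k + 1) → Fin m, C (c (Fin.cons i κ) : ℚ) * ∏ j, X (κ j)
    let φ := map (σ := Fin m) (Int.castRingHom ℚ)
    have hq0 : ∀ i, q0 i = C ((k + 1).factorial : ℚ) * φ (pderiv i F) := by
      intro i
      have := congrArg φ (polar_pderiv F c hsym hpoly i)
      simp only [φ, map_mul, map_sum, map_prod, map_C, map_X] at this
      simpa [q0] using this.symm
    have hlow : ∀ i, (q i - q0 i).totalDegree ≤ k := by
      intro i
      simp only [q, q0, ← Finset.sum_sub_distrib, ← mul_sub]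
      refine totalDegree_finsetSum_le fun κ _ => ?_
      refine (totalDegree_mul _ _).trans ?_
      rw [totalDegree_C, zero_add]
      simpa using prod_low Finset.univ κ fun j => (w' j (κ j) : ℚ)
    have hDq : ((D : ℚ) * (k + 1).factorial) ≠ 0 :=
      mul_ne_zero (by exact_mod_cast hD) (by exact_mod_cast Nat.factorial_ne_zero _)
    refine ⟨C ((D : ℚ) * (k + 1).factorial)⁻¹ * (- ∑ i, φ (a j i) * (q i - q0 i)), ?_, ?_⟩
    · refine (totalDegree_mul _ _).trans_lt ?_
      rw [totalDegree_C, zero_add, totalDegree_neg]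
      refine lt_of_le_of_lt (b := M - (k + 1) + k) ?_ (by omega)
      refine totalDegree_finsetSum_le fun i _ => ?_
      refine (totalDegree_mul _ _).trans ?_
      have : (φ (a j i)).totalDegree ≤ M - (k + 1) :=
        ((hah j i).map (Int.castRingHom ℚ)).totalDegree_le
      have := hlow i
      omega
    · intro z hz
      obtain ⟨h, hh, rfl⟩ := Finset.mem_image.mp hz
      obtain ⟨hhS, hw⟩ := Finset.mem_filter.mp hh
      have hqz : ∀ i, eval (ρ h) (q i) = 0 := by
        intro i
        have h1 := (hS h hhS).2 i
        have h2 : ((psi c h i : ℤ) : ℚ) = 0 := by rw [h1]; simp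
        rw [← h2, psi]
        simp only [q, map_sum, map_mul, map_prod, eval_C, map_add, eval_X, Int.cast_sum, Int.cast_mul, Int.cast_prod]
        refine Finset.sum_congr rfl fun κ _ => ?_
        congr 1
        refine Finset.prod_congr rfl fun j _ => ?_
        refine Fin.cases ?_ (fun l => ?_) j
        · simp [ρ, w']
        · have := congrFun (congrFun hw l) (κ l.succ)
          simp only [v, Pi.sub_apply] at this
          simp only [ρ, w', Fin.cons_succ]
          rw [← this]; push_cast; ring
      have hj := congrArg (fun p => eval (ρ h) (φ p)) (ha j)
      simp only [map_mul, map_pow, map_sum] at hj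
      have e1 : eval (ρ h) (φ (C D)) = (D : ℚ) := by simp [φ]
      have e2 : eval (ρ h) (φ (X j)) = ρ h j := by simp [φ]
      rw [e1, e2] at hj
      have e3 : ∀ i, eval (ρ h) (q0 i) = (k + 1).factorial * eval (ρ h) (φ (pderiv i F)) := by
        intro i; rw [hq0]; simp
      simp only [map_mul, eval_C, map_neg, map_sum, map_sub, hqz, e3]
      rw [eq_inv_mul_iff_mul_eq₀ hDq, mul_right_comm, hj, Finset.sum_mul, ← Finset.sum_neg_distrib]
      refine Finset.sum_congr rfl fun i _ => ?_
      ring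
  have h1 := Finset.card_le_mul_card_image_of_maps_to hmaps _ hfib
  have h2 : (T.card : ℝ) ≤ 5 ^ (m * k) * U ^ (m * k) := by
    simp only [T, Fintype.card_piFinset, Finset.prod_const, Finset.card_univ, Fintype.card_fin]
    push_cast
    rw [← mul_pow, pow_mul]
    gcongr
    refine (card_bx_le m (2 * U) (by linarith)).trans ?_
    gcongr
    linarith
  have h3 : (S.card : ℝ) ≤ M ^ m * T.card := by exact_mod_cast h1
  calc (S.card : ℝ) ≤ M ^ m * T.card := h3
    _ ≤ M ^ m * (5 ^ (m * k) * U ^ (m * k)) := by gcongr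
    _ ≤ _ := by
      have : 0 ≤ U ^ (m * k) := by positivity
      nlinarith

/-- additive character -/
def ee (x : ℝ) : ℂ := Complex.exp (Complex.I * ((2 * Real.pi * x : ℝ) : ℂ))

lemma ee_add (x y : ℝ) : ee (x + y) = ee x * ee y := by
  rw [ee, ee, ee, ← Complex.exp_add]; congr 1; push_cast; ring

lemma ee_norm (x : ℝ) : ‖ee x‖ = 1 := by
  rw [ee, mul_comm]; exact Complex.norm_exp_ofReal_mul_I _

lemma ee_conj (x : ℝ) : (starRingEnd ℂ) (ee x) = ee (-x) := by
  rw [ee, ee, ← Complex.exp_conj]; congr 1; simp only [map_mul, Complex.conj_I, Complex.conj_ofReal]; push_cast; ring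

lemma ee_int (n : ℤ) : ee n = 1 := by
  rw [ee, Complex.exp_eq_one_iff]
  exact ⟨n, by push_cast; ring⟩

lemma ee_zero : ee 0 = 1 := by simpa using ee_int 0

lemma ee_sum {ι : Type*} (s : Finset ι) (f : ι → ℝ) : ee (∑ i ∈ s, f i) = ∏ i ∈ s, ee (f i) := by
  classical
  induction s using Finset.induction_on with
  | empty => simp [ee_zero]
  | insert a s ha ih => rw [Finset.sum_insert ha, Finset.prod_insert ha, ee_add, ih]

lemma ee_sub_one_le (x : ℝ) : ‖ee x - 1‖ ≤ 2 * Real.pi * |x| := by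
  have := Real.norm_exp_I_mul_ofReal_sub_one_le (x := 2 * Real.pi * x)
  rw [ee]
  refine this.trans_eq ?_
  rw [Real.norm_eq_abs, abs_mul, abs_of_pos (by positivity)]

lemma ee_shift (x : ℝ) (n : ℤ) : ee (x - n) = ee x := by
  rw [sub_eq_add_neg, ee_add]
  have := ee_int (-n)
  push_cast at this
  rw [this, mul_one]

lemma ee_sub_one_ge (x : ℝ) : 4 * dz x ≤ ‖ee x - 1‖ := by
  rw [← ee_shift x (round x), ee, Complex.norm_exp_I_mul_ofReal_sub_one]
  set y := x - round x with hy
  have h1 : |y| ≤ 1 / 2 := abs_sub_round x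
  have h2 : dz x = |y| := rfl
  rw [h2, norm_mul, Real.norm_eq_abs, Real.norm_eq_abs, abs_two, show 2 * Real.pi * y / 2 = Real.pi * y by ring]
  have h3 : |Real.sin (Real.pi * y)| = Real.sin (Real.pi * |y|) := by
    rcases abs_cases y with ⟨e, h⟩ | ⟨e, h⟩
    · rw [e, abs_of_nonneg]
      apply Real.sin_nonneg_of_nonneg_of_le_pi (by positivity)
      rw [e] at h1; nlinarith [Real.pi_pos]
    · rw [e, mul_neg, Real.sin_neg, abs_of_nonpos]
      apply Real.sin_nonpos_of_nonpos_of_neg_pi_le (by nlinarith [Real.pi_pos])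
      rw [e] at h1; nlinarith [Real.pi_pos]
  rw [h3]
  have h4 := Real.mul_le_sin (x := Real.pi * |y|) (by positivity) (by nlinarith [Real.pi_pos])
  have h5 : 2 / Real.pi * (Real.pi * |y|) = 2 * |y| := by field_simp
  linarith

/-- exponential sum over a box -/
def Sbox {m : ℕ} (f : (Fin m → ℤ) → ℝ) (a b : Fin m → ℤ) : ℂ := ∑ x ∈ Finset.Icc a b, ee (f x)

lemma Sbox_sq {m : ℕ} (f : (Fin m → ℤ) → ℝ) (a b : Fin m → ℤ) (T : ℤ) (hT : ∀ i, b i - a i ≤ T) :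
    ‖Sbox f a b‖ ^ 2 ≤ ∑ h ∈ Fintype.piFinset (fun _ : Fin m => Finset.Icc (-T) T),
      ‖Sbox (fwdDiff h f) (a ⊔ (a - h)) (b ⊓ (b - h))‖ := by
  classical
  set B := Finset.Icc a b with hB
  set H := Fintype.piFinset (fun _ : Fin m => Finset.Icc (-T) T) with hH
  have h1 : ((‖Sbox f a b‖ ^ 2 : ℝ) : ℂ) = ∑ h ∈ H, Sbox (fwdDiff h f) (a ⊔ (a - h)) (b ⊓ (b - h)) := by
    rw [Complex.ofReal_pow, ← Complex.mul_conj', Sbox, map_sum, Finset.sum_mul_sum, Finset.sum_comm]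
    have : ∀ x ∈ B, ∑ y ∈ B, ee (f y) * (starRingEnd ℂ) (ee (f x)) =
        ∑ h ∈ H, if x + h ∈ B then ee (fwdDiff h f x) else 0 := by
      intro x hx
      rw [← Finset.sum_filter]
      refine Finset.sum_bij' (fun y _ => y - x) (fun h _ => x + h) ?_ ?_ ?_ ?_ ?_
      · intro y hy
        simp only [Finset.mem_filter, hH, Fintype.mem_piFinset, Finset.mem_Icc, Pi.sub_apply, add_sub_cancel]
        refine ⟨fun i => ?_, hy⟩
        rw [hB, Finset.mem_Icc] at hx hy
        have h1 : a i ≤ x i := hx.1 i; have h2 : x i ≤ b i := hx.2 i; have h3 : a i ≤ y i := hy.1 i; have h4 : y i ≤ b i := hy.2 i; have := hT i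
        constructor <;> omega
      · intro h hh
        exact (Finset.mem_filter.mp hh).2
      · intro y hy; simp
      · intro h hh; simp
      · intro y hy
        rw [ee_conj, ← ee_add]
        simp [fwdDiff, sub_eq_add_neg]
    rw [Finset.sum_congr rfl this, Finset.sum_comm]
    refine Finset.sum_congr rfl fun h _ => ?_
    rw [Sbox, ← Finset.sum_filter]
    refine Finset.sum_congr ?_ fun _ _ => rfl
    ext x
    simp only [hB, Finset.mem_filter, Finset.mem_Icc, sup_le_iff, le_inf_iff, sub_le_iff_le_add, le_sub_iff_add_le]
    tauto
  have h2 : ‖Sbox f a b‖ ^ 2 = ‖((‖Sbox f a b‖ ^ 2 : ℝ) : ℂ)‖ := by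
    rw [Complex.norm_real, Real.norm_eq_abs, abs_of_nonneg (by positivity)]
  rw [h2, h1]
  exact norm_sum_le _ _

lemma weyl_diff {m : ℕ} (T : ℕ) (k : ℕ) : ∀ (f : (Fin m → ℤ) → ℝ) (a b : Fin m → ℤ), (∀ i, b i - a i ≤ T) →
    ∃ a' b' : (Fin k → Fin m → ℤ) → (Fin m → ℤ), (∀ h i, b' h i - a' h i ≤ T) ∧
      ‖Sbox f a b‖ ^ (2 ^ k) ≤ (((2 * T + 1 : ℕ) : ℝ) ^ m) ^ (2 ^ k - k - 1) *
        ∑ h ∈ Fintype.piFinset (fun _ : Fin k => Fintype.piFinset (fun _ : Fin m => Finset.Icc (-(T:ℤ)) T)),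
          ‖Sbox (DK k f h) (a' h) (b' h)‖ := by
  classical
  induction k with
  | zero =>
    intro f a b hT
    exact ⟨fun _ => a, fun _ => b, fun _ => hT, by simp [DK]⟩
  | succ k ih =>
    intro f a b hT
    have hT' : ∀ (h : Fin m → ℤ) i, (b ⊓ (b - h)) i - (a ⊔ (a - h)) i ≤ T := by
      intro h i
      have := hT i
      simp only [Pi.inf_apply, Pi.sup_apply]
      have h1 : b i ⊓ (b - h) i ≤ b i := inf_le_left
      have h2 : a i ≤ a i ⊔ (a - h) i := le_sup_left
      linarith
    choose A Bb hAB hS using fun h : Fin m → ℤ => ih (fwdDiff h f) _ _ (hT' h)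
    refine ⟨fun h => A (h 0) (Fin.tail h), fun h => Bb (h 0) (Fin.tail h), fun h i => hAB _ _ _, ?_⟩
    set Q := Fintype.piFinset (fun _ : Fin m => Finset.Icc (-(T:ℤ)) T) with hQ
    set H : ℝ := ((2 * T + 1 : ℕ) : ℝ) ^ m with hH
    have hQc : (Q.card : ℝ) = H := by
      rw [hQ, Fintype.card_piFinset]
      simp only [Int.card_Icc, Finset.prod_const, Finset.card_univ, Fintype.card_fin, Nat.cast_pow, hH]
      congr 2
      omega
    have hHpos : 0 < H := by positivity
    have h1 := Sbox_sq f a b T hT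
    have hk : 2 ^ k = (2 ^ k - 1) + 1 := by have := Nat.one_le_two_pow (n := k); omega
    have h2 := pow_sum_div_card_le_sum_pow (s := Q)
      (f := fun h => ‖Sbox (fwdDiff h f) (a ⊔ (a - h)) (b ⊓ (b - h))‖) (fun _ _ => norm_nonneg _) (2 ^ k - 1)
    rw [← hk, hQc, div_le_iff₀ (by positivity)] at h2
    calc ‖Sbox f a b‖ ^ 2 ^ (k + 1) = (‖Sbox f a b‖ ^ 2) ^ 2 ^ k := by rw [← pow_mul]; ring_nf
      _ ≤ (∑ h ∈ Q, ‖Sbox (fwdDiff h f) (a ⊔ (a - h)) (b ⊓ (b - h))‖) ^ 2 ^ k := by gcongr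
      _ ≤ (∑ h ∈ Q, ‖Sbox (fwdDiff h f) (a ⊔ (a - h)) (b ⊓ (b - h))‖ ^ 2 ^ k) * H ^ (2 ^ k - 1) := h2
      _ ≤ (∑ h0 ∈ Q, H ^ (2 ^ k - k - 1) * ∑ h ∈ Fintype.piFinset (fun _ : Fin k => Q),
            ‖Sbox (DK k (fwdDiff h0 f) h) (A h0 h) (Bb h0 h)‖) * H ^ (2 ^ k - 1) := by
          gcongr with h0 _
          exact hS h0
      _ = H ^ (2 ^ (k + 1) - (k + 1) - 1) * ∑ h0 ∈ Q, ∑ h ∈ Fintype.piFinset (fun _ : Fin k => Q),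
            ‖Sbox (DK k (fwdDiff h0 f) h) (A h0 h) (Bb h0 h)‖ := by
          rw [← Finset.mul_sum, mul_right_comm, ← pow_add]
          congr 2
          have := Nat.lt_two_pow_self (n := k)
          rw [pow_succ]; omega
      _ = _ := by
          congr 1
          rw [← Finset.sum_product']
          refine Finset.sum_bij' (fun p _ => Fin.cons p.1 p.2) (fun h _ => (h 0, Fin.tail h)) ?_ ?_ ?_ ?_ ?_
          · rintro ⟨p, q⟩ h
            rw [Finset.mem_product] at h
            rw [Fintype.mem_piFinset]
            intro j
            refine Fin.cases ?_ (fun j => ?_) j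
            · exact h.1
            · simpa using Fintype.mem_piFinset.mp h.2 j
          · intro h hh
            rw [Fintype.mem_piFinset] at hh
            rw [Finset.mem_product]
            exact ⟨hh 0, Fintype.mem_piFinset.mpr fun j => hh (Fin.succ j)⟩
          · rintro ⟨p, q⟩ _; simp
          · intro h _; simp
          · rintro ⟨p, q⟩ _; simp [DK]

lemma geom_bound (θ : ℝ) (a b : ℤ) : ‖∑ t ∈ Finset.Icc a b, ee (θ * t)‖ * (2 * dz θ) ≤ 1 := by
  have h1 : (∑ t ∈ Finset.Icc a b, ee (θ * t)) * (ee θ - 1) = if a ≤ b then ee (θ * (b + 1)) - ee (θ * a) else 0 := by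
    split_ifs with h
    · obtain ⟨n, rfl⟩ := Int.le.dest h
      induction n with
      | zero => simp; rw [show θ * ((a:ℝ) + 1) = θ * a + θ by ring, ee_add]; ring
      | succ n ih =>
        have : Finset.Icc a (a + ((n + 1 : ℕ) : ℤ)) = insert (a + ((n + 1 : ℕ) : ℤ)) (Finset.Icc a (a + (n : ℤ))) := by
          ext x; simp only [Finset.mem_Icc, Finset.mem_insert]; push_cast; omega
        rw [this, Finset.sum_insert (by simp), add_mul, ih (by omega)]
        have e : ee (θ * (((a + ((n + 1 : ℕ) : ℤ) : ℤ) : ℝ) + 1)) = ee (θ * (a + ((n + 1 : ℕ) : ℤ) : ℤ)) * ee θ := by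
          rw [← ee_add]; congr 1; ring
        rw [e]
        push_cast
        ring_nf
    · rw [Finset.Icc_eq_empty h]; simp
  have h2 : ‖(∑ t ∈ Finset.Icc a b, ee (θ * t)) * (ee θ - 1)‖ ≤ 2 := by
    rw [h1]
    split_ifs
    · refine (norm_sub_le _ _).trans ?_
      rw [ee_norm, ee_norm]; norm_num
    · simp
  rw [norm_mul] at h2
  have := ee_sub_one_ge θ
  nlinarith [norm_nonneg (∑ t ∈ Finset.Icc a b, ee (θ * t))]

lemma Sbox_linear {m : ℕ} (f : (Fin m → ℤ) → ℝ) (c0 : ℝ) (θ : Fin m → ℝ) (hf : ∀ x, f x = c0 + ∑ i, θ i * x i)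
    (a b : Fin m → ℤ) : ‖Sbox f a b‖ = ∏ i, ‖∑ t ∈ Finset.Icc (a i) (b i), ee (θ i * t)‖ := by
  classical
  rw [Sbox, ← norm_prod, Finset.prod_univ_sum, ← Pi.Icc_eq]
  simp only [hf, ee_add, ee_sum]
  rw [← Finset.mul_sum, norm_mul, ee_norm, one_mul]

lemma one_dim_bound (θ : ℝ) (a b : ℤ) (T : ℕ) (h : b - a ≤ T) :
    ‖∑ t ∈ Finset.Icc a b, ee (θ * t)‖ ≤ T + 1 := by
  refine (norm_sum_le _ _).trans ?_
  simp only [ee_norm, Finset.sum_const, Int.card_Icc, nsmul_eq_mul, mul_one]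
  have : (b + 1 - a).toNat ≤ T + 1 := by omega
  exact_mod_cast this

lemma cell_bound (θ : ℝ) (a b : ℤ) (T : ℕ) (h : b - a ≤ T) (Q : ℝ) (hQ : T + 1 ≤ Q) :
    ‖∑ t ∈ Finset.Icc a b, ee (θ * t)‖ ≤ 3 * Q / (|(⌊Q * (θ - round θ)⌋ : ℝ)| + 1) := by
  set w := ‖∑ t ∈ Finset.Icc a b, ee (θ * t)‖
  set n := ⌊Q * (θ - round θ)⌋ with hn
  have h1 : w ≤ T + 1 := one_dim_bound θ a b T h
  have h2 : w * (2 * dz θ) ≤ 1 := geom_bound θ a b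
  have hw : 0 ≤ w := norm_nonneg _
  have hQ0 : 0 < Q := by have : (0:ℝ) ≤ T := Nat.cast_nonneg T
                         linarith
  have h3 : |(n:ℝ)| - 1 ≤ Q * dz θ := by
    have a1 := Int.floor_le (Q * (θ - round θ))
    have a2 := Int.lt_floor_add_one (Q * (θ - round θ))
    rw [← hn] at a1 a2
    have : Q * dz θ = |Q * (θ - round θ)| := by rw [abs_mul, abs_of_pos hQ0]; rfl
    rw [this]
    rcases abs_cases (n:ℝ) with ⟨e, h⟩ | ⟨e, h⟩ <;> rcases abs_cases (Q * (θ - round θ)) with ⟨e', h'⟩ | ⟨e', h'⟩ <;>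
      linarith
  rw [le_div_iff₀ (by positivity)]
  have h4 : w * (2 * (|(n:ℝ)| - 1)) ≤ Q := by
    nlinarith
  nlinarith

lemma summable_cs (s : ℝ) (hs : 1 < s) : Summable fun n : ℤ => (1 / (|(n:ℝ)| + 1)) ^ s := by
  have h : Summable fun n : ℕ => (1 / ((n:ℝ) + 1)) ^ s := by
    have := (Real.summable_one_div_nat_add_rpow 1 s).mpr hs
    refine this.congr fun n => ?_
    rw [Real.div_rpow zero_le_one (by positivity), Real.one_rpow, abs_of_pos (by positivity)]
  apply Summable.of_nat_of_neg
  · simpa using h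
  · simpa using h

lemma cell_sum {m : ℕ} (S V : Finset (Fin m → ℤ)) (θ : (Fin m → ℤ) → Fin m → ℝ)
    (hadd : ∀ u v i, θ (u - v) i = θ u i - θ v i) (W : (Fin m → ℤ) → ℝ) (Q s : ℝ) (hQ : 0 < Q) (hs : 1 < s)
    (hW0 : ∀ u, 0 ≤ W u)
    (hW : ∀ u ∈ S, W u ≤ ∏ i, (3 * Q / (|(⌊Q * (θ u i - round (θ u i))⌋ : ℝ)| + 1)))
    (hV : ∀ u ∈ S, ∀ v ∈ S, (∀ i, dz (θ (u - v) i) ≤ 1 / Q) → u - v ∈ V) :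
    ∑ u ∈ S, W u ^ s ≤ ((3 * Q) ^ s * ∑' n : ℤ, (1 / (|(n:ℝ)| + 1)) ^ s) ^ m * V.card := by
  classical
  let n : (Fin m → ℤ) → (Fin m → ℤ) := fun u i => ⌊Q * (θ u i - round (θ u i))⌋
  let w : ℤ → ℝ := fun t => (3 * Q) ^ s * (1 / (|(t:ℝ)| + 1)) ^ s
  have hw : ∀ t, 0 ≤ w t := fun t => by positivity
  have hfib : ∀ ν ∈ S.image n, ((S.filter fun u => n u = ν).card : ℝ) ≤ V.card := by
    intro ν hν
    obtain ⟨v, hv, rfl⟩ := Finset.mem_image.mp hν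
    norm_cast
    apply Finset.card_le_card_of_injOn (fun u => u - v)
    · intro u hu
      obtain ⟨hu, hn⟩ := Finset.mem_filter.mp hu
      apply hV u hu v hv
      intro i
      rw [hadd]
      have h1 := congrFun hn i
      simp only [n] at h1
      have a1 := Int.abs_sub_lt_one_of_floor_eq_floor h1
      refine (dz_le _ (round (θ u i) - round (θ v i))).trans ?_
      rw [← mul_sub, abs_mul, abs_of_pos hQ] at a1
      rw [le_div_iff₀ hQ, mul_comm]
      push_cast
      have : θ u i - θ v i - (round (θ u i) - round (θ v i)) = θ u i - round (θ u i) - (θ v i - round (θ v i)) := by ring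
      rw [this]; exact a1.le
    · intro u _ u' _ h
      exact sub_left_injective h
  have h1 : ∀ u ∈ S, W u ^ s ≤ ∏ i, w (n u i) := by
    intro u hu
    refine (Real.rpow_le_rpow (hW0 u) (hW u hu) (by linarith)).trans_eq ?_
    rw [← Real.finsetProd_rpow _ _ (fun i _ => by positivity)]
    refine Finset.prod_congr rfl fun i _ => ?_
    simp only [w, n]
    rw [← Real.mul_rpow (by positivity) (by positivity), mul_one_div]
  calc ∑ u ∈ S, W u ^ s ≤ ∑ u ∈ S, ∏ i, w (n u i) := Finset.sum_le_sum h1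
    _ = ∑ ν ∈ S.image n, ∑ u ∈ S.filter (fun u => n u = ν), ∏ i, w (n u i) :=
        (Finset.sum_fiberwise_of_maps_to (fun u hu => Finset.mem_image_of_mem _ hu) _).symm
    _ = ∑ ν ∈ S.image n, ((S.filter fun u => n u = ν).card : ℝ) * ∏ i, w (ν i) := by
        refine Finset.sum_congr rfl fun ν _ => ?_
        rw [← nsmul_eq_mul, ← Finset.sum_const]
        refine Finset.sum_congr rfl fun u hu => ?_
        rw [(Finset.mem_filter.mp hu).2]
    _ ≤ ∑ ν ∈ S.image n, (V.card : ℝ) * ∏ i, w (ν i) := by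
        refine Finset.sum_le_sum fun ν hν => ?_
        exact mul_le_mul_of_nonneg_right (hfib ν hν) (Finset.prod_nonneg fun i _ => hw _)
    _ = V.card * ∑ ν ∈ S.image n, ∏ i, w (ν i) := by rw [Finset.mul_sum]
    _ ≤ V.card * ∑ ν ∈ Fintype.piFinset (fun i => (S.image n).image fun ν => ν i), ∏ i, w (ν i) := by
        gcongr
        · intro ν hν
          rw [Fintype.mem_piFinset]
          intro i
          exact Finset.mem_image_of_mem (fun ν : Fin m → ℤ => ν i) hν
    _ = V.card * ∏ i, ∑ t ∈ (S.image n).image (fun ν => ν i), w t := by rw [Finset.prod_univ_sum]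
    _ ≤ V.card * ∏ _i : Fin m, ((3 * Q) ^ s * ∑' n : ℤ, (1 / (|(n:ℝ)| + 1)) ^ s) := by
        gcongr with i _
        · simp only [w]
          rw [← Finset.mul_sum]
          gcongr
          exact (summable_cs s hs).sum_le_tsum _ (fun t _ => by positivity)
    _ = _ := by rw [Finset.prod_const, Finset.card_univ, Fintype.card_fin, mul_comm]

/-- counting set -/
def Vs {m k : ℕ} (c : (Fin (k + 1) → Fin m) → ℤ) (A : ℝ) (P : Fin k → ℝ) (δ : ℝ) : Finset (Fin k → Fin m → ℤ) := by
  classical exact (Fintype.piFinset fun j => bx m (P j)).filter fun h => ∀ i, dz (A * psi c h i) ≤ δ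

lemma mem_Vs {m k : ℕ} {c : (Fin (k + 1) → Fin m) → ℤ} {A : ℝ} {P : Fin k → ℝ} {δ : ℝ} {h : Fin k → Fin m → ℤ} :
    h ∈ Vs c A P δ ↔ (∀ j, h j ∈ bx m (P j)) ∧ ∀ i, dz (A * psi c h i) ≤ δ := by
  classical
  simp [Vs]

/-- the matrix of psi in slot j -/
def Lm {m k : ℕ} (c : (Fin (k + 1) → Fin m) → ℤ) (w : Fin k → Fin m → ℤ) (j : Fin k) (i l : Fin m) : ℤ :=
  ∑ κ : Fin k → Fin m, if κ j = l then c (Fin.cons i κ) * ∏ t ∈ Finset.univ.erase j, w t (κ t) else 0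

lemma psi_update {m k : ℕ} (c : (Fin (k + 1) → Fin m) → ℤ) (w : Fin k → Fin m → ℤ) (j : Fin k) (u : Fin m → ℤ) (i : Fin m) :
    psi c (Function.update w j u) i = ∑ l, Lm c w j i l * u l := by
  classical
  simp only [Lm, Finset.sum_mul, psi]
  rw [Finset.sum_comm]
  refine Finset.sum_congr rfl fun κ _ => ?_
  simp only [ite_mul, zero_mul, Finset.sum_ite_eq, Finset.mem_univ, if_true]
  rw [← Finset.mul_prod_erase _ _ (Finset.mem_univ j)]
  simp only [Function.update_self]
  have : ∏ x ∈ Finset.univ.erase j, Function.update w j u x (κ x) = ∏ x ∈ Finset.univ.erase j, w x (κ x) := by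
    refine Finset.prod_congr rfl fun x hx => ?_
    rw [Function.update_of_ne (Finset.ne_of_mem_erase hx)]
  rw [this]; ring

lemma Lm_symm {m k : ℕ} (c : (Fin (k + 1) → Fin m) → ℤ)
    (hsym : ∀ ι (σ : Equiv.Perm (Fin (k + 1))), c (ι ∘ σ) = c ι)
    (w : Fin k → Fin m → ℤ) (j : Fin k) (i l : Fin m) : Lm c w j i l = Lm c w j l i := by
  classical
  simp only [Lm, ← Finset.sum_filter]
  refine Finset.sum_bij' (fun κ _ => Function.update κ j i) (fun κ _ => Function.update κ j l) ?_ ?_ ?_ ?_ ?_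
  · intro κ _; simp
  · intro κ _; simp
  · intro κ hκ; simp only [Finset.mem_filter] at hκ; simp [← hκ.2]
  · intro κ hκ; simp only [Finset.mem_filter] at hκ; simp [← hκ.2]
  · intro κ hκ
    simp only [Finset.mem_filter, Finset.mem_univ, true_and] at hκ
    congr 1
    · rw [← hsym (Fin.cons i κ) (Equiv.swap 0 j.succ)]
      congr 1
      funext t
      refine Fin.cases ?_ (fun t => ?_) t
      · simp [hκ]
      · by_cases ht : t = j
        · subst ht; simp
        · have : Equiv.swap 0 j.succ t.succ = t.succ :=
            Equiv.swap_apply_of_ne_of_ne (Fin.succ_ne_zero t) (fun h => ht (Fin.succ_injective _ h))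
          simp [this, ht]
    · refine Finset.prod_congr rfl fun t ht => ?_
      rw [Function.update_of_ne (Finset.ne_of_mem_erase ht)]

lemma slot {m k : ℕ} (c : (Fin (k + 1) → Fin m) → ℤ)
    (hsym : ∀ ι (σ : Equiv.Perm (Fin (k + 1))), c (ι ∘ σ) = c ι)
    (A : ℝ) (P : Fin k → ℝ) (δ κ : ℝ) (j : Fin k) (hP : 0 < P j) (hδ : 0 < δ) (hPδ : 2 * m * (P j * δ) < 1)
    (hκ : 0 < κ) (hκ1 : κ ≤ 1) :
    ((Vs c A P δ).card : ℝ) ≤ (3 / κ) ^ m * (Vs c A (Function.update P j (κ * P j)) (κ * δ)).card := by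
  classical
  set V := Vs c A P δ
  set V' := Vs c A (Function.update P j (κ * P j)) (κ * δ)
  let r : (Fin k → Fin m → ℤ) → (Fin k → Fin m → ℤ) := fun h => Function.update h j 0
  let t := V.image r ∪ V'.image r
  have h1 : V.card = ∑ w ∈ t, (V.filter fun h => r h = w).card :=
    Finset.card_eq_sum_card_fiberwise fun h hh => Finset.mem_coe.mpr
      (Finset.mem_union_left _ (Finset.mem_image_of_mem _ hh))
  have h2 : V'.card = ∑ w ∈ t, (V'.filter fun h => r h = w).card :=
    Finset.card_eq_sum_card_fiberwise fun h hh => Finset.mem_coe.mpr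
      (Finset.mem_union_right _ (Finset.mem_image_of_mem _ hh))
  rw [h1, h2]
  push_cast
  rw [Finset.mul_sum]
  refine Finset.sum_le_sum fun w hw => ?_
  have hwb : w j = 0 ∧ ∀ l, l ≠ j → w l ∈ bx m (P l) := by
    rcases Finset.mem_union.mp hw with hw | hw <;> obtain ⟨h, hh, rfl⟩ := Finset.mem_image.mp hw
    · refine ⟨by simp [r], fun l hl => ?_⟩
      simp only [r, Function.update_of_ne hl]
      exact (mem_Vs.mp hh).1 l
    · refine ⟨by simp [r], fun l hl => ?_⟩
      have := (mem_Vs.mp hh).1 l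
      simp only [r, Function.update_of_ne hl] at this ⊢
      exact this
  let Λ : Fin m → Fin m → ℝ := fun i l => A * Lm c w j i l
  have hΛ : ∀ (u : Fin m → ℤ) i, A * (psi c (Function.update w j u) i : ℝ) = ∑ l, Λ i l * u l := by
    intro u i
    rw [psi_update]
    push_cast
    rw [Finset.mul_sum]
    exact Finset.sum_congr rfl fun l _ => by simp only [Λ]; ring
  have hs := shrink Λ (fun i l => by simp only [Λ]; rw [Lm_symm c hsym]) (P j) δ κ hP hδ hPδ hκ hκ1
  have e : ∀ h, r h = w → h = Function.update w j (h j) := by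
    intro h hh
    rw [← hh]; simp [r]
  have h3 : (V.filter fun h => r h = w).card ≤ (sh Λ (P j) δ).card := by
    apply Finset.card_le_card_of_injOn (fun h => h j)
    · intro h hh
      obtain ⟨hV, hr⟩ := Finset.mem_filter.mp hh
      have hV := mem_Vs.mp hV
      refine Finset.mem_coe.mpr (mem_sh.mpr ⟨mem_bx.mp (hV.1 j), fun i => ?_⟩)
      rw [← hΛ, ← e h hr]
      exact hV.2 i
    · intro h hh h' hh' heq
      rw [e h (Finset.mem_filter.mp hh).2, e h' (Finset.mem_filter.mp hh').2]
      simp only at heq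
      rw [heq]
  have h4 : (sh Λ (κ * P j) (κ * δ)).card ≤ (V'.filter fun h => r h = w).card := by
    apply Finset.card_le_card_of_injOn (fun u => Function.update w j u)
    · intro u hu
      have hu := mem_sh.mp (Finset.mem_coe.mp hu)
      refine Finset.mem_coe.mpr (Finset.mem_filter.mpr ⟨mem_Vs.mpr ⟨fun l => ?_, fun i => ?_⟩, ?_⟩)
      · by_cases hl : l = j
        · subst hl; simp only [Function.update_self]; exact mem_bx.mpr hu.1
        · simp only [Function.update_of_ne hl]; exact hwb.2 l hl
      · rw [hΛ]; exact hu.2 i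
      · simp only [r, Function.update_idem]
        rw [← hwb.1]; simp
    · intro u _ u' _ heq
      have := congrFun heq j
      simpa using this
  calc ((V.filter fun h => r h = w).card : ℝ) ≤ (sh Λ (P j) δ).card := by exact_mod_cast h3
    _ ≤ _ := hs
    _ ≤ _ := by gcongr

lemma slots {m k : ℕ} (c : (Fin (k + 1) → Fin m) → ℤ)
    (hsym : ∀ ι (σ : Equiv.Perm (Fin (k + 1))), c (ι ∘ σ) = c ι)
    (A P δ κ : ℝ) (hP : 0 < P) (hδ : 0 < δ) (hPδ : 2 * m * (P * δ) < 1)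
    (hκ : 0 < κ) (hκ1 : κ ≤ 1) :
    ((Vs c A (fun _ => P) δ).card : ℝ) ≤ ((3 / κ) ^ m) ^ k * (Vs c A (fun _ => κ * P) (κ ^ k * δ)).card := by
  classical
  have key : ∀ s : Finset (Fin k), ((Vs c A (fun _ => P) δ).card : ℝ) ≤
      ((3 / κ) ^ m) ^ s.card * (Vs c A (fun j => if j ∈ s then κ * P else P) (κ ^ s.card * δ)).card := by
    intro s
    induction s using Finset.induction_on with
    | empty => simp
    | insert j s hj ih =>
      have hle : κ ^ s.card ≤ 1 := pow_le_one₀ hκ.le hκ1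
      have := slot c hsym A (fun j => if j ∈ s then κ * P else P) (κ ^ s.card * δ) κ j (by simp [hj, hP])
        (by positivity) (by
          simp only [hj, if_false]
          refine lt_of_le_of_lt ?_ hPδ
          have : κ ^ s.card * δ ≤ δ := by nlinarith
          gcongr) hκ hκ1
      have e : Function.update (fun j => if j ∈ s then κ * P else P) j (κ * (if j ∈ s then κ * P else P)) =
          fun l => if l ∈ insert j s then κ * P else P := by
        funext l
        by_cases hl : l = j
        · subst hl; simp [hj]
        · simp [hl]
      rw [e] at this
      rw [Finset.card_insert_of_notMem hj]
      refine ih.trans ?_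
      rw [pow_succ, mul_assoc, pow_succ' κ, mul_assoc κ]
      gcongr
  simpa using key Finset.univ

lemma dz_neg (x : ℝ) : dz (-x) = dz x := by
  apply le_antisymm
  · refine (dz_le (-x) (-round x)).trans_eq ?_
    rw [dz, ← abs_neg]; congr 1; push_cast; ring
  · refine (dz_le x (-round (-x))).trans_eq ?_
    rw [dz, ← abs_neg]; congr 1; push_cast; ring

lemma psi_bound {m k : ℕ} (c : (Fin (k + 1) → Fin m) → ℤ) (P : ℝ) (h : Fin k → Fin m → ℤ)
    (hh : ∀ j, h j ∈ bx m P) (i : Fin m) : |(psi c h i : ℝ)| ≤ (∑ ι, |(c ι : ℝ)|) * P ^ k := by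
  classical
  have h1 : |(psi c h i : ℝ)| ≤ ∑ κ : Fin k → Fin m, |(c (Fin.cons i κ) : ℝ)| * P ^ k := by
    rw [psi]
    push_cast
    refine (Finset.abs_sum_le_sum_abs _ _).trans (Finset.sum_le_sum fun κ _ => ?_)
    rw [abs_mul, Finset.abs_prod]
    gcongr
    calc ∏ j, |(h j (κ j) : ℝ)| ≤ ∏ _j : Fin k, P :=
          Finset.prod_le_prod (fun _ _ => abs_nonneg _) fun j _ => mem_bx.mp (hh j) (κ j)
      _ = P ^ k := by simp
  refine h1.trans ?_
  rw [← Finset.sum_mul]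
  have hP : 0 ≤ P ^ k := by
    rcases k with _ | k
    · simp
    · have := mem_bx.mp (hh 0) i
      have := (abs_nonneg _).trans this
      positivity
  gcongr
  have hinj : Function.Injective fun κ : Fin k → Fin m => (Fin.cons i κ : Fin (k + 1) → Fin m) := by
    intro a b hab
    exact Fin.cons_right_injective (α := fun _ => Fin m) i hab
  calc ∑ κ : Fin k → Fin m, |(c (Fin.cons i κ) : ℝ)| = ∑ ι ∈ Finset.univ.image (fun κ : Fin k → Fin m => (Fin.cons i κ : Fin (k + 1) → Fin m)), |(c ι : ℝ)| := by
        rw [Finset.sum_image fun a _ b _ h => hinj h]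
    _ ≤ _ := Finset.sum_le_sum_of_subset_of_nonneg (Finset.subset_univ _) fun _ _ _ => abs_nonneg _

lemma Vs_small {m k : ℕ} (F : MvPolynomial (Fin m) ℤ) (hF : F.IsHomogeneous (k + 1 + 1))
    (hsmooth : ∀ z : Fin m → ℂ, z ≠ 0 → eval z (map (Int.castRingHom ℂ) F) = 0 →
      ∃ i, eval z (pderiv i (map (Int.castRingHom ℂ) F)) ≠ 0)
    (c : (Fin (k + 1 + 1) → Fin m) → ℤ)
    (hsym : ∀ ι (σ : Equiv.Perm (Fin (k + 1 + 1))), c (ι ∘ σ) = c ι)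
    (hpoly : C ((k + 1 + 1).factorial : ℤ) * F = ∑ ι, C (c ι) * ∏ j, X (ι j)) (hm : 1 ≤ m) :
    ∃ C1 : ℝ, 0 < C1 ∧ ∃ C2 : ℝ, 0 < C2 ∧ ∀ (A T U : ℝ), 1 ≤ U → U ≤ T →
      (∀ q : ℕ, 1 ≤ q → (q : ℝ) ≤ C1 * U ^ (k + 1) → ¬ dz (q * A) ≤ U ^ (k + 1) / T ^ (k + 2)) →
      ((Vs c A (fun _ => 2 * T) (1 / (8 * m * T))).card : ℝ) ≤ C2 * T ^ (m * (k + 1)) * U ^ (-(m:ℝ)) := by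
  classical
  obtain ⟨C0, hC0, hcount⟩ := psi_count F hF hsmooth c hsym hpoly
  refine ⟨(∑ ι, |(c ι : ℝ)|) * 2 ^ (k + 1) + 1, by positivity, 3 ^ (m * (k + 1)) * C0 * 2 ^ (m * k), by positivity, ?_⟩
  intro A T U hU hUT hno
  have hU0 : 0 < U := by linarith
  have hT0 : 0 < T := by linarith
  have hm0 : (0:ℝ) < m := by exact_mod_cast hm
  have hm1 : (1:ℝ) ≤ m := by exact_mod_cast hm
  have h1 := slots c hsym A (2 * T) (1 / (8 * m * T)) (U / T) (by positivity) (by positivity)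
    (by
      have : 2 * (m:ℝ) * (2 * T * (1 / (8 * m * T))) = 1 / 2 := by field_simp; norm_num
      rw [this]; norm_num) (by positivity) (by rw [div_le_one hT0]; exact hUT)
  have h2 : ((Vs c A (fun _ => U / T * (2 * T)) ((U / T) ^ (k + 1) * (1 / (8 * m * T)))).card : ℝ) ≤ C0 * (2 * U) ^ (m * k) := by
    apply hcount (2 * U) (by linarith)
    intro h hh
    obtain ⟨hb, hd⟩ := mem_Vs.mp hh
    rw [show U / T * (2 * T) = 2 * U by field_simp] at hb
    refine ⟨hb, fun i => ?_⟩
    by_contra hne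
    have hq : 1 ≤ (psi c h i).natAbs := Int.natAbs_pos.mpr hne
    have hqa : (((psi c h i).natAbs : ℕ) : ℝ) = |(psi c h i : ℝ)| := by
      rw [Nat.cast_natAbs]; push_cast; rfl
    refine hno _ hq ?_ ?_
    · rw [hqa]
      refine (psi_bound c (2 * U) h hb i).trans ?_
      rw [mul_pow]
      have : 0 < U ^ (k + 1) := by positivity
      nlinarith
    · have e : dz (((psi c h i).natAbs : ℕ) * A) = dz (A * psi c h i) := by
        rw [hqa]
        rcases abs_choice (psi c h i : ℝ) with e | e <;> rw [e]
        · rw [mul_comm]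
        · rw [← dz_neg]; congr 1; ring
      rw [e]
      refine (hd i).trans ?_
      have e2 : U ^ (k + 1) / T ^ (k + 2) = (U / T) ^ (k + 1) * (1 / T) := by
        rw [div_pow, pow_succ T (k + 1)]; field_simp
      rw [e2]
      gcongr
      nlinarith
  refine h1.trans ?_
  calc ((3 / (U / T)) ^ m) ^ (k + 1) * ((Vs c A (fun _ => U / T * (2 * T)) ((U / T) ^ (k + 1) * (1 / (8 * m * T)))).card : ℝ)
      ≤ ((3 / (U / T)) ^ m) ^ (k + 1) * (C0 * (2 * U) ^ (m * k)) := by gcongr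
    _ = _ := by
      rw [Real.rpow_neg hU0.le, Real.rpow_natCast, ← pow_mul, div_div_eq_mul_div, div_pow, mul_pow, mul_pow,
        mul_add m k 1, mul_one, pow_add U]
      field_simp

lemma holder_sum {ι : Type*} (S : Finset ι) (w : ι → ℝ) (hw : ∀ i ∈ S, 0 ≤ w i) (s : ℝ) (hs : 1 < s) :
    (∑ i ∈ S, w i) ^ s ≤ (S.card : ℝ) ^ (s - 1) * ∑ i ∈ S, w i ^ s := by
  have := Real.rpow_sum_le_const_mul_sum_rpow S (f := w) hs.le
  have e1 : ∑ i ∈ S, |w i| = ∑ i ∈ S, w i := Finset.sum_congr rfl fun i hi => abs_of_nonneg (hw i hi)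
  have e2 : ∑ i ∈ S, |w i| ^ s = ∑ i ∈ S, w i ^ s :=
    Finset.sum_congr rfl fun i hi => by rw [abs_of_nonneg (hw i hi)]
  rw [e1, e2] at this
  exact this

lemma weyl_sum {m k : ℕ} (c : (Fin (k + 1 + 1) → Fin m) → ℤ) (hm : 1 ≤ m) (s : ℝ) (hs : 1 < s)
    (f : (Fin m → ℤ) → ℝ) (A : ℝ)
    (hf : ∀ h y, DK (k + 1) f h y = DK (k + 1) f h 0 + A * ∑ i, (y i : ℝ) * psi c h i)
    (T : ℕ) (hT : 1 ≤ T) (a' b' : (Fin (k + 1) → Fin m → ℤ) → (Fin m → ℤ)) (hab : ∀ h i, b' h i - a' h i ≤ T) :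
    ∑ h ∈ Fintype.piFinset (fun _ : Fin (k + 1) => Fintype.piFinset (fun _ : Fin m => Finset.Icc (-(T:ℤ)) T)),
      ‖Sbox (DK (k + 1) f h) (a' h) (b' h)‖ ^ s ≤
    ((3 * (8 * m * T)) ^ s * ∑' n : ℤ, (1 / (|(n:ℝ)| + 1)) ^ s) ^ m *
      (Vs c A (fun _ => 2 * T) (1 / (8 * m * T))).card := by
  classical
  set H := Fintype.piFinset (fun _ : Fin m => Finset.Icc (-(T:ℤ)) T) with hH
  set Q : ℝ := 8 * m * T with hQ
  have hm1 : (1:ℝ) ≤ m := by exact_mod_cast hm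
  have hT1 : (1:ℝ) ≤ T := by exact_mod_cast hT
  have hQ0 : 0 < Q := by positivity
  have hQT : (T:ℝ) + 1 ≤ Q := by nlinarith
  set V := Vs c A (fun _ => 2 * (T:ℝ)) (1 / Q) with hV
  have hHm : ∀ u, u ∈ H ↔ ∀ i, |(u i : ℝ)| ≤ T := by
    intro u
    simp only [hH, Fintype.mem_piFinset, Finset.mem_Icc, abs_le]
    exact forall_congr' fun i => by norm_cast
  have e1 : ∀ g : (Fin (k + 1) → Fin m → ℤ) → ℝ, ∑ h ∈ Fintype.piFinset (fun _ : Fin (k + 1) => H), g h =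
      ∑ h' ∈ Fintype.piFinset (fun _ : Fin k => H), ∑ u ∈ H, g (Fin.cons u h') := by
    intro g
    rw [← Finset.sum_product']
    symm
    refine Finset.sum_bij' (fun p _ => Fin.cons p.2 p.1) (fun h _ => (Fin.tail h, h 0)) ?_ ?_ ?_ ?_ ?_
    · rintro ⟨p, q⟩ h
      rw [Finset.mem_product] at h
      rw [Fintype.mem_piFinset]
      intro j
      refine Fin.cases ?_ (fun j => ?_) j
      · exact h.2
      · simpa using Fintype.mem_piFinset.mp h.1 j
    · intro h hh
      rw [Fintype.mem_piFinset] at hh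
      rw [Finset.mem_product]
      exact ⟨Fintype.mem_piFinset.mpr fun j => hh (Fin.succ j), hh 0⟩
    · rintro ⟨p, q⟩ _; simp
    · intro h _; simp
    · rintro ⟨p, q⟩ _; simp
  rw [e1]
  let Vf : (Fin k → Fin m → ℤ) → Finset (Fin m → ℤ) := fun h' =>
    (bx m (2 * T)).filter fun u => ∀ i, dz (A * psi c (Fin.cons u h' : Fin (k+1) → Fin m → ℤ) i) ≤ 1 / Q
  have hpsi : ∀ (h' : Fin k → Fin m → ℤ) u i, psi c (Fin.cons u h' : Fin (k + 1) → Fin m → ℤ) i =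
      ∑ l, Lm c (Fin.cons 0 h' : Fin (k + 1) → Fin m → ℤ) 0 i l * u l := by
    intro h' u i
    rw [← psi_update, Fin.update_cons_zero]
  have h1 : ∀ h' ∈ Fintype.piFinset (fun _ : Fin k => H), ∑ u ∈ H, ‖Sbox (DK (k + 1) f (Fin.cons u h')) (a' (Fin.cons u h')) (b' (Fin.cons u h'))‖ ^ s
      ≤ ((3 * Q) ^ s * ∑' n : ℤ, (1 / (|(n:ℝ)| + 1)) ^ s) ^ m * (Vf h').card := by
    intro h' _
    apply cell_sum H (Vf h') (fun u i => A * psi c (Fin.cons u h' : Fin (k+1) → Fin m → ℤ) i) ?_ _ Q s hQ0 hs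
    · intro u; positivity
    · intro u hu
      rw [Sbox_linear _ (DK (k + 1) f (Fin.cons u h') 0) (fun i => A * psi c (Fin.cons u h' : Fin (k+1) → Fin m → ℤ) i)]
      · refine Finset.prod_le_prod (fun _ _ => norm_nonneg _) fun i _ => ?_
        exact cell_bound _ _ _ T (hab _ _) Q hQT
      · intro x
        rw [hf, Finset.mul_sum]
        congr 1
        exact Finset.sum_congr rfl fun i _ => by ring
    · intro u hu v hv hd
      refine Finset.mem_filter.mpr ⟨mem_bx.mpr fun i => ?_, hd⟩
      have a1 := (hHm u).mp hu i
      have a2 := (hHm v).mp hv i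
      simp only [Pi.sub_apply, Int.cast_sub]
      refine (abs_sub _ _).trans (by linarith)
    · intro u v i
      simp only [hpsi]
      push_cast
      simp only [Pi.sub_apply, Int.cast_sub, mul_sub, Finset.sum_sub_distrib]
  refine (Finset.sum_le_sum h1).trans ?_
  rw [← Finset.mul_sum]
  gcongr
  rw [← Nat.cast_sum, ← Finset.card_sigma]
  norm_cast
  apply Finset.card_le_card_of_injOn (fun p => (Fin.cons p.2 p.1 : Fin (k + 1) → Fin m → ℤ))
  · rintro ⟨h', u⟩ hp
    obtain ⟨hh, hu⟩ := Finset.mem_sigma.mp (Finset.mem_coe.mp hp)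
    obtain ⟨hu, hd⟩ := Finset.mem_filter.mp hu
    refine Finset.mem_coe.mpr (mem_Vs.mpr ⟨fun j => ?_, hd⟩)
    refine Fin.cases ?_ (fun j => ?_) j
    · exact hu
    · simp only [Fin.cons_succ]
      refine mem_bx.mpr fun i => ?_
      have := (hHm _).mp (Fintype.mem_piFinset.mp hh j) i
      simp only at this
      linarith
  · rintro ⟨h', u⟩ _ ⟨h'', u'⟩ _ heq
    have := Fin.cons_injective2 heq
    simp only at this
    obtain ⟨rfl, rfl⟩ := this
    rfl

lemma DK_cast {G : Type*} [AddCommGroup G] (k : ℕ) (f : G → ℤ) (h : Fin k → G) (x : G) :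
    DK k (fun x => ((f x : ℤ) : ℝ)) h x = ((DK k f h x : ℤ) : ℝ) := by
  induction k generalizing f with
  | zero => rfl
  | succ k ih =>
    simp only [DK]
    rw [← ih]
    congr 1
    funext y
    simp [fwdDiff]

theorem weyl {m k : ℕ} (F : MvPolynomial (Fin m) ℤ) (hF : F.IsHomogeneous (k + 1 + 1))
    (hsmooth : ∀ z : Fin m → ℂ, z ≠ 0 → eval z (map (Int.castRingHom ℂ) F) = 0 →
      ∃ i, eval z (pderiv i (map (Int.castRingHom ℂ) F)) ≠ 0)
    (c : (Fin (k + 1 + 1) → Fin m) → ℤ)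
    (hsym : ∀ ι (σ : Equiv.Perm (Fin (k + 1 + 1))), c (ι ∘ σ) = c ι)
    (hpoly : C ((k + 1 + 1).factorial : ℤ) * F = ∑ ι, C (c ι) * ∏ j, X (ι j)) (hm : 1 ≤ m) (s : ℝ) (hs : 1 < s) :
    ∃ C1 : ℝ, 0 < C1 ∧ ∃ Cw : ℝ, 0 < Cw ∧ ∀ (f : (Fin m → ℤ) → ℤ) (E : ℤ),
      (∀ h y, DK (k + 1) f h y = DK (k + 1) f h 0 + E * ∑ i, y i * psi c h i) →
      ∀ (α : ℝ) (T : ℕ) (U : ℝ), 1 ≤ U → U ≤ T →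
      (∀ q : ℕ, 1 ≤ q → (q : ℝ) ≤ C1 * U ^ (k + 1) → ¬ dz (q * (E * α)) ≤ U ^ (k + 1) / T ^ (k + 2)) →
      ∀ a b : Fin m → ℤ, (∀ i, b i - a i ≤ T) →
      ‖Sbox (fun x => α * f x) a b‖ ≤ Cw * T ^ m * U ^ (-((m:ℝ) / (2 ^ (k + 1) * s))) := by
  obtain ⟨C1, hC1, C2, hC2, hV⟩ := Vs_small F hF hsmooth c hsym hpoly hm
  set e1 : ℝ := ((2 ^ (k + 1) - (k + 1) - 1 : ℕ) : ℝ) * s + ((k + 1 : ℕ) : ℝ) * (s - 1) with he1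
  set Cs : ℝ := ∑' n : ℤ, (1 / (|(n:ℝ)| + 1)) ^ s with hCs
  have hCs0 : 0 ≤ Cs := tsum_nonneg fun n => by positivity
  set r : ℝ := 2 ^ (k + 1) * s with hr
  have hr0 : 0 < r := by positivity
  have hs0 : 0 < s := by linarith
  set Ct : ℝ := (3:ℝ) ^ (m * e1) * ((3 * (8 * m)) ^ s * Cs) ^ m * C2 with hCt
  have hCt0 : 0 ≤ Ct := by positivity
  refine ⟨C1, hC1, Ct ^ (1 / r) + 1, by positivity, ?_⟩
  intro f E hf α T U hU hUT hno a b hab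
  have hT1 : (1:ℝ) ≤ T := hU.trans hUT
  have hT : 1 ≤ T := by exact_mod_cast hT1
  have hT0 : (0:ℝ) < T := by linarith
  have hU0 : 0 < U := by linarith
  have hVc := hV (E * α) T U hU hUT hno
  have hDK : ∀ h y, DK (k + 1) (fun x => α * (f x : ℝ)) h y = DK (k + 1) (fun x => α * (f x : ℝ)) h 0 +
      (E * α) * ∑ i, (y i : ℝ) * psi c h i := by
    intro h y
    rw [DK_smul, DK_smul, DK_cast, DK_cast, hf h y]
    push_cast; ring
  obtain ⟨a', b', hab', hW⟩ := weyl_diff T (k + 1) (fun x => α * (f x : ℝ)) a b hab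
  have hsum := weyl_sum c hm s hs (fun x => α * (f x : ℝ)) (E * α) hDK T hT a' b' hab'
  set S := ‖Sbox (fun x => α * (f x : ℝ)) a b‖ with hS
  set HH := Fintype.piFinset (fun _ : Fin (k + 1) => Fintype.piFinset (fun _ : Fin m => Finset.Icc (-(T:ℤ)) T)) with hHH
  have hS0 : 0 ≤ S := norm_nonneg _
  set H : ℝ := ((2 * T + 1 : ℕ) : ℝ) ^ m with hH
  have hHpos : 0 < H := by positivity
  have hHle : H ≤ (3 * T : ℝ) ^ (m:ℝ) := by
    rw [Real.rpow_natCast, hH]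
    gcongr
    push_cast; linarith
  have hcard : (HH.card : ℝ) = H ^ (k + 1) := by
    rw [hHH, Fintype.card_piFinset]
    simp only [Fintype.card_piFinset, Int.card_Icc, Finset.prod_const, Finset.card_univ, Fintype.card_fin, Nat.cast_pow, hH]
    congr 3
    omega
  have hmain : S ^ r ≤ Ct * T ^ ((m:ℝ) * r) * U ^ (-(m:ℝ)) := by
    calc S ^ r = (S ^ (2 ^ (k + 1))) ^ s := by
          rw [← Real.rpow_natCast, ← Real.rpow_mul hS0, hr]; push_cast; rfl
      _ ≤ (H ^ (2 ^ (k + 1) - (k + 1) - 1) * ∑ h ∈ HH, ‖Sbox (DK (k + 1) (fun x => α * (f x : ℝ)) h) (a' h) (b' h)‖) ^ s := by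
          gcongr
      _ = (H ^ (2 ^ (k + 1) - (k + 1) - 1)) ^ s * (∑ h ∈ HH, ‖Sbox (DK (k + 1) (fun x => α * (f x : ℝ)) h) (a' h) (b' h)‖) ^ s := by
          rw [Real.mul_rpow (by positivity) (Finset.sum_nonneg fun _ _ => norm_nonneg _)]
      _ ≤ (H ^ (2 ^ (k + 1) - (k + 1) - 1)) ^ s * ((HH.card : ℝ) ^ (s - 1) *
            ∑ h ∈ HH, ‖Sbox (DK (k + 1) (fun x => α * (f x : ℝ)) h) (a' h) (b' h)‖ ^ s) := by
          gcongr
          exact holder_sum HH _ (fun _ _ => norm_nonneg _) s hs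
      _ ≤ (H ^ (2 ^ (k + 1) - (k + 1) - 1)) ^ s * ((HH.card : ℝ) ^ (s - 1) *
            (((3 * (8 * m * T)) ^ s * Cs) ^ m * (C2 * T ^ (m * (k + 1)) * U ^ (-(m:ℝ))))) := by
          gcongr
          refine hsum.trans ?_
          gcongr
      _ = H ^ e1 * (((3 * (8 * m * T)) ^ s * Cs) ^ m * (C2 * T ^ (m * (k + 1)) * U ^ (-(m:ℝ)))) := by
          rw [hcard, ← mul_assoc, he1, Real.rpow_add hHpos, Real.rpow_mul hHpos.le, Real.rpow_mul hHpos.le,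
            Real.rpow_natCast, Real.rpow_natCast]
      _ ≤ ((3 * T : ℝ) ^ (m:ℝ)) ^ e1 * (((3 * (8 * m * T)) ^ s * Cs) ^ m * (C2 * T ^ (m * (k + 1)) * U ^ (-(m:ℝ)))) := by
          gcongr
      _ = Ct * (T ^ ((m:ℝ) * e1) * (T ^ s) ^ m * T ^ (m * (k + 1))) * U ^ (-(m:ℝ)) := by
          rw [← Real.rpow_mul (by positivity), Real.mul_rpow (by positivity) hT0.le,
            show (3 * (8 * (m:ℝ) * T)) = (3 * (8 * m)) * T by ring, Real.mul_rpow (by positivity) hT0.le, hCt]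
          ring
      _ = _ := by
          congr 2
          rw [← Real.rpow_natCast (_ ^ s), ← Real.rpow_mul hT0.le, ← Real.rpow_natCast (T:ℝ), ← Real.rpow_add hT0, ← Real.rpow_add hT0]
          congr 1
          rw [he1, hr]
          have : (k + 1) + 1 ≤ 2 ^ (k + 1) := Nat.lt_two_pow_self
          rw [Nat.sub_sub, Nat.cast_sub this]
          push_cast
          ring
  have h1 : S = (S ^ r) ^ (1 / r) := by rw [← Real.rpow_mul hS0, mul_one_div_cancel hr0.ne', Real.rpow_one]
  rw [h1]
  calc (S ^ r) ^ (1 / r) ≤ (Ct * T ^ ((m:ℝ) * r) * U ^ (-(m:ℝ))) ^ (1 / r) := by gcongr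
    _ = Ct ^ (1 / r) * T ^ m * U ^ (-((m:ℝ) / r)) := by
      rw [Real.mul_rpow (by positivity) (by positivity), Real.mul_rpow hCt0 (by positivity), ← Real.rpow_mul hT0.le,
        ← Real.rpow_mul hU0.le, mul_assoc (m:ℝ), mul_one_div_cancel hr0.ne', mul_one, Real.rpow_natCast]
      congr 2; ring
    _ ≤ _ := by
      gcongr
      linarith

lemma avg_dz (M q : ℕ) (hM : M.Prime) (hq : 0 < q) (hqM : q < M) (η : ℝ) (hη : 1 ≤ η * M)
    [DecidablePred fun r : ℕ => dz (q * ((r:ℝ) / M)) ≤ η] :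
    (((Finset.range M).filter fun r : ℕ => dz (q * ((r:ℝ) / M)) ≤ η).card : ℝ) ≤ 3 * (η * M) := by
  have hM0 : (0:ℝ) < M := by exact_mod_cast hM.pos
  have h0 : 0 ≤ ⌊η * M⌋ := Int.floor_nonneg.2 (by linarith)
  have h1 : ((Finset.range M).filter fun r : ℕ => dz (q * ((r:ℝ) / M)) ≤ η).card ≤
      (Finset.Icc (-⌊η * M⌋) ⌊η * M⌋).card := by
    refine Finset.card_le_card_of_injOn (fun r : ℕ => (q * r - M * round (q * ((r:ℝ) / M)) : ℤ)) ?_ ?_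
    · intro r hr
      rw [Finset.coe_filter] at hr
      have h2 : |(q * ((r:ℝ) / M)) - round (q * ((r:ℝ) / M))| ≤ η := hr.2
      have h3 : |((q * r - M * round (q * ((r:ℝ) / M)) : ℤ) : ℝ)| ≤ η * M := by
        have : ((q * r - M * round (q * ((r:ℝ) / M)) : ℤ) : ℝ) = ((q * ((r:ℝ) / M)) - round (q * ((r:ℝ) / M))) * M := by
          push_cast
          field_simp
        rw [this, abs_mul, abs_of_pos hM0]
        gcongr
      rw [abs_le] at h3
      simp only [Finset.coe_Icc, Set.mem_Icc]
      constructor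
      · have : (q * r - M * round (q * ((r:ℝ) / M)) : ℤ) = - -(q * r - M * round (q * ((r:ℝ) / M)) : ℤ) := by ring
        rw [this, neg_le_neg_iff, Int.le_floor]
        push_cast at h3 ⊢
        linarith [h3.1]
      · rw [Int.le_floor]; exact h3.2
    · intro r hr r' hr' h
      simp only [Finset.coe_filter, Finset.mem_range] at hr hr'
      simp only at h
      have h4 : (M:ℤ) ∣ q * ((r:ℤ) - r') := ⟨round (q * ((r:ℝ) / M)) - round (q * ((r':ℝ) / M)), by linear_combination h⟩
      have h5 : IsCoprime (M:ℤ) q := by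
        rw [Nat.isCoprime_iff_coprime]
        exact Nat.coprime_of_lt_prime hq.ne.symm hqM hM
      have h6 := h5.dvd_of_dvd_mul_left h4
      have h7 := Int.eq_zero_of_abs_lt_dvd h6 (by rw [abs_lt]; have := hr.1; have := hr'.1; constructor <;> omega)
      omega
  have h2 : ((Finset.Icc (-⌊η * M⌋) ⌊η * M⌋).card : ℝ) = 2 * ⌊η * M⌋ + 1 := by
    rw [Int.card_Icc]
    have : (((⌊η * M⌋ + 1 - -⌊η * M⌋).toNat : ℤ) : ℝ) = ((⌊η * M⌋ + 1 - -⌊η * M⌋ : ℤ) : ℝ) := by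
      rw [Int.toNat_of_nonneg (by omega)]
    push_cast at this ⊢
    rw [this]; ring
  have h3 : (⌊η * M⌋ : ℝ) ≤ η * M := Int.floor_le _
  have h4 : (((Finset.range M).filter fun r : ℕ => dz (q * ((r:ℝ) / M)) ≤ η).card : ℝ) ≤ ((Finset.Icc (-⌊η * M⌋) ⌊η * M⌋).card : ℝ) := by
    exact_mod_cast h1
  linarith

lemma ortho_zero (M : ℕ) (hM : 0 < M) (v : ℤ) (hv : v ≠ 0) (hvM : |v| < M) :
    ∑ r ∈ Finset.range M, ee ((r:ℝ) / M * v) = 0 := by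
  have hM0 : (M:ℝ) ≠ 0 := by positivity
  have h1 : ∀ r : ℕ, ee ((r:ℝ) / M * v) = ee (v / M) ^ r := by
    intro r
    induction r with
    | zero => simp [ee_zero]
    | succ r ih => rw [pow_succ, ← ih, ← ee_add]; congr 1; push_cast; field_simp
  simp only [h1]
  have h2 : ee ((v:ℝ) / M) ≠ 1 := by
    intro h
    rw [ee, Complex.exp_eq_one_iff] at h
    obtain ⟨n, hn⟩ := h
    have h3 : ((v:ℝ) / M : ℝ) = n := by
      have h4 : (2 * Real.pi * Complex.I : ℂ) ≠ 0 := Complex.two_pi_I_ne_zero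
      have : (((v:ℝ) / M : ℝ) : ℂ) = ((n : ℝ) : ℂ) := by
        apply mul_right_cancel₀ h4
        push_cast at hn ⊢
        linear_combination hn
      exact_mod_cast this
    rw [div_eq_iff hM0] at h3
    have h5 : v = n * M := by exact_mod_cast h3
    exact hv (Int.eq_zero_of_abs_lt_dvd ⟨n, by rw [h5]; ring⟩ hvM)
  have h3 := mul_geom_sum (ee ((v:ℝ) / M)) M
  rw [← h1 M, div_self hM0, one_mul, ee_int, sub_self] at h3
  rcases mul_eq_zero.1 h3 with h | h
  · exact absurd (sub_eq_zero.1 h) h2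
  · exact h

lemma count_le_avg {m : ℕ} (f : (Fin m → ℤ) → ℤ) (a b : Fin m → ℤ) (M : ℕ) (hM : 0 < M)
    (hf : ∀ y ∈ Finset.Icc a b, |f y| < M) [DecidablePred fun y => f y = 0] :
    (((Finset.Icc a b).filter fun y => f y = 0).card : ℝ) * M ≤
      ∑ r ∈ Finset.range M, ‖Sbox (fun y => ((r:ℝ) / M) * f y) a b‖ := by
  have h1 : ∑ r ∈ Finset.range M, Sbox (fun y => ((r:ℝ) / M) * f y) a b =
      (((Finset.Icc a b).filter fun y => f y = 0).card : ℂ) * M := by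
    simp only [Sbox]
    rw [Finset.sum_comm, Finset.card_filter]
    push_cast
    rw [Finset.sum_mul]
    refine Finset.sum_congr rfl fun y hy => ?_
    split_ifs with h
    · simp [h, ee_zero]
    · rw [zero_mul]; exact ortho_zero M hM _ h (hf y hy)
  have h2 : ‖(((Finset.Icc a b).filter fun y => f y = 0).card : ℂ) * M‖ = (((Finset.Icc a b).filter fun y => f y = 0).card : ℝ) * M := by
    simp
  rw [← h2, ← h1]
  exact norm_sum_le _ _

lemma box_card {m : ℕ} (a b : Fin m → ℤ) (T : ℕ) (hab : ∀ i, b i - a i ≤ T) :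
    ((Finset.Icc a b).card : ℝ) ≤ ((T:ℝ) + 1) ^ m := by
  classical
  have : (Finset.Icc a b).card ≤ (T + 1) ^ m := by
    rw [Pi.card_Icc]
    refine (Finset.prod_le_pow_card _ _ (T + 1) ?_).trans (by simp)
    intro i _
    rw [Int.card_Icc]
    have := hab i
    omega
  exact_mod_cast this

lemma slab_card {m : ℕ} (a b : Fin m → ℤ) (T : ℕ) (hab : ∀ i, b i - a i ≤ T) (i : Fin m) (s : ℤ) (u : ℕ) :
    (((Finset.Icc a b).filter fun y => s ≤ y i ∧ y i < s + u).card : ℝ) ≤ u * ((T:ℝ) + 1) ^ (m - 1) := by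
  classical
  have : ((Finset.Icc a b).filter fun y => s ≤ y i ∧ y i < s + u).card ≤ u * (T + 1) ^ (m - 1) := by
    refine (Finset.card_le_card (t := Fintype.piFinset fun j => if j = i then Finset.Ico s (s + u) else Finset.Icc (a j) (b j)) ?_).trans ?_
    · intro y hy
      rw [Finset.mem_filter, Finset.mem_Icc] at hy
      rw [Fintype.mem_piFinset]
      intro j
      split_ifs with h
      · subst h; rw [Finset.mem_Ico]; exact hy.2
      · rw [Finset.mem_Icc]; exact ⟨hy.1.1 j, hy.1.2 j⟩
    · rw [Fintype.card_piFinset, ← Finset.mul_prod_erase _ _ (Finset.mem_univ i)]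
      simp only [if_true, Int.card_Ico]
      refine Nat.mul_le_mul (by omega) ?_
      refine (Finset.prod_le_pow_card _ _ (T + 1) ?_).trans (by simp)
      intro j hj
      rw [if_neg (Finset.ne_of_mem_erase hj), Int.card_Icc]
      have := hab j
      omega
  exact_mod_cast this

lemma shift_sum {m : ℕ} (g : (Fin m → ℤ) → ℂ) (hg : ∀ y, ‖g y‖ = 1) (a b : Fin m → ℤ) (T : ℕ)
    (hab : ∀ i, b i - a i ≤ T) (i : Fin m) (u : ℕ) :
    ‖∑ y ∈ Finset.Icc a b, g (y + Pi.single i (u:ℤ)) - ∑ y ∈ Finset.Icc a b, g y‖ ≤ 2 * (u * ((T:ℝ) + 1) ^ (m - 1)) := by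
  classical
  set w : Fin m → ℤ := Pi.single i (u:ℤ) with hw
  set P := Finset.Icc a b with hP
  set P' := Finset.Icc (a + w) (b + w) with hP'
  have h1 : ∑ y ∈ P, g (y + w) = ∑ y ∈ P', g y := by
    refine Finset.sum_bij' (fun y _ => y + w) (fun y _ => y - w) ?_ ?_ ?_ ?_ ?_
    · intro y hy; simp only [hP, hP', Finset.mem_Icc] at hy ⊢; exact ⟨by gcongr; exact hy.1, by gcongr; exact hy.2⟩
    · intro y hy; simp only [hP, hP', Finset.mem_Icc] at hy ⊢
      exact ⟨le_sub_iff_add_le.2 hy.1, sub_le_iff_le_add.2 hy.2⟩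
    · intro y _; simp
    · intro y _; simp
    · intro y _; rfl
  have h2 : ∀ s : Finset (Fin m → ℤ), ‖∑ y ∈ s, g y‖ ≤ s.card := by
    intro s
    refine (norm_sum_le _ _).trans ?_
    simp [hg]
  rw [h1, ← Finset.sum_sdiff_sub_sum_sdiff]
  refine (norm_sub_le _ _).trans ?_
  have hwj : ∀ j, j ≠ i → w j = 0 := fun j hj => by simp [hw, hj]
  have hwi : w i = u := by simp [hw]
  have h3 : ((P' \ P).card : ℝ) ≤ u * ((T:ℝ) + 1) ^ (m - 1) := by
    refine le_trans ?_ (slab_card (a + w) (b + w) T (fun j => by simpa using hab j) i (b i + 1) u)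
    norm_cast
    refine Finset.card_le_card ?_
    intro y hy
    simp only [hP, hP', Finset.mem_sdiff, Finset.mem_Icc, Finset.mem_filter] at hy ⊢
    refine ⟨hy.1, ?_, ?_⟩
    · by_contra hc
      apply hy.2
      refine ⟨fun j => ?_, fun j => ?_⟩
      · have := hy.1.1 j
        simp only [Pi.add_apply] at this
        have h0 : 0 ≤ w j := by by_cases hj : j = i; subst hj; rw [hwi]; positivity; rw [hwj j hj]
        linarith
      · by_cases hj : j = i
        · subst hj; have h7 : y j ≤ b j := by omega
          exact h7
        · have := hy.1.2 j; simpa [hwj j hj] using this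
    · have := hy.1.2 i
      simp only [Pi.add_apply, hwi] at this
      omega
  have h4 : ((P \ P').card : ℝ) ≤ u * ((T:ℝ) + 1) ^ (m - 1) := by
    refine le_trans ?_ (slab_card a b T hab i (a i) u)
    norm_cast
    refine Finset.card_le_card ?_
    intro y hy
    simp only [hP, hP', Finset.mem_sdiff, Finset.mem_Icc, Finset.mem_filter] at hy ⊢
    refine ⟨hy.1, hy.1.1 i, ?_⟩
    by_contra hc
    apply hy.2
    refine ⟨fun j => ?_, fun j => ?_⟩
    · by_cases hj : j = i
      · subst hj; simp only [Pi.add_apply, hwi]; omega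
      · have := hy.1.1 j; simpa [hwj j hj] using this
    · have := hy.1.2 j
      simp only [Pi.add_apply]
      have h0 : 0 ≤ w j := by by_cases hj : j = i; subst hj; rw [hwi]; positivity; rw [hwj j hj]
      linarith
  have := h2 (P' \ P)
  have := h2 (P \ P')
  linarith

lemma dz_ge (p : ℕ) (hp : p.Prime) (v : ℤ) (hv : ¬ (p:ℤ) ∣ v) : 1 / (p:ℝ) ≤ dz (v / p) := by
  have hp0 : (0:ℝ) < p := by exact_mod_cast hp.pos
  rw [dz, div_le_iff₀ hp0, ← abs_of_pos hp0, ← abs_mul, abs_of_pos hp0, sub_mul, div_mul_cancel₀ _ hp0.ne']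
  have : (1:ℤ) ≤ |v - round ((v:ℝ) / p) * p| := by
    refine Int.one_le_abs fun h => hv ⟨round ((v:ℝ) / p), by linear_combination h⟩
  exact_mod_cast this

lemma shift_bound {m : ℕ} (f : (Fin m → ℤ) → ℤ) (a b : Fin m → ℤ) (T : ℕ) (hab : ∀ i, b i - a i ≤ T)
    (i : Fin m) (u p : ℕ) (hp : p.Prime) (hu : 1 ≤ u) (l : ℤ) (hl : ¬ (p:ℤ) ∣ l) (b' : ℤ) (hb' : ¬ (p:ℤ) ∣ b')
    (α β : ℝ) (hα : α = b' / (p * u) + β)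
    (hf : ∀ y ∈ Finset.Icc a b, (p * u : ℤ) ∣ f (y + Pi.single i (u:ℤ)) - f y - u * l) (Δ : ℝ) (hΔ0 : 0 ≤ Δ)
    (hΔ : ∀ y ∈ Finset.Icc a b, |((f (y + Pi.single i (u:ℤ)) - f y : ℤ) : ℝ)| ≤ Δ) :
    ‖Sbox (fun y => α * f y) a b‖ * (4 / p) ≤
      ((T:ℝ) + 1) ^ m * (2 * Real.pi * (|β| * Δ)) + 2 * (u * ((T:ℝ) + 1) ^ (m - 1)) := by
  set g : (Fin m → ℤ) → ℂ := fun y => ee (α * f y) with hg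
  have hp0 : (p:ℝ) ≠ 0 := by exact_mod_cast hp.ne_zero
  have hu0 : (u:ℝ) ≠ 0 := by positivity
  set ζ := ee (((b' * l : ℤ) : ℝ) / p) with hζ
  set S := Sbox (fun y => α * f y) a b with hS
  have hS' : S = ∑ y ∈ Finset.Icc a b, g y := rfl
  have h1 := shift_sum g (fun y => ee_norm _) a b T hab i u
  have h2 : ∀ y ∈ Finset.Icc a b, ‖g (y + Pi.single i (u:ℤ)) - ζ * g y‖ ≤ 2 * Real.pi * (|β| * Δ) := by
    intro y hy
    obtain ⟨z, hz⟩ := hf y hy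
    have h3 : α * f (y + Pi.single i (u:ℤ)) = α * f y + (((b' * l : ℤ) : ℝ) / p + ((b' * z : ℤ) : ℝ)) +
        β * ((f (y + Pi.single i (u:ℤ)) - f y : ℤ) : ℝ) := by
      have h4 : ((f (y + Pi.single i (u:ℤ)) : ℤ):ℝ) = f y + u * l + p * u * z := by
        have : f (y + Pi.single i (u:ℤ)) = f y + u * l + p * u * z := by linear_combination hz
        exact_mod_cast this
      have h5 : α * ((f (y + Pi.single i (u:ℤ)) : ℤ):ℝ) - α * f y = (b' / (p * u) + β) * (u * l + p * u * z) := by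
        rw [h4, hα]; ring
      have h6 : (b' / (p * u) : ℝ) * (u * l + p * u * z) = b' * l / p + b' * z := by
        field_simp
      push_cast
      rw [h4] at h5 ⊢
      linear_combination h5 + h6
    have h4 : g (y + Pi.single i (u:ℤ)) - ζ * g y = (g y * ζ) * (ee (β * ((f (y + Pi.single i (u:ℤ)) - f y : ℤ) : ℝ)) - 1) := by
      simp only [hg]
      rw [h3, ee_add, ee_add, ee_add, ee_int]
      ring
    rw [h4, norm_mul, norm_mul, hζ, hg]
    simp only [ee_norm, one_mul]
    refine (ee_sub_one_le _).trans ?_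
    rw [abs_mul]
    have := hΔ y hy
    have := Real.pi_pos
    gcongr
  have h3 : ‖∑ y ∈ Finset.Icc a b, g (y + Pi.single i (u:ℤ)) - ζ * S‖ ≤ ((T:ℝ) + 1) ^ m * (2 * Real.pi * (|β| * Δ)) := by
    rw [hS', Finset.mul_sum, ← Finset.sum_sub_distrib]
    refine (norm_sum_le _ _).trans ?_
    refine (Finset.sum_le_sum h2).trans ?_
    rw [Finset.sum_const, nsmul_eq_mul]
    have := Real.pi_pos
    have := box_card a b T hab
    gcongr
  have h4 : 4 / (p:ℝ) ≤ ‖ζ - 1‖ := by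
    refine le_trans ?_ (ee_sub_one_ge _)
    have : ¬ (p:ℤ) ∣ b' * l := by
      intro h
      rcases (Nat.prime_iff_prime_int.1 hp).dvd_or_dvd h with h | h
      · exact hb' h
      · exact hl h
    have := dz_ge p hp _ this
    rw [show 4 / (p:ℝ) = 4 * (1 / p) by ring]
    gcongr
  have h5 : ‖S‖ * ‖ζ - 1‖ ≤ ((T:ℝ) + 1) ^ m * (2 * Real.pi * (|β| * Δ)) + 2 * (u * ((T:ℝ) + 1) ^ (m - 1)) := by
    rw [← norm_mul]
    have : S * (ζ - 1) = -((∑ y ∈ Finset.Icc a b, g (y + Pi.single i (u:ℤ)) - ζ * S)) +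
      (∑ y ∈ Finset.Icc a b, g (y + Pi.single i (u:ℤ)) - ∑ y ∈ Finset.Icc a b, g y) := by rw [← hS']; ring
    rw [this]
    refine (norm_add_le _ _).trans ?_
    rw [norm_neg]
    exact add_le_add h3 h1
  exact le_trans (by gcongr) h5

lemma approx_dich (p K q : ℕ) (hp : p = 1 ∨ p.Prime) (hq : 1 ≤ q) (α η : ℝ) (h : dz (q * (((p:ℤ) ^ K : ℤ) * α)) ≤ η) :
    dz (q * α) ≤ η / p ^ K ∨ p.Prime ∧ ∃ (u : ℕ) (b' : ℤ) (β : ℝ), 1 ≤ u ∧ p * u ∣ q * p ^ K ∧ ¬ (p:ℤ) ∣ b' ∧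
      α = b' / (p * u) + β ∧ |β| ≤ η / (q * p ^ K) := by
  rcases hp with rfl | hp
  · left; simpa using h
  have hp0 : (0:ℝ) < p := by exact_mod_cast hp.pos
  have hq0 : (0:ℝ) < q := by exact_mod_cast hq
  set b := round (q * ((((p:ℤ) ^ K : ℤ):ℝ) * α)) with hb
  set θ := q * ((((p:ℤ) ^ K : ℤ):ℝ) * α) - b with hθ
  have hθη : |θ| ≤ η := h
  set r : ℚ := (b : ℚ) / ((q * p ^ K : ℕ) : ℚ) with hr
  have hα : α = (r : ℝ) + θ / (q * p ^ K) := by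
    rw [hr, hθ]; push_cast; field_simp; ring
  have hβ : |θ / (q * p ^ K)| ≤ η / (q * p ^ K) := by
    rw [abs_div, abs_of_pos (show (0:ℝ) < q * p ^ K by positivity)]
    gcongr
  have hden : r.den ∣ q * p ^ K := by
    have := Rat.den_dvd b ((q * p ^ K : ℕ) : ℤ)
    have e : Rat.divInt b ((q * p ^ K : ℕ) : ℤ) = r := by
      rw [Rat.divInt_eq_div, hr]; push_cast; rfl
    rw [e] at this
    exact_mod_cast this
  by_cases hpd : p ∣ r.den
  · right
    obtain ⟨u, hu⟩ := hpd
    refine ⟨hp, u, r.num, _, ?_, hu ▸ hden, ?_, ?_, hβ⟩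
    · rcases Nat.eq_zero_or_pos u with h0 | h0
      · rw [h0, mul_zero] at hu; exact absurd hu r.den_nz
      · exact h0
    · intro hd
      have h1 := r.reduced
      have h2 : p ∣ r.num.natAbs := Int.natCast_dvd.1 hd
      have h3 := Nat.dvd_gcd h2 (Dvd.intro u hu.symm)
      rw [h1] at h3
      exact hp.one_lt.ne' (Nat.dvd_one.1 h3)
    · rw [hα]
      congr 1
      have := Rat.num_div_den r
      have h2 : ((r : ℚ) : ℝ) = (r.num : ℝ) / (r.den : ℝ) := by exact_mod_cast this.symm
      rw [h2, hu]; push_cast; rfl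
  · left
    have hc : Nat.Coprime r.den (p ^ K) := ((Nat.Prime.coprime_iff_not_dvd hp).2 hpd).symm.pow_right K
    obtain ⟨t, ht⟩ := hc.dvd_of_dvd_mul_right hden
    refine (dz_le _ (t * r.num)).trans ?_
    have h2 : ((r : ℚ) : ℝ) = (r.num : ℝ) / (r.den : ℝ) := by exact_mod_cast (Rat.num_div_den r).symm
    have hd0 : (r.den : ℝ) ≠ 0 := by exact_mod_cast r.den_nz
    have h3 : (q:ℝ) * α - ((t * r.num : ℤ) : ℝ) = q * (θ / (q * p ^ K)) := by
      rw [hα, h2, ht]; push_cast; field_simp; ring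
    rw [h3, abs_mul, abs_of_pos hq0]
    calc q * |θ / (q * p ^ K)| ≤ q * (η / (q * p ^ K)) := by gcongr
      _ = _ := by field_simp

/-- local hypotheses on the polynomial function `f` modulo `p` -/
def good {m : ℕ} (f : (Fin m → ℤ) → ℤ) (a b : Fin m → ℤ) (p K T : ℕ) (Cf : ℝ) : Prop :=
  ∃ (i : Fin m) (l : ℤ), ¬ (p:ℤ) ∣ l ∧ (∀ y ∈ Finset.Icc a b, ∀ u : ℕ, (p * u : ℤ) ∣ f (y + Pi.single i (u:ℤ)) - f y - u * l) ∧
    ∀ y ∈ Finset.Icc a b, ∀ u : ℕ, u ≤ T → |((f (y + Pi.single i (u:ℤ)) - f y : ℤ) : ℝ)| ≤ Cf * (u * (p ^ K * T ^ K))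

lemma Sbox_trivial {m : ℕ} (f : (Fin m → ℤ) → ℝ) (a b : Fin m → ℤ) (T : ℕ) (hT : 1 ≤ T) (hab : ∀ i, b i - a i ≤ T) :
    ‖Sbox f a b‖ ≤ 2 ^ m * T ^ m := by
  refine (norm_sum_le _ _).trans ?_
  simp only [ee_norm, Finset.sum_const, nsmul_eq_mul, mul_one]
  refine (box_card a b T hab).trans ?_
  rw [← mul_pow]
  have : (1:ℝ) ≤ T := by exact_mod_cast hT
  gcongr
  linarith

lemma shift_case {m : ℕ} (hm : 1 ≤ m) (C1 Cf : ℝ) (hC1 : 0 < C1) (hCf : 0 < Cf) (f : (Fin m → ℤ) → ℤ) (a b : Fin m → ℤ) (p K T q : ℕ)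
    (hT : 1 ≤ T) (hab : ∀ i, b i - a i ≤ T) (hp : p.Prime) (hg : good f a b p K T Cf) (α U : ℝ) (hU : 1 ≤ U)
    (hq : 1 ≤ q) (hqU : q ≤ C1 * U ^ K)
    (h : ∃ (u : ℕ) (b' : ℤ) (β : ℝ), 1 ≤ u ∧ p * u ∣ q * p ^ K ∧ ¬ (p:ℤ) ∣ b' ∧
      α = b' / (p * u) + β ∧ |β| ≤ (U ^ K / T ^ (K + 1)) / (q * p ^ K)) :
    ‖Sbox (fun y => α * f y) a b‖ ≤ 2 ^ m * (2 * Cf + C1) * (T ^ m * (U ^ K * (p ^ K / T))) := by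
  obtain ⟨u, b', β, hu, hdvd, hb', hα, hβ⟩ := h
  obtain ⟨i, l, hl, h1, h2⟩ := hg
  have hp0 : (0:ℝ) < p := by exact_mod_cast hp.pos
  have hp1 : (1:ℝ) ≤ p := by exact_mod_cast hp.one_le
  have hq0 : (0:ℝ) < q := by exact_mod_cast hq
  have hT1 : (1:ℝ) ≤ T := by exact_mod_cast hT
  have hT0 : (0:ℝ) < T := by linarith
  have hU0 : 0 < U := by linarith
  have hu0 : (1:ℝ) ≤ u := by exact_mod_cast hu
  have hpu : (p:ℝ) * u ≤ q * p ^ K := by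
    have := Nat.le_of_dvd (Nat.mul_pos (by omega) (pow_pos hp.pos K)) hdvd
    exact_mod_cast this
  have hpu2 : (p:ℝ) * u ≤ C1 * U ^ K * p ^ K := hpu.trans (by gcongr)
  by_cases huT : u ≤ T
  · have hΔ0 : 0 ≤ Cf * (u * ((p:ℝ) ^ K * T ^ K)) := by positivity
    have h3 := shift_bound f a b T hab i u p hp hu l hl b' hb' α β hα (fun y hy => h1 y hy u) _ hΔ0 (fun y hy => h2 y hy u huT)
    set S := ‖Sbox (fun y => α * f y) a b‖ with hS
    have h4 : |β| * (Cf * (u * ((p:ℝ) ^ K * T ^ K))) ≤ Cf * (p ^ K * U ^ K) / (p * T) := by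
      calc |β| * (Cf * (u * ((p:ℝ) ^ K * T ^ K))) ≤ (U ^ K / T ^ (K + 1)) / (q * p ^ K) * (Cf * (u * ((p:ℝ) ^ K * T ^ K))) := by gcongr
        _ = Cf * U ^ K * (p * u) / (p * T * q) := by rw [pow_succ]; field_simp
        _ ≤ Cf * U ^ K * (q * p ^ K) / (p * T * q) := by gcongr
        _ = _ := by field_simp
    have h5 : (T:ℝ) + 1 ≤ 2 * T := by linarith
    have hpi : Real.pi ≤ 4 := Real.pi_le_four
    have hpi0 := Real.pi_pos
    have e1 : (2 * (T:ℝ)) ^ m = 2 * T * (2 * T) ^ (m - 1) := by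
      rw [← pow_succ']; congr 1; omega
    have h6 : S * (4 / p) ≤ (2 * T) ^ m * (2 * 4 * (Cf * (p ^ K * U ^ K) / (p * T))) + 2 * (u * (2 * (T:ℝ)) ^ (m - 1)) := by
      refine h3.trans ?_
      gcongr
    have h7 : S ≤ (p / 4) * ((2 * T) ^ m * (2 * 4 * (Cf * (p ^ K * U ^ K) / (p * T))) + 2 * (u * (2 * (T:ℝ)) ^ (m - 1))) := by
      calc S = (p / 4) * (S * (4 / p)) := by field_simp
        _ ≤ _ := by gcongr
    refine h7.trans ?_
    have h8 : (p / 4) * ((2 * T) ^ m * (2 * 4 * (Cf * (p ^ K * U ^ K) / (p * T))) + 2 * (u * (2 * (T:ℝ)) ^ (m - 1))) =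
        (2 * T) ^ m * (2 * Cf * (p ^ K * U ^ K) / T) + (p * u) * (2 * T) ^ m / (4 * T) := by
      rw [e1]; field_simp
    rw [h8]
    calc (2 * (T:ℝ)) ^ m * (2 * Cf * (p ^ K * U ^ K) / T) + (p * u) * (2 * T) ^ m / (4 * T)
        ≤ (2 * (T:ℝ)) ^ m * (2 * Cf * (p ^ K * U ^ K) / T) + (C1 * U ^ K * p ^ K) * (2 * T) ^ m / (1 * T) := by
          gcongr; norm_num
      _ = _ := by rw [mul_pow]; field_simp
  · refine (Sbox_trivial _ a b T hT hab).trans ?_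
    have h3 : (T:ℝ) ≤ u := by exact_mod_cast (not_le.1 huT).le
    have h4 : (T:ℝ) ≤ C1 * U ^ K * p ^ K := by nlinarith
    have h5 : 1 ≤ (2 * Cf + C1) * (U ^ K * (p ^ K / T)) := by
      rw [← mul_div_assoc, ← mul_div_assoc, le_div_iff₀ hT0]
      have : 0 ≤ 2 * Cf * (U ^ K * p ^ K) := by positivity
      nlinarith
    calc (2:ℝ) ^ m * T ^ m = 2 ^ m * T ^ m * 1 := by ring
      _ ≤ 2 ^ m * T ^ m * ((2 * Cf + C1) * (U ^ K * (p ^ K / T))) := by gcongr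
      _ = _ := by ring

/-- pointwise bound for the exponential sum -/
lemma pointwise {m : ℕ} (hm : 1 ≤ m) (C1 Cf Cw : ℝ) (hC1 : 0 < C1) (hCf : 0 < Cf) (hCw : 0 < Cw) (K : ℕ) (σ σ' θ : ℝ)
    (hσ : 0 < σ) (hθ : 0 < θ) (hθ1 : θ < 1) (hσ' : σ' = σ * (1 - θ) - K * θ) : ∃ C3 : ℝ, 0 < C3 ∧
    ∀ (f : (Fin m → ℤ) → ℤ) (a b : Fin m → ℤ) (p T J : ℕ), 1 ≤ T → (∀ i, b i - a i ≤ T) → (p = 1 ∨ p.Prime ∧ good f a b p K T Cf) →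
    2 ^ J ≤ T → ∀ α : ℝ,
    (∀ U : ℝ, 1 ≤ U → U ≤ T → (∀ q : ℕ, 1 ≤ q → (q : ℝ) ≤ C1 * U ^ K → ¬ dz (q * (((p:ℤ) ^ K : ℤ) * α)) ≤ U ^ K / T ^ (K + 1)) →
      ‖Sbox (fun x => α * f x) a b‖ ≤ Cw * T ^ m * U ^ (-σ)) →
    (‖Sbox (fun x => α * f x) a b‖ ≤ C3 * T ^ m * ((2:ℝ) ^ J) ^ (-σ)) ∨
    ∃ j ≤ J, ∃ q : ℕ, 1 ≤ q ∧ q ≤ C1 * ((2:ℝ) ^ j) ^ K ∧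
      (dz (q * α) ≤ ((2:ℝ) ^ j) ^ K / T ^ (K + 1) / p ^ K ∧ ‖Sbox (fun x => α * f x) a b‖ ≤ C3 * T ^ m * ((2:ℝ) ^ j) ^ (-σ) ∨
       dz (q * (((p:ℤ) ^ K : ℤ) * α)) ≤ ((2:ℝ) ^ j) ^ K / T ^ (K + 1) ∧
        ‖Sbox (fun x => α * f x) a b‖ ≤ C3 * T ^ m * (((2:ℝ) ^ j) ^ (-σ') * ((p:ℝ) ^ K / T) ^ θ)) := by
  set CA : ℝ := Cw * 2 ^ σ + 2 ^ m + 2 ^ m * (2 * Cf + C1) + Cw with hCA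
  have hCA0 : 0 < CA := by positivity
  refine ⟨CA, hCA0, ?_⟩
  intro f a b p T J hT hab hp hJ α hW
  set S := ‖Sbox (fun x => α * f x) a b‖ with hS
  have hS0 : 0 ≤ S := norm_nonneg _
  have hT0 : (0:ℝ) < T := by exact_mod_cast hT
  classical
  let P : ℕ → Prop := fun j => ∃ q : ℕ, 1 ≤ q ∧ (q : ℝ) ≤ C1 * ((2:ℝ) ^ j) ^ K ∧
    dz (q * (((p:ℤ) ^ K : ℤ) * α)) ≤ ((2:ℝ) ^ j) ^ K / T ^ (K + 1)
  have hJT : ∀ j ≤ J, (2:ℝ) ^ j ≤ T := by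
    intro j hj
    have : 2 ^ j ≤ T := (Nat.pow_le_pow_right (by norm_num) hj).trans hJ
    exact_mod_cast this
  have hWj : ∀ j ≤ J, ¬ P j → S ≤ Cw * T ^ m * ((2:ℝ) ^ j) ^ (-σ) := by
    intro j hj hPj
    refine hW _ (one_le_pow₀ (by norm_num)) (hJT j hj) ?_
    intro q hq1 hq2 hq3
    exact hPj ⟨q, hq1, hq2, hq3⟩
  by_cases hex : ∃ j, j ≤ J ∧ P j
  · right
    have hsp := Nat.find_spec hex
    set j := Nat.find hex with hj
    obtain ⟨hjJ, q, hq1, hq2, hq3⟩ := hsp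
    have hb1 : S ≤ CA * T ^ m * ((2:ℝ) ^ j) ^ (-σ) := by
      rcases Nat.eq_zero_or_pos j with h0 | h0
      · rw [h0, pow_zero, Real.one_rpow, mul_one]
        refine (Sbox_trivial _ a b T hT hab).trans ?_
        gcongr
        have : 0 < Cw * 2 ^ σ + 2 ^ m * (2 * Cf + C1) + Cw := by positivity
        linarith
      · have hlt : j - 1 < Nat.find hex := by omega
        have h1 := Nat.find_min hex hlt
        have h2 : ¬ P (j - 1) := fun h => h1 ⟨by omega, h⟩
        have h3 := hWj (j - 1) (by omega) h2
        refine h3.trans ?_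
        have e : ((2:ℝ) ^ (j - 1)) ^ (-σ) = 2 ^ σ * ((2:ℝ) ^ j) ^ (-σ) := by
          have : (2:ℝ) ^ (j - 1) = 2 ^ j * 2⁻¹ := by
            obtain ⟨t, ht⟩ : ∃ t, j = t + 1 := ⟨j - 1, by omega⟩
            rw [ht, pow_succ]; simp
          rw [this, Real.mul_rpow (by positivity) (by positivity), Real.inv_rpow (by norm_num), Real.rpow_neg (by norm_num : (0:ℝ) ≤ 2) σ, inv_inv]
          ring
        rw [e]
        have : 0 < 2 ^ m + 2 ^ m * (2 * Cf + C1) + Cw := by positivity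
        calc Cw * T ^ m * (2 ^ σ * ((2:ℝ) ^ j) ^ (-σ)) = (Cw * 2 ^ σ) * T ^ m * ((2:ℝ) ^ j) ^ (-σ) := by ring
          _ ≤ _ := by gcongr; linarith
    refine ⟨j, hjJ, q, hq1, hq2, ?_⟩
    rcases approx_dich p K q (hp.imp id And.left) hq1 α _ hq3 with h | ⟨hpp, h⟩
    · left; exact ⟨h, hb1⟩
    · right
      refine ⟨hq3, ?_⟩
      have hg : good f a b p K T Cf := by
        rcases hp with hp | hp
        · exact absurd hpp (by rw [hp]; exact Nat.not_prime_one)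
        · exact hp.2
      have hp0 : (0:ℝ) < p := by exact_mod_cast hpp.pos
      have h2 := shift_case hm C1 Cf hC1 hCf f a b p K T q hT hab hpp hg α ((2:ℝ) ^ j) (one_le_pow₀ (by norm_num)) hq1 hq2 h
      have hb2 : S ≤ CA * (T ^ m * (((2:ℝ) ^ j) ^ K * (p ^ K / T))) := by
        refine h2.trans ?_
        have : 0 < Cw * 2 ^ σ + 2 ^ m + Cw := by positivity
        gcongr
        linarith
      have hV : (0:ℝ) < 2 ^ j := by positivity
      calc S = S ^ (1 - θ) * S ^ θ := by
            rw [← Real.rpow_add' hS0 (by norm_num)]; simp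
        _ ≤ (CA * T ^ m * ((2:ℝ) ^ j) ^ (-σ)) ^ (1 - θ) * (CA * (T ^ m * (((2:ℝ) ^ j) ^ K * (p ^ K / T)))) ^ θ := by
            gcongr
        _ = (CA * T ^ m) ^ (1 - θ) * (CA * T ^ m) ^ θ * (((2:ℝ) ^ j) ^ (-σ * (1 - θ)) * ((2:ℝ) ^ j) ^ (K * θ) * ((p:ℝ) ^ K / T) ^ θ) := by
            rw [← mul_assoc CA, Real.mul_rpow (x := CA * (T:ℝ) ^ m) (z := 1 - θ) (by positivity) (by positivity), Real.mul_rpow (x := CA * (T:ℝ) ^ m) (z := θ) (by positivity) (by positivity),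
              Real.mul_rpow (x := ((2:ℝ) ^ j) ^ K) (by positivity) (by positivity), ← Real.rpow_mul hV.le, Real.rpow_mul hV.le K,
              Real.rpow_natCast]
            ring
        _ = _ := by
            rw [← Real.rpow_add (by positivity), ← Real.rpow_add hV]
            congr 2
            · simp
            · congr 1
              rw [hσ']; ring_nf
  · left
    push Not at hex
    refine (hWj J le_rfl (hex J le_rfl)).trans ?_
    have : 0 < Cw * 2 ^ σ + 2 ^ m + 2 ^ m * (2 * Cf + C1) := by positivity
    gcongr
    linarith

lemma geom2_le (δ : ℝ) (hδ : 0 < δ) (J : ℕ) : ∑ j ∈ Finset.range J, ((2:ℝ) ^ j) ^ (-δ) ≤ ∑' j : ℕ, ((2:ℝ) ^ (-δ)) ^ j := by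
  have h1 : ∀ j : ℕ, ((2:ℝ) ^ j) ^ (-δ) = ((2:ℝ) ^ (-δ)) ^ j := by
    intro j
    rw [← Real.rpow_natCast, ← Real.rpow_mul (by norm_num), ← Real.rpow_natCast, ← Real.rpow_mul (by norm_num), mul_comm]
  simp only [h1]
  refine Summable.sum_le_tsum _ (fun _ _ => by positivity) (summable_geometric_of_lt_one (by positivity) ?_)
  exact Real.rpow_lt_one_of_one_lt_of_neg (by norm_num) (by linarith)

theorem count_main {m : ℕ} (hm : 1 ≤ m) (C1 Cf Cw : ℝ) (hC1 : 0 < C1) (hCf : 0 < Cf) (hCw : 0 < Cw) (K : ℕ) (σ θ : ℝ)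
    (hσ : 2 * K < σ) (hθ : 0 < θ) (hθ1 : θ < 1) (hσ' : 2 * K < σ * (1 - θ) - K * θ) : ∃ C5 : ℝ, 0 < C5 ∧
    ∀ (f : (Fin m → ℤ) → ℤ) (a b : Fin m → ℤ) (p T : ℕ), 1 ≤ T → (∀ i, b i - a i ≤ T) → (p = 1 ∨ p.Prime ∧ good f a b p K T Cf) →
    (∀ α U : ℝ, 1 ≤ U → U ≤ T → (∀ q : ℕ, 1 ≤ q → (q : ℝ) ≤ C1 * U ^ K → ¬ dz (q * (((p:ℤ) ^ K : ℤ) * α)) ≤ U ^ K / T ^ (K + 1)) →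
      ‖Sbox (fun x => α * f x) a b‖ ≤ Cw * T ^ m * U ^ (-σ)) →
    (((Finset.Icc a b).filter fun y => f y = 0).card : ℝ) ≤ C5 * (T ^ m / T ^ (K + 1)) *
      ((T:ℝ) ^ (K + 1 - σ) + 1 / p ^ K + ((p:ℝ) ^ K / T) ^ θ) := by
  classical
  have hσ0 : 0 < σ := lt_of_le_of_lt (by positivity) hσ
  set σ' : ℝ := σ * (1 - θ) - K * θ with hσ'e
  obtain ⟨C3, hC3, hpt⟩ := pointwise hm C1 Cf Cw hC1 hCf hCw K σ σ' θ hσ0 hθ hθ1 rfl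
  set G1 : ℝ := ∑' j : ℕ, ((2:ℝ) ^ (-(σ - 2 * K))) ^ j with hG1
  set G2 : ℝ := ∑' j : ℕ, ((2:ℝ) ^ (-(σ' - 2 * K))) ^ j with hG2
  have hG10 : 0 ≤ G1 := tsum_nonneg fun _ => by positivity
  have hG20 : 0 ≤ G2 := tsum_nonneg fun _ => by positivity
  set C5 : ℝ := C3 * (2 ^ σ + 3 * C1 * G1 + 3 * C1 * G2) with hC5
  refine ⟨C5, by positivity, ?_⟩
  intro f a b p T hT hab hp hW
  have hp1 : 1 ≤ p := by rcases hp with h | h; omega; exact h.1.one_le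
  have hpR : (0:ℝ) < p := by exact_mod_cast hp1
  have hT0 : (0:ℝ) < T := by exact_mod_cast hT
  set J := Nat.log 2 T with hJ
  have hJT : 2 ^ J ≤ T := Nat.pow_log_le_self 2 (by omega)
  have hTJ : T < 2 ^ (J + 1) := Nat.lt_pow_succ_log_self (by norm_num) T
  -- choose the modulus
  set Q : ℕ := ∑ y ∈ Finset.Icc a b, (f y).natAbs + (⌈C1 * T ^ K⌉₊ + 1) * p ^ K + p ^ K * T ^ (K + 1) + 1 with hQ
  obtain ⟨M, hMQ, hM⟩ := Nat.exists_infinite_primes Q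
  have hM0 : (0:ℝ) < M := by exact_mod_cast hM.pos
  have hfM : ∀ y ∈ Finset.Icc a b, |f y| < M := by
    intro y hy
    have h1 : (f y).natAbs ≤ ∑ y ∈ Finset.Icc a b, (f y).natAbs :=
      Finset.single_le_sum (f := fun y => (f y).natAbs) (fun _ _ => Nat.zero_le _) hy
    have h2 : (f y).natAbs < M := by
      have : 0 ≤ (⌈C1 * T ^ K⌉₊ + 1) * p ^ K + p ^ K * T ^ (K + 1) := by positivity
      omega
    rw [Int.abs_eq_natAbs]
    exact_mod_cast h2
  have hM2 : (⌈C1 * T ^ K⌉₊ + 1) * p ^ K < M := by omega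
  have hM3 : (p:ℝ) ^ K * T ^ (K + 1) ≤ M := by
    have : p ^ K * T ^ (K + 1) ≤ M := by omega
    exact_mod_cast this
  have hcount := count_le_avg f a b M hM.pos hfM
  let η : ℕ → ℝ := fun j => ((2:ℝ) ^ j) ^ K / T ^ (K + 1)
  let Qj : ℕ → Finset ℕ := fun j => Finset.Icc 1 ⌊C1 * ((2:ℝ) ^ j) ^ K⌋₊
  let Θ : ℝ := ((p:ℝ) ^ K / T) ^ θ
  have hΘ : 0 ≤ Θ := by positivity
  let X : ℕ → ℝ := fun j => C3 * T ^ m * ((2:ℝ) ^ j) ^ (-σ)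
  let Y : ℕ → ℝ := fun j => C3 * T ^ m * (((2:ℝ) ^ j) ^ (-σ') * Θ)
  have hX : ∀ j, 0 ≤ X j := fun j => by positivity
  have hY : ∀ j, 0 ≤ Y j := fun j => by positivity
  have hpw : ∀ r ∈ Finset.range M, ‖Sbox (fun y => ((r:ℝ) / M) * f y) a b‖ ≤ X J +
      ∑ j ∈ Finset.range (J + 1), ∑ q ∈ Qj j, ((if dz (q * ((r:ℝ) / M)) ≤ η j / p ^ K then X j else 0) +
        (if dz ((q * p ^ K : ℕ) * ((r:ℝ) / M)) ≤ η j then Y j else 0)) := by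
    intro r _
    have hnn : ∀ j q, 0 ≤ ((if dz ((q:ℕ) * ((r:ℝ) / M)) ≤ η j / p ^ K then X j else 0) +
        (if dz ((q * p ^ K : ℕ) * ((r:ℝ) / M)) ≤ η j then Y j else 0)) := by
      intro j q
      have := hX j
      have := hY j
      positivity
    rcases hpt f a b p T J hT hab hp hJT ((r:ℝ) / M) (hW _) with h | ⟨j, hj, q, hq1, hq2, h⟩
    · refine h.trans ?_
      have : 0 ≤ ∑ j ∈ Finset.range (J + 1), ∑ q ∈ Qj j, ((if dz (q * ((r:ℝ) / M)) ≤ η j / p ^ K then X j else 0) +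
        (if dz ((q * p ^ K : ℕ) * ((r:ℝ) / M)) ≤ η j then Y j else 0)) :=
        Finset.sum_nonneg fun j _ => Finset.sum_nonneg fun q _ => hnn j q
      simp only [X]; linarith
    · have hqm : q ∈ Qj j := Finset.mem_Icc.2 ⟨hq1, Nat.le_floor hq2⟩
      have h1 : ((if dz ((q:ℕ) * ((r:ℝ) / M)) ≤ η j / p ^ K then X j else 0) +
        (if dz ((q * p ^ K : ℕ) * ((r:ℝ) / M)) ≤ η j then Y j else 0)) ≤ ∑ j ∈ Finset.range (J + 1), ∑ q ∈ Qj j, ((if dz (q * ((r:ℝ) / M)) ≤ η j / p ^ K then X j else 0) +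
        (if dz ((q * p ^ K : ℕ) * ((r:ℝ) / M)) ≤ η j then Y j else 0)) := by
        refine le_trans ?_ (Finset.single_le_sum (fun j _ => Finset.sum_nonneg fun q _ => hnn j q) (Finset.mem_range.2 (Nat.lt_succ_of_le hj)))
        exact Finset.single_le_sum (fun q _ => hnn j q) hqm
      have h2 : ‖Sbox (fun y => ((r:ℝ) / M) * f y) a b‖ ≤ ((if dz ((q:ℕ) * ((r:ℝ) / M)) ≤ η j / p ^ K then X j else 0) +
        (if dz ((q * p ^ K : ℕ) * ((r:ℝ) / M)) ≤ η j then Y j else 0)) := by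
        rcases h with ⟨h3, h4⟩ | ⟨h3, h4⟩
        · rw [if_pos h3]
          refine h4.trans ?_
          have := hY j
          have : 0 ≤ (if dz ((q * p ^ K : ℕ) * ((r:ℝ) / M)) ≤ η j then Y j else 0) := by positivity
          simp only [X]; linarith
        · have e : dz ((q * p ^ K : ℕ) * ((r:ℝ) / M)) ≤ η j := by
            push_cast at h3 ⊢
            rw [← mul_assoc] at h3
            exact h3
          rw [if_pos e]
          refine h4.trans ?_
          have := hX j
          have : 0 ≤ (if dz ((q:ℕ) * ((r:ℝ) / M)) ≤ η j / p ^ K then X j else 0) := by positivity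
          simp only [Y]; linarith
      have := hX J
      linarith
  have hj1 : ∀ j : ℕ, (1:ℝ) ≤ ((2:ℝ) ^ j) ^ K := fun j => one_le_pow₀ (one_le_pow₀ (by norm_num))
  have hpj1 : (1:ℝ) ≤ (p:ℝ) ^ K := one_le_pow₀ (by exact_mod_cast hp1)
  have hηM : ∀ j, 1 ≤ η j / p ^ K * M := by
    intro j
    simp only [η]
    rw [div_div, div_mul_eq_mul_div, le_div_iff₀ (by positivity), one_mul]
    have := hj1 j
    nlinarith
  have hηM2 : ∀ j, 1 ≤ η j * M := by
    intro j
    refine (hηM j).trans ?_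
    have : 0 ≤ η j := by positivity
    have : η j / p ^ K ≤ η j := div_le_self this hpj1
    gcongr
  have hcell : ∀ j ∈ Finset.range (J + 1), ∀ q ∈ Qj j,
      ∑ r ∈ Finset.range M, ((if dz (q * ((r:ℝ) / M)) ≤ η j / p ^ K then X j else 0) +
        (if dz ((q * p ^ K : ℕ) * ((r:ℝ) / M)) ≤ η j then Y j else 0)) ≤ 3 * (η j / p ^ K * M) * X j + 3 * (η j * M) * Y j := by
    intro j hj q hq
    rw [Finset.mem_range] at hj
    obtain ⟨hq1, hq2⟩ := Finset.mem_Icc.1 hq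
    have hqb : q ≤ ⌈C1 * T ^ K⌉₊ := by
      refine hq2.trans ((Nat.floor_le_ceil _).trans ?_)
      refine Nat.ceil_mono ?_
      have : (2:ℝ) ^ j ≤ T := by
        have : 2 ^ j ≤ T := (Nat.pow_le_pow_right (by norm_num) (by omega)).trans hJT
        exact_mod_cast this
      gcongr
    have hqp : q * p ^ K < M := lt_of_le_of_lt (Nat.mul_le_mul_right _ (by omega)) hM2
    have hqM : q < M := lt_of_le_of_lt (Nat.le_mul_of_pos_right q (pow_pos hp1 K)) hqp
    rw [Finset.sum_add_distrib, ← Finset.sum_filter, ← Finset.sum_filter, Finset.sum_const, Finset.sum_const, nsmul_eq_mul, nsmul_eq_mul]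
    have h1 := avg_dz M q hM (by omega) hqM _ (hηM j)
    have h2 := avg_dz M (q * p ^ K) hM (Nat.mul_pos (by omega) (pow_pos hp1 K)) hqp _ (hηM2 j)
    have := hX j
    have := hY j
    gcongr
  have hsum : (((Finset.Icc a b).filter fun y => f y = 0).card : ℝ) * M ≤ M * X J +
      ∑ j ∈ Finset.range (J + 1), (C1 * ((2:ℝ) ^ j) ^ K) * (3 * (η j / p ^ K * M) * X j + 3 * (η j * M) * Y j) := by
    refine hcount.trans ((Finset.sum_le_sum hpw).trans ?_)
    rw [Finset.sum_add_distrib, Finset.sum_const, Finset.card_range, nsmul_eq_mul]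
    gcongr
    rw [Finset.sum_comm]
    refine Finset.sum_le_sum fun j hj => ?_
    rw [Finset.sum_comm]
    refine (Finset.sum_le_sum (hcell j hj)).trans ?_
    rw [Finset.sum_const, nsmul_eq_mul]
    have h1 : ((Qj j).card : ℝ) ≤ C1 * ((2:ℝ) ^ j) ^ K := by
      simp only [Qj, Nat.card_Icc, Nat.add_sub_cancel]
      exact Nat.floor_le (by positivity)
    have := hX j
    have := hY j
    gcongr
  have hterm : ∀ j, (C1 * ((2:ℝ) ^ j) ^ K) * (3 * (η j / p ^ K * M) * X j + 3 * (η j * M) * Y j) =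
      (3 * C1 * C3 * (T ^ m / T ^ (K + 1)) * M) * (1 / p ^ K * ((2:ℝ) ^ j) ^ (-(σ - 2 * K)) + Θ * ((2:ℝ) ^ j) ^ (-(σ' - 2 * K))) := by
    intro j
    have hV : (0:ℝ) < 2 ^ j := by positivity
    have e1 : ((2:ℝ) ^ j) ^ (-(σ - 2 * K)) = ((2:ℝ) ^ j) ^ K * ((2:ℝ) ^ j) ^ K * ((2:ℝ) ^ j) ^ (-σ) := by
      rw [← Real.rpow_natCast _ K, ← Real.rpow_add hV, ← Real.rpow_add hV]; congr 1; ring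
    have e2 : ((2:ℝ) ^ j) ^ (-(σ' - 2 * K)) = ((2:ℝ) ^ j) ^ K * ((2:ℝ) ^ j) ^ K * ((2:ℝ) ^ j) ^ (-σ') := by
      rw [← Real.rpow_natCast _ K, ← Real.rpow_add hV, ← Real.rpow_add hV]; congr 1; ring
    rw [e1, e2]
    simp only [η, X, Y]
    field_simp
  simp only [hterm] at hsum
  rw [← Finset.mul_sum, Finset.sum_add_distrib, ← Finset.mul_sum, ← Finset.mul_sum] at hsum
  have hXJ : X J ≤ C3 * 2 ^ σ * (T ^ m / T ^ (K + 1) * (T:ℝ) ^ (K + 1 - σ)) := by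
    have h1 : ((2:ℝ) ^ J) ^ (-σ) ≤ 2 ^ σ * (T:ℝ) ^ (-σ) := by
      have h2 : (T:ℝ) / 2 ≤ 2 ^ J := by
        have : (T:ℝ) ≤ 2 ^ (J + 1) := by exact_mod_cast hTJ.le
        rw [pow_succ] at this; linarith
      calc ((2:ℝ) ^ J) ^ (-σ) ≤ ((T:ℝ) / 2) ^ (-σ) := Real.rpow_le_rpow_of_nonpos (by positivity) h2 (by linarith)
        _ = _ := by
          rw [Real.div_rpow (by positivity) (by norm_num), Real.rpow_neg (by norm_num : (0:ℝ) ≤ 2)]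
          field_simp
    have h3 : (T:ℝ) ^ (K + 1 - σ) = T ^ (K + 1) * (T:ℝ) ^ (-σ) := by
      rw [← Real.rpow_natCast _ (K + 1), ← Real.rpow_add hT0]; push_cast; congr 1
    rw [h3]
    calc X J ≤ C3 * T ^ m * (2 ^ σ * (T:ℝ) ^ (-σ)) := by simp only [X]; gcongr
      _ = _ := by field_simp
  have hg1 := geom2_le (σ - 2 * K) (by linarith) (J + 1)
  have hg2 := geom2_le (σ' - 2 * K) (by linarith) (J + 1)
  have hfin : (((Finset.Icc a b).filter fun y => f y = 0).card : ℝ) * M ≤ (C5 * (T ^ m / T ^ (K + 1)) *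
      ((T:ℝ) ^ (K + 1 - σ) + 1 / p ^ K + ((p:ℝ) ^ K / T) ^ θ)) * M := by
    calc _ ≤ M * (C3 * 2 ^ σ * (T ^ m / T ^ (K + 1) * (T:ℝ) ^ (K + 1 - σ))) +
          (3 * C1 * C3 * (T ^ m / T ^ (K + 1)) * M) * (1 / p ^ K * G1 + Θ * G2) := by
          refine hsum.trans ?_
          gcongr
      _ = C3 * ((2 ^ σ) * (T:ℝ) ^ (K + 1 - σ) + (3 * C1 * G1) * (1 / p ^ K) + (3 * C1 * G2) * Θ) * (T ^ m / T ^ (K + 1)) * M := by ring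
      _ ≤ C3 * ((2 ^ σ + 3 * C1 * G1 + 3 * C1 * G2) * (T:ℝ) ^ (K + 1 - σ) + (2 ^ σ + 3 * C1 * G1 + 3 * C1 * G2) * (1 / p ^ K) +
            (2 ^ σ + 3 * C1 * G1 + 3 * C1 * G2) * Θ) * (T ^ m / T ^ (K + 1)) * M := by
          have h1 : 0 ≤ 3 * C1 * G1 := by positivity
          have h2 : 0 ≤ 3 * C1 * G2 := by positivity
          have h3 : (0:ℝ) ≤ 2 ^ σ := by positivity
          gcongr <;> linarith
      _ = _ := by rw [hC5]; ring
  exact le_of_mul_le_mul_right hfin hM0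

lemma DK_comp {m : ℕ} (k : ℕ) (f : (Fin m → ℤ) → ℤ) (a : Fin m → ℤ) (p : ℤ) (h : Fin k → Fin m → ℤ) (x : Fin m → ℤ) :
    DK k (fun y => f (a + p • y)) h x = DK k f (fun j => p • h j) (a + p • x) := by
  induction k generalizing f with
  | zero => rfl
  | succ k ih =>
    simp only [DK]
    have : fwdDiff (h 0) (fun y => f (a + p • y)) = fun y => (fwdDiff (p • h 0) f) (a + p • y) := by
      funext y; simp only [fwdDiff]; rw [smul_add, add_assoc]
    rw [this, ih]
    rfl

lemma sum_psi {m k : ℕ} (c : (Fin (k + 1) → Fin m) → ℤ) (y : Fin m → ℤ) (h : Fin k → Fin m → ℤ) :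
    ∑ ι, c ι * (y (ι 0) * ∏ j : Fin k, h j (ι j.succ)) = ∑ i, y i * psi c h i := by
  rw [← (Fin.consEquiv (fun _ : Fin (k + 1) => Fin m)).sum_comp, Fintype.sum_prod_type]
  refine Finset.sum_congr rfl fun i _ => ?_
  rw [psi, Finset.mul_sum]
  refine Finset.sum_congr rfl fun κ _ => ?_
  simp [Fin.consEquiv]
  ring

lemma psi_smul {m k : ℕ} (c : (Fin (k + 1) → Fin m) → ℤ) (p : ℤ) (h : Fin k → Fin m → ℤ) (i : Fin m) :
    psi c (fun j => p • h j) i = p ^ k * psi c h i := by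
  rw [psi, psi, Finset.mul_sum]
  refine Finset.sum_congr rfl fun κ _ => ?_
  simp only [Pi.smul_apply, smul_eq_mul, Finset.prod_mul_distrib, Finset.prod_const, Finset.card_univ, Fintype.card_fin]
  ring

lemma DK_local {m k : ℕ} (F : MvPolynomial (Fin m) ℤ) (c : (Fin (k + 1) → Fin m) → ℤ)
    (hc : ∀ (h : Fin k → Fin m → ℤ) y, DK k (fun x => eval x F) h y = DK k (fun x => eval x F) h 0 + ∑ ι, c ι * (y (ι 0) * ∏ j : Fin k, h j (ι j.succ)))
    (a : Fin m → ℤ) (p : ℤ) (hp : p ≠ 0) (f : (Fin m → ℤ) → ℤ) (hf : ∀ y, p * f y = eval (a + p • y) F) (h : Fin k → Fin m → ℤ)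
    (y : Fin m → ℤ) : DK k f h y = DK k f h 0 + p ^ k * ∑ i, y i * psi c h i := by
  have h1 : ∀ y, p * DK k f h y = DK k (fun x => eval x F) (fun j => p • h j) 0 + ∑ i, (a i + p * y i) * (p ^ k * psi c h i) := by
    intro y
    rw [← DK_smul]
    simp only [hf]
    rw [DK_comp k (fun x => eval x F), hc, sum_psi]
    simp only [psi_smul, Pi.add_apply, Pi.smul_apply, smul_eq_mul]
  apply mul_left_cancel₀ hp
  rw [mul_add, h1, h1]
  simp only [Pi.zero_apply, mul_zero, add_zero, add_assoc]
  congr 1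
  rw [Finset.mul_sum, Finset.mul_sum, ← Finset.sum_add_distrib]
  refine Finset.sum_congr rfl fun i _ => ?_
  ring

lemma eval_congr_dvd {m : ℕ} (F : MvPolynomial (Fin m) ℤ) (p : ℤ) (x y : Fin m → ℤ) (h : ∀ i, p ∣ x i - y i) :
    p ∣ eval x F - eval y F := by
  induction F using MvPolynomial.induction_on with
  | C a => simp
  | add F G hF hG => simp only [map_add]; obtain ⟨u, hu⟩ := hF; obtain ⟨v, hv⟩ := hG; exact ⟨u + v, by linear_combination hu + hv⟩
  | mul_X F i hF =>
    simp only [map_mul, eval_X]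
    obtain ⟨u, hu⟩ := hF; obtain ⟨v, hv⟩ := h i
    exact ⟨u * x i + v * eval y F, by linear_combination (x i) * hu + (eval y F) * hv⟩

lemma taylor2 {m : ℕ} (F : MvPolynomial (Fin m) ℤ) (i : Fin m) (x : Fin m → ℤ) (t : ℤ) :
    t ^ 2 ∣ eval (x + Pi.single i t) F - eval x F - t * eval x (pderiv i F) := by
  classical
  induction F using MvPolynomial.induction_on with
  | C a => simp
  | add F G hF hG => simp only [map_add]; obtain ⟨u, hu⟩ := hF; obtain ⟨v, hv⟩ := hG; exact ⟨u + v, by linear_combination hu + hv⟩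
  | mul_X F j hF =>
    simp only [map_mul, eval_X, Derivation.leibniz, smul_eq_mul, map_add, pderiv_X]
    by_cases hj : i = j
    · subst hj
      simp only [Pi.add_apply, Pi.single_eq_same, map_one, mul_one]
      obtain ⟨z, hz⟩ := hF
      refine ⟨z * (x i + t) + eval x (pderiv i F), ?_⟩
      linear_combination (x i + t) * hz
    · have hj' : j ≠ i := fun h => hj h.symm
      simp only [Pi.add_apply, Pi.single_eq_of_ne hj', Pi.single_eq_of_ne hj, map_zero, mul_zero, zero_add, add_zero]
      obtain ⟨z, hz⟩ := hF
      refine ⟨z * x j, ?_⟩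
      linear_combination (x j) * hz

lemma prod_diff (n : ℕ) (u v : Fin n → ℝ) (X t : ℝ) (hX : 0 ≤ X) (hu : ∀ j, |u j| ≤ X) (hv : ∀ j, |v j| ≤ X)
    (huv : ∀ j, |u j - v j| ≤ t) : |∏ j, u j - ∏ j, v j| * X ≤ n * t * X ^ n := by
  induction n with
  | zero => simp
  | succ n ih =>
    have ht : 0 ≤ t := (abs_nonneg _).trans (huv 0)
    rw [Fin.prod_univ_succ, Fin.prod_univ_succ]
    have h1 := ih (fun j => u j.succ) (fun j => v j.succ) (fun j => hu _) (fun j => hv _) (fun j => huv _)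
    set P := ∏ j : Fin n, u j.succ
    set Q := ∏ j : Fin n, v j.succ
    have h2 : |Q| ≤ X ^ n := by
      rw [Finset.abs_prod]
      refine (Finset.prod_le_prod (fun _ _ => abs_nonneg _) (fun j _ => hv j.succ)).trans (by simp)
    have e : u 0 * P - v 0 * Q = u 0 * (P - Q) + (u 0 - v 0) * Q := by ring
    rw [e]
    calc |u 0 * (P - Q) + (u 0 - v 0) * Q| * X ≤ (|u 0| * |P - Q| + |u 0 - v 0| * |Q|) * X := by
          gcongr
          refine (abs_add_le _ _).trans ?_
          rw [abs_mul, abs_mul]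
      _ ≤ (X * |P - Q| + t * X ^ n) * X := by
          have := hu 0
          have := huv 0
          gcongr
      _ = X * (|P - Q| * X) + t * X ^ (n + 1) := by ring
      _ ≤ X * (n * t * X ^ n) + t * X ^ (n + 1) := by gcongr
      _ = _ := by push_cast; ring

lemma F_diff {m k : ℕ} (F : MvPolynomial (Fin m) ℤ) (c : (Fin (k + 1) → Fin m) → ℤ)
    (hpoly : C ((k + 1).factorial : ℤ) * F = ∑ ι, C (c ι) * ∏ j, X (ι j)) :
    ∃ Cd : ℝ, 0 < Cd ∧ ∀ (x y : Fin m → ℤ) (Z t : ℝ), 0 < Z → 0 ≤ t → (∀ j, |(x j : ℝ)| ≤ Z) → (∀ j, |(y j : ℝ)| ≤ Z) →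
      (∀ j, |(x j : ℝ) - y j| ≤ t) → |((eval x F - eval y F : ℤ) : ℝ)| ≤ Cd * (t * Z ^ k) := by
  refine ⟨∑ ι, |(c ι : ℝ)| * ((k + 1 : ℕ) : ℝ) + 1, by positivity, ?_⟩
  intro x y Z t hZ ht hx hy hxy
  have e : ∀ x : Fin m → ℤ, ((k + 1).factorial : ℝ) * ((eval x F : ℤ) : ℝ) = ∑ ι, (c ι : ℝ) * ∏ j, (x (ι j) : ℝ) := by
    intro x
    have := congrArg (eval x) hpoly
    simp only [map_mul, eval_C, map_sum, map_prod, eval_X] at this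
    exact_mod_cast this
  have h1 : (((k + 1).factorial : ℕ) : ℝ) * ((eval x F - eval y F : ℤ) : ℝ) =
      ∑ ι, (c ι : ℝ) * (∏ j, (x (ι j) : ℝ) - ∏ j, (y (ι j) : ℝ)) := by
    push_cast
    rw [mul_sub, e, e, ← Finset.sum_sub_distrib]
    simp only [mul_sub]
  have h2 : (1:ℝ) ≤ ((k + 1).factorial : ℕ) := by exact_mod_cast Nat.succ_le_of_lt (Nat.factorial_pos _)
  have h3 : ∀ ι : Fin (k + 1) → Fin m, |∏ j, (x (ι j) : ℝ) - ∏ j, (y (ι j) : ℝ)| ≤ ((k + 1 : ℕ) : ℝ) * (t * Z ^ k) := by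
    intro ι
    have := prod_diff (k + 1) (fun j => (x (ι j) : ℝ)) (fun j => (y (ι j) : ℝ)) Z t hZ.le (fun j => hx _) (fun j => hy _) (fun j => hxy _)
    refine le_of_mul_le_mul_right (this.trans_eq ?_) hZ
    ring
  calc |((eval x F - eval y F : ℤ) : ℝ)| ≤ (((k + 1).factorial : ℕ) : ℝ) * |((eval x F - eval y F : ℤ) : ℝ)| :=
        le_mul_of_one_le_left (abs_nonneg _) h2
    _ = |∑ ι, (c ι : ℝ) * (∏ j, (x (ι j) : ℝ) - ∏ j, (y (ι j) : ℝ))| := by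
        rw [← h1, abs_mul, abs_of_nonneg (by positivity : (0:ℝ) ≤ (((k + 1).factorial : ℕ) : ℝ))]
    _ ≤ ∑ ι, |(c ι : ℝ)| * (((k + 1 : ℕ) : ℝ) * (t * Z ^ k)) := by
        refine (Finset.abs_sum_le_sum_abs _ _).trans (Finset.sum_le_sum fun ι _ => ?_)
        rw [abs_mul]
        have := h3 ι
        gcongr
    _ = (∑ ι, |(c ι : ℝ)| * ((k + 1 : ℕ) : ℝ)) * (t * Z ^ k) := by rw [Finset.sum_mul]; simp only [mul_assoc]
    _ ≤ _ := by gcongr; linarith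

lemma rpow_small (p K : ℕ) (hp : 1 ≤ p) (W δ : ℝ) (A : ℕ) (hA : K ≤ A * δ) (hW : (p:ℝ) ^ A ≤ W) (hδ : 0 < δ) :
    W ^ (-δ) ≤ 1 / (p:ℝ) ^ K := by
  have hp1 : (1:ℝ) ≤ p := by exact_mod_cast hp
  have hp0 : (0:ℝ) < p := by linarith
  calc W ^ (-δ) ≤ ((p:ℝ) ^ A) ^ (-δ) := Real.rpow_le_rpow_of_nonpos (by positivity) hW (by linarith)
    _ = (p:ℝ) ^ (-(A * δ)) := by rw [← Real.rpow_natCast, ← Real.rpow_mul hp0.le]; congr 1; ring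
    _ ≤ (p:ℝ) ^ (-(K:ℝ)) := Real.rpow_le_rpow_of_exponent_le hp1 (by linarith)
    _ = _ := by rw [Real.rpow_neg hp0.le, Real.rpow_natCast, one_div]

lemma cc_good {m : ℕ} (F : MvPolynomial (Fin m) ℤ) (K : ℕ) (Cd : ℝ)
    (hdiff : ∀ (x y : Fin m → ℤ) (Z t : ℝ), 0 < Z → 0 ≤ t → (∀ j, |(x j : ℝ)| ≤ Z) → (∀ j, |(y j : ℝ)| ≤ Z) →
      (∀ j, |(x j : ℝ) - y j| ≤ t) → |((eval x F - eval y F : ℤ) : ℝ)| ≤ Cd * (t * Z ^ K))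
    (p : ℕ) (hp1 : 1 ≤ p) (a' : Fin m → ℤ) (ha0 : ∀ i, 0 ≤ a' i ∧ a' i < p) (f : (Fin m → ℤ) → ℤ)
    (hf : ∀ y, eval (a' + (p:ℤ) • y) F = p * f y) (R W : ℕ) (hR1 : 1 ≤ R) (hW : W = 2 * R) (i : Fin m)
    (hi' : ¬ (p:ℤ) ∣ eval a' (pderiv i F)) :
    good f (fun _ => -(R:ℤ)) (fun _ => (R:ℤ)) p K W (Cd * 4 ^ K) := by
  have hpR1 : (1:ℝ) ≤ p := by exact_mod_cast hp1
  have hpR : (0:ℝ) < p := by linarith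
  have hpZ : (0:ℤ) < p := by exact_mod_cast hp1
  have hRW : (W:ℝ) = 2 * R := by rw [hW]; push_cast; ring
  have hRR : (1:ℝ) ≤ R := by exact_mod_cast hR1
  have hWR : (0:ℝ) < W := by linarith
  have hpW : (0:ℝ) < p * W := by positivity
  refine ⟨i, eval a' (pderiv i F), hi', ?_, ?_⟩
  · intro y _ u
    have e : a' + (p:ℤ) • (y + Pi.single i (u:ℤ)) = (a' + (p:ℤ) • y) + Pi.single i ((p:ℤ) * u) := by
      rw [smul_add, add_assoc, ← Pi.single_smul]; simp
    obtain ⟨z, hz⟩ := taylor2 F i (a' + (p:ℤ) • y) ((p:ℤ) * u)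
    obtain ⟨w, hw⟩ := eval_congr_dvd (pderiv i F) p (a' + (p:ℤ) • y) a' (fun i => by simp)
    rw [← e, hf, hf] at hz
    refine ⟨u * z + w, ?_⟩
    apply mul_left_cancel₀ hpZ.ne'
    linear_combination hz + (p:ℤ) * u * hw
  · intro y hy u hu
    have e : a' + (p:ℤ) • (y + Pi.single i (u:ℤ)) = (a' + (p:ℤ) • y) + Pi.single i ((p:ℤ) * u) := by
      rw [smul_add, add_assoc, ← Pi.single_smul]; simp
    rw [Finset.mem_Icc] at hy
    have huR : (u:ℝ) ≤ W := by exact_mod_cast hu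
    have hyR : ∀ j, |(y j : ℝ)| ≤ R := by
      intro j
      have h1 := hy.1 j
      have h2 := hy.2 j
      simp only at h1 h2
      rw [abs_le]
      exact ⟨by exact_mod_cast h1, by exact_mod_cast h2⟩
    have haR : ∀ j, |(a' j : ℝ)| ≤ p := by
      intro j
      rw [abs_of_nonneg (by exact_mod_cast (ha0 j).1)]
      exact_mod_cast (ha0 j).2.le
    have hb1 : ∀ j, |(((a' + (p:ℤ) • y) j : ℤ) : ℝ)| ≤ 2 * (p * W) := by
      intro j
      simp only [Pi.add_apply, Pi.smul_apply, smul_eq_mul, Int.cast_add, Int.cast_mul, Int.cast_natCast]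
      refine (abs_add_le _ _).trans ?_
      rw [abs_mul, abs_of_pos hpR]
      have h3 := haR j
      have h4 := mul_le_mul_of_nonneg_left (hyR j) hpR.le
      have h5 : (p:ℝ) * 1 ≤ p * R := mul_le_mul_of_nonneg_left hRR hpR.le
      rw [hRW]; linarith
    have hsing : ∀ j, |(((Pi.single i ((p:ℤ) * u) : Fin m → ℤ) j : ℤ) : ℝ)| ≤ p * u := by
      intro j
      by_cases hj : j = i
      · subst hj; simp only [Pi.single_eq_same]; push_cast; rw [abs_of_nonneg (by positivity)]
      · rw [Pi.single_eq_of_ne hj]; simp; positivity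
    have hpu : (p:ℝ) * u ≤ p * W := by gcongr
    have h1 := hdiff (a' + (p:ℤ) • (y + Pi.single i (u:ℤ))) (a' + (p:ℤ) • y) (4 * (p * W)) (p * u) (by linarith) (by positivity)
      (by intro j
          rw [e, Pi.add_apply, Int.cast_add]
          refine (abs_add_le _ _).trans ?_
          have := hb1 j
          have := hsing j
          linarith)
      (by intro j
          have := hb1 j
          linarith)
      (by intro j
          rw [e, Pi.add_apply (a' + (p:ℤ) • y), Int.cast_add, add_sub_cancel_left]
          exact hsing j)
    rw [hf, hf, ← mul_sub, Int.cast_mul, abs_mul, Int.cast_natCast, abs_of_pos hpR] at h1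
    refine le_of_mul_le_mul_left (h1.trans_eq ?_) hpR
    rw [mul_pow, mul_pow]; ring

lemma cc_card {m : ℕ} (F : MvPolynomial (Fin m) ℤ) (p : ℕ) (hp1 : 1 ≤ p) (a : Fin m → ℤ) (f : (Fin m → ℤ) → ℤ)
    (hf : ∀ y, eval ((fun i => a i % p) + (p:ℤ) • y) F = p * f y) (R T : ℕ) (hRT : T < p * R) :
    ((bx m T).filter fun x => eval x F = 0 ∧ ∀ i, (p:ℤ) ∣ x i - a i).card ≤
      ((Finset.Icc (fun _ => -(R:ℤ)) (fun _ => (R:ℤ))).filter fun y => f y = 0).card := by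
  have hpZ : (0:ℤ) < p := by exact_mod_cast hp1
  refine Finset.card_le_card_of_injOn (fun x i => x i / p) ?_ ?_
  · intro x hx
    rw [Finset.coe_filter] at hx
    obtain ⟨hxb, hxF, hxa⟩ := hx
    rw [mem_bx] at hxb
    have hxe : x = (fun i => a i % p) + (p:ℤ) • (fun i => x i / p) := by
      funext i
      simp only [Pi.add_apply, Pi.smul_apply, smul_eq_mul]
      have : x i % p = a i % p := Int.ModEq.symm (Int.modEq_iff_dvd.2 (hxa i))
      rw [← this]; exact (Int.emod_add_mul_ediv _ _).symm
    have hxi : ∀ i, -(R:ℤ) ≤ x i / p ∧ x i / p ≤ R := by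
      intro i
      have h1 : |x i| ≤ (T:ℤ) := by have := hxb i; exact_mod_cast this
      rw [abs_le] at h1
      have h2 : (T:ℤ) < R * p := by rw [mul_comm]; exact_mod_cast hRT
      constructor
      · rw [Int.le_ediv_iff_mul_le hpZ, neg_mul]; linarith [h1.1]
      · exact (Int.ediv_lt_of_lt_mul hpZ (by linarith [h1.2])).le
    rw [Finset.coe_filter]
    refine ⟨Finset.mem_Icc.2 ⟨fun i => (hxi i).1, fun i => (hxi i).2⟩, ?_⟩
    have h1 := hf (fun i => x i / p)
    rw [← hxe, hxF] at h1
    rcases mul_eq_zero.1 h1.symm with h | h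
    · exact absurd h hpZ.ne'
    · exact h
  · intro x hx x' hx' h
    rw [Finset.coe_filter] at hx hx'
    funext i
    have h1 : x i % p = x' i % p := by
      have e1 : x i % p = a i % p := Int.ModEq.symm (Int.modEq_iff_dvd.2 (hx.2.2 i))
      have e2 : x' i % p = a i % p := Int.ModEq.symm (Int.modEq_iff_dvd.2 (hx'.2.2 i))
      rw [e1, e2]
    have h2 : x i / p = x' i / p := congrFun h i
    rw [← Int.emod_add_mul_ediv (x i) p, ← Int.emod_add_mul_ediv (x' i) p, h1, h2]

lemma cc_num (m K p T R W A1 A2 : ℕ) (σ θ C5 : ℝ) (hp1 : 1 ≤ p) (hT : 1 ≤ T) (hKm : K + 1 ≤ m) (hpT : p ^ (A1 + A2 + K + 1) ≤ T)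
    (hR : R = T / p + 1) (hW : W = 2 * R) (hδ0 : 0 < σ - (K + 1)) (hθ0 : 0 < θ) (hA1 : K ≤ A1 * (σ - (K + 1)))
    (hA2 : K ≤ A2 * θ) (hC5 : 0 ≤ C5) :
    C5 * ((W:ℝ) ^ m / W ^ (K + 1)) * ((W:ℝ) ^ (K + 1 - σ) + 1 / p ^ K + ((p:ℝ) ^ K / W) ^ θ) ≤
      C5 * 4 ^ (m - (K + 1)) * 3 * ((T:ℝ) ^ m / T ^ (K + 1)) / p ^ (m - 1) := by
  have hpR1 : (1:ℝ) ≤ p := by exact_mod_cast hp1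
  have hpR : (0:ℝ) < p := by linarith
  have hT0 : (0:ℝ) < T := by exact_mod_cast hT
  have hpTp : p ≤ T := le_trans (Nat.le_self_pow (by omega) p) hpT
  have hR1 : (T:ℝ) / p ≤ R := by
    rw [div_le_iff₀ hpR]
    have : T < p * (T / p + 1) := Nat.lt_mul_div_succ T hp1
    rw [← hR] at this
    have h2 : (T:ℝ) ≤ p * R := by exact_mod_cast this.le
    linarith
  have hR2 : (R:ℝ) ≤ 2 * (T / p) := by
    have h1 : ((T / p : ℕ) : ℝ) ≤ T / p := Nat.cast_div_le
    have h2 : (1:ℝ) ≤ T / p := by rw [le_div_iff₀ hpR, one_mul]; exact_mod_cast hpTp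
    rw [hR]; push_cast; linarith
  have hW1 : 1 ≤ W := by rw [hW, hR]; exact Nat.mul_pos two_pos (Nat.succ_pos _)
  have hWR : (0:ℝ) < W := by exact_mod_cast hW1
  have hWlo : (T:ℝ) / p ≤ W := by
    have h0 : (0:ℝ) ≤ T / p := by positivity
    rw [hW]; push_cast; linarith
  have hWhi : (W:ℝ) ≤ 4 * (T / p) := by rw [hW]; push_cast; linarith
  have hWA : (p:ℝ) ^ (A1 + A2 + K) ≤ W := by
    refine le_trans ?_ hWlo
    rw [le_div_iff₀ hpR, ← pow_succ]
    exact_mod_cast hpT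
  have b1 : (W:ℝ) ^ ((K:ℝ) + 1 - σ) ≤ 1 / (p:ℝ) ^ K := by
    have e : (K:ℝ) + 1 - σ = -(σ - (K + 1)) := by ring
    rw [e]
    refine rpow_small p K hp1 W (σ - (K + 1)) A1 hA1 (le_trans ?_ hWA) hδ0
    exact pow_le_pow_right₀ hpR1 (by omega)
  have b2 : ((p:ℝ) ^ K / W) ^ θ ≤ 1 / (p:ℝ) ^ K := by
    have e : ((p:ℝ) ^ K / W) ^ θ = ((W:ℝ) / p ^ K) ^ (-θ) := by
      rw [Real.rpow_neg (by positivity), ← Real.inv_rpow (by positivity), inv_div]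
    rw [e]
    refine rpow_small p K hp1 _ θ A2 hA2 ?_ hθ0
    rw [le_div_iff₀ (by positivity), ← pow_add]
    refine le_trans ?_ hWA
    exact pow_le_pow_right₀ hpR1 (by omega)
  have hpow : ∀ Z : ℝ, 0 < Z → Z ^ m / Z ^ (K + 1) = Z ^ (m - (K + 1)) := by
    intro Z hZ
    rw [div_eq_iff (by positivity), ← pow_add]; congr 1; omega
  rw [hpow _ hWR, hpow _ hT0]
  have hpm : (p:ℝ) ^ (m - 1) = p ^ (m - (K + 1)) * p ^ K := by rw [← pow_add]; congr 1; omega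
  calc C5 * (W:ℝ) ^ (m - (K + 1)) * ((W:ℝ) ^ ((K:ℝ) + 1 - σ) + 1 / p ^ K + ((p:ℝ) ^ K / W) ^ θ)
      ≤ C5 * (4 * ((T:ℝ) / p)) ^ (m - (K + 1)) * (1 / (p:ℝ) ^ K + 1 / p ^ K + 1 / (p:ℝ) ^ K) := by gcongr
    _ = _ := by
      rw [hpm, mul_pow, div_pow]; field_simp; ring

lemma cc_param (m K : ℕ) (hK : 1 ≤ K) (hmR : (2:ℝ) ^ (K + 1) * (K : ℝ) < m) : ∃ s σ θ : ℝ, 1 < s ∧ σ = (m:ℝ) / (2 ^ K * s) ∧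
    2 * (K:ℝ) < σ ∧ 0 < θ ∧ θ < 1 ∧ 2 * (K:ℝ) < σ * (1 - θ) - K * θ := by
  have hK1 : (1:ℝ) ≤ (K:ℝ) := by exact_mod_cast hK
  have hD0 : (0:ℝ) < 2 ^ (K + 1) * K := by positivity
  have hq1 : 1 < m / ((2:ℝ) ^ (K + 1) * K) := by rw [lt_div_iff₀ hD0, one_mul]; exact hmR
  obtain ⟨s, hs1, hs2⟩ := exists_between hq1
  obtain ⟨σ, hσ⟩ : ∃ σ, σ = (m:ℝ) / (2 ^ K * s) := ⟨_, rfl⟩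
  have hσ2 : 2 * (K:ℝ) < σ := by
    rw [lt_div_iff₀ hD0] at hs2
    rw [hσ, lt_div_iff₀ (by positivity)]
    calc 2 * (K:ℝ) * (2 ^ K * s) = s * (2 ^ (K + 1) * K) := by rw [pow_succ]; ring
      _ < m := hs2
  have hσK : 0 < 2 * (σ + K) := by linarith
  refine ⟨s, σ, (σ - 2 * K) / (2 * (σ + K)), hs1, hσ, hσ2, div_pos (by linarith) hσK, by rw [div_lt_one hσK]; linarith, ?_⟩
  have : (σ - 2 * K) / (2 * (σ + K)) * (2 * (σ + K)) = σ - 2 * K := div_mul_cancel₀ _ hσK.ne'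
  linarith

set_option maxHeartbeats 800000 in
theorem count_cong {m k : ℕ} (F : MvPolynomial (Fin m) ℤ) (hF : F.IsHomogeneous (k + 1 + 1))
    (hsmooth : ∀ z : Fin m → ℂ, z ≠ 0 → eval z (map (Int.castRingHom ℂ) F) = 0 →
      ∃ i, eval z (pderiv i (map (Int.castRingHom ℂ) F)) ≠ 0)
    (hmk : 2 ^ (k + 1 + 1) * (k + 1) < m) :
    ∃ C6 : ℝ, 0 < C6 ∧ ∃ A : ℕ, ∀ (p : ℕ) (a : Fin m → ℤ),
      (p = 1 ∨ p.Prime ∧ ∃ i, ¬ (p:ℤ) ∣ eval a (pderiv i F)) → ∀ T : ℕ, 1 ≤ T → p ^ A ≤ T →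
      (((bx m T).filter fun x => eval x F = 0 ∧ ∀ i, (p:ℤ) ∣ x i - a i).card : ℝ) ≤
        C6 * (T ^ m / T ^ (k + 1 + 1)) / p ^ (m - 1) := by
  classical
  obtain ⟨c, hsym, hpoly, hDK⟩ := polar F hF
  obtain ⟨Cd, hCd, hdiff⟩ := F_diff F c hpoly
  have hm : 1 ≤ m := by omega
  have hmR : (2:ℝ) ^ (k + 1 + 1) * ((k + 1 : ℕ) : ℝ) < m := by exact_mod_cast hmk
  obtain ⟨s, σ, θ, hs1, hσ, hσ2, hθ0, hθ1, hθ2⟩ := cc_param m (k + 1) (by omega) hmR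
  obtain ⟨C1, hC1, Cw, hCw, hweyl⟩ := weyl F hF hsmooth c hsym hpoly hm s hs1
  rw [← hσ] at hweyl
  obtain ⟨C5, hC5, hcount⟩ := count_main hm C1 (Cd * 4 ^ (k + 1)) Cw hC1 (by positivity) hCw (k + 1) σ θ hσ2 hθ0 hθ1 hθ2
  have hδ0 : 0 < σ - ((k + 1 : ℕ) + 1) := by
    have : (1:ℝ) ≤ (k + 1 : ℕ) := by exact_mod_cast (by omega : 1 ≤ k + 1)
    linarith
  obtain ⟨A1, hA1⟩ := exists_nat_ge (((k + 1 : ℕ):ℝ) / (σ - ((k + 1 : ℕ) + 1)))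
  obtain ⟨A2, hA2⟩ := exists_nat_ge (((k + 1 : ℕ):ℝ) / θ)
  rw [div_le_iff₀ hδ0] at hA1
  rw [div_le_iff₀ hθ0] at hA2
  have hKm : k + 1 + 1 ≤ m := by
    have h1 : k + 1 + 1 < 2 ^ (k + 1 + 1) := Nat.lt_two_pow_self
    have h2 : 2 ^ (k + 1 + 1) * 1 ≤ 2 ^ (k + 1 + 1) * (k + 1) := Nat.mul_le_mul_left _ (by omega)
    omega
  refine ⟨C5 * 4 ^ (m - (k + 1 + 1)) * 3, by positivity, A1 + A2 + (k + 1) + 1, ?_⟩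
  intro p a hp T hT hpT
  have hp1 : 1 ≤ p := by rcases hp with h | h; exact h.ge; exact h.1.one_le
  have hpZ : (0:ℤ) < p := by exact_mod_cast hp1
  have hpR : (0:ℝ) < p := by exact_mod_cast hp1
  rcases ((bx m T).filter fun x => eval x F = 0 ∧ ∀ i, (p:ℤ) ∣ x i - a i).eq_empty_or_nonempty with hemp | ⟨x0, hx0⟩
  · rw [hemp]; simp only [Finset.card_empty, Nat.cast_zero]; positivity
  have haa : ∀ i, (p:ℤ) ∣ a i - a i % p := fun i => Int.dvd_self_sub_emod
  have ha0 : ∀ i, 0 ≤ a i % p ∧ a i % p < p := fun i => ⟨Int.emod_nonneg _ hpZ.ne', Int.emod_lt_of_pos _ hpZ⟩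
  have hx0' : (p:ℤ) ∣ eval (fun i => a i % p) F := by
    rw [Finset.mem_filter] at hx0
    have := eval_congr_dvd F p x0 (fun i => a i % p) (fun i => by have := dvd_add (hx0.2.2 i) (haa i); simpa using this)
    rw [hx0.2.1, zero_sub] at this
    exact (dvd_neg).1 this
  have hdv : ∀ y : Fin m → ℤ, (p:ℤ) ∣ eval ((fun i => a i % p) + (p:ℤ) • y) F := by
    intro y
    have := eval_congr_dvd F p ((fun i => a i % p) + (p:ℤ) • y) (fun i => a i % p) (fun i => by simp)
    have := dvd_add this hx0'
    simpa using this
  choose f hf using hdv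
  obtain ⟨R, hRdef⟩ : ∃ R, R = T / p + 1 := ⟨_, rfl⟩
  obtain ⟨W, hW⟩ : ∃ W, W = 2 * R := ⟨_, rfl⟩
  have hRT : T < p * R := by rw [hRdef]; exact Nat.lt_mul_div_succ T hp1
  have hR1 : 1 ≤ R := by rw [hRdef]; exact Nat.succ_pos _
  have hab : ∀ i : Fin m, (fun _ => (R:ℤ)) i - (fun _ => -(R:ℤ)) i ≤ (W:ℤ) := by intro i; simp only [hW]; push_cast; omega
  have hgood : p = 1 ∨ p.Prime ∧ good f (fun _ => -(R:ℤ)) (fun _ => (R:ℤ)) p (k + 1) W (Cd * 4 ^ (k + 1)) := by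
    refine hp.imp id ?_
    rintro ⟨hpp, i, hi'⟩
    refine ⟨hpp, cc_good F (k + 1) Cd hdiff p hp1 _ ha0 f hf R W hR1 hW i ?_⟩
    intro h
    have h2 := eval_congr_dvd (pderiv i F) p a _ haa
    exact hi' (by have := dvd_add h2 h; simpa using this)
  have hmain := hcount f _ _ p W (by omega) hab hgood (by
    intro α U hU1 hU2 hno
    have hDKf := DK_local F c hDK _ (p:ℤ) hpZ.ne' f (fun y => (hf y).symm)
    exact hweyl f ((p:ℤ) ^ (k + 1)) hDKf α W U hU1 hU2 hno _ _ hab)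
  have hcardR := (Nat.cast_le (α := ℝ)).2 (cc_card F p hp1 a f hf R T hRT)
  refine hcardR.trans (hmain.trans ?_)
  exact cc_num m (k + 1) p T R W A1 A2 σ θ C5 hp1 hT hKm hpT hRdef hW hδ0 hθ0 hA1 hA2 hC5.le

lemma height_vars {K : Type*} [Field K] {m : ℕ} (hm : 3 ≤ m) (Q : Ideal (MvPolynomial (Fin m) K)) [Q.IsPrime]
    (hX : ∀ i, X i ∈ Q) : 3 ≤ Q.height := by
  let φ : ℕ → MvPolynomial (Fin m) K →ₐ[K] MvPolynomial (Fin m) K := fun k => aeval fun i => if i.val < k then 0 else X i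
  let P : ℕ → Ideal (MvPolynomial (Fin m) K) := fun k => RingHom.ker (φ k)
  have hP : ∀ k, (P k).IsPrime := fun k => RingHom.ker_isPrime _
  have hle : ∀ k (I : Ideal (MvPolynomial (Fin m) K)), (∀ i : Fin m, i.val < k → X i ∈ I) → P k ≤ I := by
    intro k I hI f hf
    have h1 : (Ideal.Quotient.mkₐ K I).comp (φ k) = Ideal.Quotient.mkₐ K I := by
      refine MvPolynomial.algHom_ext fun i => ?_
      simp only [AlgHom.comp_apply, φ, aeval_X]
      split_ifs with h
      · rw [map_zero]; exact (Ideal.Quotient.eq_zero_iff_mem.2 (hI i h)).symm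
      · rfl
    have h2 := DFunLike.congr_fun h1 f
    rw [AlgHom.comp_apply, RingHom.mem_ker.1 hf, map_zero] at h2
    exact Ideal.Quotient.eq_zero_iff_mem.1 h2.symm
  have hlt : ∀ k, k < m → P k < P (k + 1) := by
    intro k hk
    refine lt_of_le_of_ne (hle k _ fun i hi => ?_) fun h => ?_
    · simp [P, RingHom.mem_ker, φ]; omega
    · have h1 : (X ⟨k, hk⟩ : MvPolynomial (Fin m) K) ∈ P (k + 1) := by simp [P, RingHom.mem_ker, φ]
      rw [← h] at h1
      simp [P, RingHom.mem_ker, φ] at h1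
  have h0 := Ideal.height_add_one_le_of_lt_of_isPrime (hlt 0 (by omega))
  have h1 := Ideal.height_add_one_le_of_lt_of_isPrime (hlt 1 (by omega))
  have h2 := Ideal.height_add_one_le_of_lt_of_isPrime (hlt 2 (by omega))
  have h3 : (P 3).height ≤ Q.height := Ideal.height_mono (hle 3 Q fun i _ => hX i)
  calc (3:ℕ∞) = 0 + 1 + 1 + 1 := by norm_num
    _ ≤ (P 0).height + 1 + 1 + 1 := by gcongr; exact zero_le
    _ ≤ (P 1).height + 1 + 1 := by gcongr
    _ ≤ (P 2).height + 1 := by gcongr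
    _ ≤ (P 3).height := h2
    _ ≤ _ := h3

lemma factor_zero {K : Type*} [Field K] {m d : ℕ} (F G H : MvPolynomial (Fin m) K) (hF : F.IsHomogeneous d) (hF0 : F ≠ 0)
    (h : F = G * H) (hH : ¬ IsUnit H) : constantCoeff H = 0 := by
  by_contra hc
  let ψ : MvPolynomial (Fin m) K →ₐ[K] Polynomial (MvPolynomial (Fin m) K) := aeval fun i => Polynomial.X * Polynomial.C (X i)
  have hψF : ψ F = Polynomial.X ^ d * Polynomial.C F := by
    have h1 : ∀ f : MvPolynomial (Fin m) K, aeval (fun i => Polynomial.C (X i)) f = Polynomial.C f := by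
      intro f
      induction f using MvPolynomial.induction_on with
      | C a => simp [Polynomial.algebraMap_apply]
      | add p q hp hq => simp [hp, hq]
      | mul_X p i hp => simp [hp]
    rw [← h1 F]
    simp only [ψ, aeval_def, eval₂_eq, Finset.mul_sum]
    refine Finset.sum_congr rfl fun ν hν => ?_
    have hd := hF (mem_support_iff.1 hν)
    rw [← hd]
    simp only [mul_pow, Finset.prod_mul_distrib, Finset.prod_pow_eq_pow_sum, Finsupp.weight_apply, Finsupp.sum, smul_eq_mul, Pi.one_apply, mul_one]
    ring
  have e1 : ∀ f, Polynomial.eval 1 (ψ f) = f := by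
    intro f
    induction f using MvPolynomial.induction_on with
    | C a => simp [ψ, Polynomial.algebraMap_apply]
    | add p q hp hq => simp [hp, hq]
    | mul_X p i hp => simp [hp]; simp [ψ]
  have e0 : ∀ f, Polynomial.eval 0 (ψ f) = C (constantCoeff f) := by
    intro f
    induction f using MvPolynomial.induction_on with
    | C a => simp [ψ, Polynomial.algebraMap_apply]
    | add p q hp hq => simp [hp, hq]
    | mul_X p i hp => simp; simp [ψ]
  have hGH : G ≠ 0 ∧ H ≠ 0 := by constructor <;> (rintro rfl; simp [h] at hF0)
  have hψ : ∀ f, f ≠ 0 → ψ f ≠ 0 := by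
    intro f hf h0
    have := e1 f; rw [h0] at this; simp at this; exact hf this.symm
  have hmul : ψ G * ψ H = Polynomial.X ^ d * Polynomial.C F := by rw [← map_mul, ← h, hψF]
  have hnd : (ψ G).natDegree + (ψ H).natDegree = d := by
    rw [← Polynomial.natDegree_mul (hψ G hGH.1) (hψ H hGH.2), hmul, mul_comm, Polynomial.natDegree_C_mul_X_pow _ _ hF0]
  have htd : (ψ G).natTrailingDegree + (ψ H).natTrailingDegree = d := by
    rw [← Polynomial.natTrailingDegree_mul (hψ G hGH.1) (hψ H hGH.2), hmul, mul_comm, Polynomial.C_mul_X_pow_eq_monomial, Polynomial.natTrailingDegree_monomial hF0]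
  have h1 := Polynomial.natTrailingDegree_le_natDegree (ψ G)
  have h2 : (ψ H).natTrailingDegree = 0 := by
    refine Nat.le_zero.1 (Polynomial.natTrailingDegree_le_of_ne_zero ?_)
    rw [Polynomial.coeff_zero_eq_eval_zero, e0]
    simpa using hc
  have h3 : (ψ H).natDegree = 0 := by omega
  rw [Polynomial.natDegree_eq_zero] at h3
  obtain ⟨c, hcc⟩ := h3
  have e2 := e1 H
  have e3 := e0 H
  rw [← hcc, Polynomial.eval_C] at e2 e3
  apply hH
  rw [← e2, e3]
  exact (isUnit_iff_ne_zero.2 hc).map C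

lemma F_prime {K : Type*} [Field K] {m d M : ℕ} (hm : 3 ≤ m) (F : MvPolynomial (Fin m) K) (hF : F.IsHomogeneous d) (hd : d ≠ 0)
    (hX : ∀ j, X j ^ M ∈ Ideal.span (Set.range fun i => pderiv i F)) : Prime F := by
  have hF0 : F ≠ 0 := by
    rintro rfl
    have := hX ⟨0, by omega⟩
    have h2 : Ideal.span (Set.range fun i : Fin m => pderiv i (0 : MvPolynomial (Fin m) K)) = ⊥ := by
      rw [Ideal.span_eq_bot]; rintro x ⟨i, rfl⟩; simp
    rw [h2, Ideal.mem_bot] at this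
    exact pow_ne_zero _ (X_ne_zero _) this
  refine Irreducible.prime ⟨fun hu => ?_, fun {G H} h => ?_⟩
  · have := hu.map (constantCoeff)
    have h0 : constantCoeff F = 0 := by
      rw [constantCoeff_eq]
      by_contra hc
      have := hF hc
      simp at this; exact hd this.symm
    rw [h0] at this; simp at this
  · by_contra hc
    push Not at hc
    have c1 := factor_zero F G H hF hF0 h hc.2
    have c2 := factor_zero F H G hF hF0 (by rw [h, mul_comm]) hc.1
    set I := Ideal.span ({G, H} : Set (MvPolynomial (Fin m) K)) with hI
    have hle : I ≤ RingHom.ker (constantCoeff : MvPolynomial (Fin m) K →+* K) := by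
      rw [hI, Ideal.span_le]; rintro x (rfl | rfl)
      · exact c2
      · exact c1
    have hIt : I ≠ ⊤ := fun h => by
      rw [h, top_le_iff] at hle
      exact RingHom.ker_ne_top _ hle
    obtain ⟨Q, hQ⟩ := Ideal.nonempty_minimalPrimes hIt
    have hQh : Q.height ≤ 2 := by
      refine (Ideal.height_le_card_of_mem_minimalPrimes_span (Set.toFinite _) hQ).trans ?_
      exact_mod_cast (Set.ncard_insert_le G {H}).trans (by rw [Set.ncard_singleton])
    have hQp : Q.IsPrime := hQ.1.1
    have := height_vars hm Q fun j => by
      refine hQp.mem_of_pow_mem M (hQ.1.2 ?_)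
      refine (Ideal.span_le.2 ?_) (hX j)
      rintro x ⟨i, rfl⟩
      simp only [h, Derivation.leibniz, smul_eq_mul]
      have hG : G ∈ I := Ideal.subset_span (by simp)
      have hH : H ∈ I := Ideal.subset_span (by simp)
      exact I.add_mem (I.mul_mem_right _ hG) (I.mul_mem_right _ hH)
    exact absurd (this.trans hQh) (by norm_num)

lemma mc_sum (m s : ℕ) : ∑ i ∈ Finset.range (s + 1), m.multichoose i = (m + 1).multichoose s := by
  induction s with
  | zero => simp
  | succ s ih => rw [Finset.sum_range_succ, ih, Nat.multichoose_succ_succ]; ring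

lemma mc_le (n k : ℕ) : (n + 1).multichoose k ≤ (k + 1) ^ n := by
  induction n generalizing k with
  | zero => simp
  | succ n ih =>
    rw [← mc_sum]
    calc _ ≤ ∑ i ∈ Finset.range (k + 1), (k + 1) ^ n := Finset.sum_le_sum fun i hi => (ih i).trans (by
            gcongr; exact Nat.le_of_lt_succ (Finset.mem_range.1 hi))
      _ = _ := by simp [pow_succ, mul_comm]

lemma mc_mono (n : ℕ) : Monotone fun k => (n + 1).multichoose k := by
  refine monotone_nat_of_le_succ fun k => ?_
  simp only [Nat.multichoose_succ_succ]; omega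

lemma mc_diff1 (n t e k : ℕ) (hk : t + e ≤ k) : (n + 1 + 1).multichoose (t + e) ≤ (n + 1 + 1).multichoose t + e * (n + 1).multichoose k := by
  induction e with
  | zero => simp
  | succ e ih =>
    rw [← add_assoc, Nat.multichoose_succ_succ]
    have := ih (by omega)
    have h2 := mc_mono n (show t + e + 1 ≤ k by omega)
    simp only at h2
    nlinarith

lemma mc_diff2 (n t d e k : ℕ) (hk : t + d + e ≤ k) : (n + 1 + 1 + 1).multichoose (t + d + e) + (n + 1 + 1 + 1).multichoose t ≤
    (n + 1 + 1 + 1).multichoose (t + d) + (n + 1 + 1 + 1).multichoose (t + e) + d * e * (n + 1).multichoose k := by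
  induction d with
  | zero => simp; omega
  | succ d ih =>
    have h1 := ih (by omega)
    have h2 := mc_diff1 n (t + d + 1) e k (by omega)
    rw [show t + (d + 1) + e = (t + d + e) + 1 by ring, show t + (d + 1) = t + d + 1 by ring, Nat.multichoose_succ_succ, Nat.multichoose_succ_succ (n + 1 + 1) (t + d)]
    rw [show t + d + 1 + e = t + d + e + 1 by ring] at h2
    rw [add_mul, add_mul, one_mul]
    simp only [show n + 2 = n + 1 + 1 from rfl] at *
    omega

lemma finrank_rtd (K : Type*) [Field K] (m s : ℕ) : Module.finrank K (restrictTotalDegree (Fin m) K s) = (m + 1).multichoose s := by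
  classical
  have h1 : Module.finrank K (restrictTotalDegree (Fin m) K s) = Nat.card {n : Fin m →₀ ℕ | (n.sum fun _ e => e) ≤ s} :=
    Module.finrank_eq_nat_card_basis (basisRestrictSupport K _)
  rw [h1]
  have h2 : {n : Fin m →₀ ℕ | (n.sum fun _ e => e) ≤ s} =
      ((Finset.range (s + 1)).biUnion fun i => (Finset.univ : Finset (Fin m)).finsuppAntidiag i : Finset (Fin m →₀ ℕ)) := by
    ext ν
    simp [Finset.mem_finsuppAntidiag, Finsupp.sum_fintype]
  rw [h2, Nat.card_coe_set_eq, Set.ncard_coe_finset, Finset.card_biUnion, ← mc_sum]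
  · refine Finset.sum_congr rfl fun i _ => ?_
    rw [Finset.card_finsuppAntidiag_nat_eq_multichoose]; simp
  · intro i _ j _ hij
    rw [Function.onFun, Finset.disjoint_left]
    intro ν h1 h2
    rw [Finset.mem_finsuppAntidiag] at h1 h2
    exact hij (h1.1.symm.trans h2.1)

lemma evZ_surj_deg {K : Type*} [Field K] [Fintype K] {m : ℕ} (Z : Finset (Fin m → K)) (s : ℕ) (hs : m * Fintype.card K ≤ s) :
    (restrictTotalDegree (Fin m) K s).map (evZ Z) = ⊤ := by
  classical
  rw [eq_top_iff]
  intro f _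
  have h := map_restrict_dom_evalₗ K (Fin m)
  have h1 : (fun x : Fin m → K => if hx : x ∈ Z then f ⟨x, hx⟩ else 0) ∈ (restrictDegree (Fin m) K (Fintype.card K - 1)).map (evalₗ K (Fin m)) := by
    rw [h]; trivial
  obtain ⟨P, hP, hPf⟩ := h1
  refine ⟨P, ?_, ?_⟩
  · intro ν hν
    have := hP hν
    simp only [Set.mem_ofPred_eq] at this ⊢
    rw [Finsupp.sum_fintype _ _ (by simp)]
    calc ∑ i, ν i ≤ ∑ i : Fin m, Fintype.card K := Finset.sum_le_sum fun i _ => (this i).trans (Nat.sub_le _ _)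
      _ = m * Fintype.card K := by simp
      _ ≤ s := hs
  · ext z
    rw [evZ_apply]
    have := congrFun hPf (z : Fin m → K)
    simpa [evalₗ_apply] using this

lemma count_FG {K : Type*} [Field K] [Fintype K] {n : ℕ} (F G : MvPolynomial (Fin (n + 2)) K) (hF : Prime F)
    (hFG : ¬ F ∣ G) (Z : Finset (Fin (n + 2) → K)) (hZ : ∀ x ∈ Z, eval x F = 0 ∧ eval x G = 0) :
    Z.card ≤ F.totalDegree * G.totalDegree * ((n + 2) * Fintype.card K + F.totalDegree + G.totalDegree + 1) ^ n := by
  classical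
  obtain ⟨d, hd⟩ : ∃ d, d = F.totalDegree := ⟨_, rfl⟩
  obtain ⟨e, he⟩ : ∃ d, d = G.totalDegree := ⟨_, rfl⟩
  obtain ⟨t, ht⟩ : ∃ t, t = (n + 2) * Fintype.card K := ⟨_, rfl⟩
  rw [← hd, ← he, ← ht]
  have hF0 := hF.ne_zero
  have hG0 : G ≠ 0 := by rintro rfl; exact hFG (dvd_zero _)
  let V := fun s => restrictTotalDegree (Fin (n + 2)) K s
  let A := (V (t + e)).map (LinearMap.mulLeft K F)
  let B := (V (t + d)).map (LinearMap.mulLeft K G)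
  have hinj : ∀ P : MvPolynomial (Fin (n + 2)) K, P ≠ 0 → Function.Injective (LinearMap.mulLeft K P) := fun P hP => mul_right_injective₀ hP
  have fr : ∀ P : MvPolynomial (Fin (n + 2)) K, P ≠ 0 → ∀ s, Module.finrank K ((V s).map (LinearMap.mulLeft K P)) = (n + 2 + 1).multichoose s := by
    intro P hP s
    rw [← finrank_rtd K]
    exact (Submodule.equivMapOfInjective _ (hinj P hP) (V s)).finrank_eq.symm
  have hA : A ≤ V (t + d + e) := by
    rintro _ ⟨u, hu, rfl⟩
    have hu' := (mem_restrictTotalDegree _ _ u).1 hu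
    refine (mem_restrictTotalDegree _ _ _).2 ((totalDegree_mul _ _).trans ?_)
    omega
  have hB : B ≤ V (t + d + e) := by
    rintro _ ⟨u, hu, rfl⟩
    have hu' := (mem_restrictTotalDegree _ _ u).1 hu
    refine (mem_restrictTotalDegree _ _ _).2 ((totalDegree_mul _ _).trans ?_)
    omega
  have hAB : A ⊓ B ≤ (V t).map (LinearMap.mulLeft K (G * F)) := by
    rintro _ ⟨⟨u, hu, rfl⟩, ⟨v, hv, huv⟩⟩
    simp only [LinearMap.mulLeft_apply] at huv ⊢
    obtain ⟨w, rfl⟩ : F ∣ v := (hF.dvd_or_dvd ⟨u, huv⟩).resolve_left hFG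
    refine ⟨w, ?_, by simp only [LinearMap.mulLeft_apply]; rw [← huv]; ring⟩
    refine (mem_restrictTotalDegree _ _ _).2 ?_
    have hv' := (mem_restrictTotalDegree _ _ _).1 hv
    by_cases hw : w = 0
    · simp [hw]
    · rw [totalDegree_mul_of_isDomain hF0 hw] at hv'; omega
  have r1 := Submodule.finrank_sup_add_finrank_inf_eq A B
  have r2 := Submodule.finrank_mono hAB
  rw [fr _ (mul_ne_zero hG0 hF0)] at r2
  rw [show Module.finrank K A = _ from fr F hF0 _, show Module.finrank K B = _ from fr G hG0 _] at r1
  have r3 : Z.card + Module.finrank K (A ⊔ B : Submodule K _) ≤ (n + 2 + 1).multichoose (t + d + e) := by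
    rw [← finrank_rtd K]
    have rn := LinearMap.finrank_range_add_finrank_ker ((evZ Z).domRestrict (V (t + d + e)))
    rw [LinearMap.range_domRestrict, evZ_surj_deg Z _ (by omega), finrank_top, Module.finrank_fintype_fun_eq_card, Fintype.card_coe] at rn
    rw [← show _ = Module.finrank K (restrictTotalDegree (Fin (n + 2)) K (t + d + e)) from rn]
    gcongr
    rw [← (Submodule.comapSubtypeEquivOfLe (sup_le hA hB)).finrank_eq]
    refine Submodule.finrank_mono fun x hx => ?_
    rw [LinearMap.mem_ker, LinearMap.domRestrict_apply]
    have hx' : (x : MvPolynomial (Fin (n + 2)) K) ∈ A ⊔ B := hx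
    have : A ⊔ B ≤ LinearMap.ker (evZ Z) := by
      refine sup_le ?_ ?_
      · rintro _ ⟨u, hu, rfl⟩
        rw [LinearMap.mem_ker]; ext z; rw [evZ_apply]; simp [(hZ z z.2).1]
      · rintro _ ⟨u, hu, rfl⟩
        rw [LinearMap.mem_ker]; ext z; rw [evZ_apply]; simp [(hZ z z.2).2]
    exact this hx'
  have r4 := mc_diff2 n t d e (t + d + e) le_rfl
  have r5 := Nat.mul_le_mul_left (d * e) (mc_le n (t + d + e))
  simp only [show n + 1 + 1 = n + 2 from rfl] at r4
  omega

lemma count_X {K : Type*} [Field K] [Fintype K] [DecidableEq K] {m : ℕ} (F : MvPolynomial (Fin (m + 1)) K) (hF : F ≠ 0) :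
    (Finset.univ.filter fun x => eval x F = 0).card ≤ F.totalDegree * Fintype.card K ^ m := by
  have h := schwartz_zippel_totalDegree hF (Finset.univ : Finset K)
  have hq : (0:ℚ≥0) < Fintype.card K := by exact_mod_cast Fintype.card_pos
  rw [Fintype.piFinset_univ, Finset.card_univ, div_le_div_iff₀ (by positivity) hq] at h
  have h2 : (Finset.univ.filter fun x => eval x F = 0).card * Fintype.card K ≤ F.totalDegree * Fintype.card K ^ (m + 1) := by
    exact_mod_cast h
  rw [pow_succ, ← mul_assoc] at h2
  exact Nat.le_of_mul_le_mul_right h2 Fintype.card_pos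

theorem block_count {K : Type*} [Field K] [Fintype K] [DecidableEq K] {r d D Cc : ℕ} (F : MvPolynomial (Fin (r + 2)) K) (hF : Prime F)
    (hd : F.totalDegree ≤ d) (hC : (d + 1) * (D + 1) * (r + 2 + d + D + 1) ^ r ≤ Cc) {ι : Type*} (s : Finset ι)
    (n : ℕ) (c : ι → K) (μ : ι → Fin n → (Fin (r + 2) →₀ ℕ)) (w : Fin n → MvPolynomial (Fin (r + 2)) K →ₗ[K] K)
    (hμ : ∀ t ∈ s, ∀ j, (μ t j).degree ≤ D) (hw : ∀ j H, H.totalDegree ≤ D → w j (F * H) = 0)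
    (hne : ∑ t ∈ s, c t * ∏ j, w j (monomial (μ t j) 1) ≠ 0) :
    (Finset.univ.filter fun x : Fin n → Fin (r + 2) → K => (∀ j, eval (x j) F = 0) ∧
      ∑ t ∈ s, c t * ∏ j, eval (x j) (monomial (μ t j) 1) = 0).card * Fintype.card K ≤ n * Cc ^ n * (Fintype.card K ^ (r + 1)) ^ n := by
  classical
  obtain ⟨q, hq⟩ : ∃ q, q = Fintype.card K := ⟨_, rfl⟩
  have hq1 : 1 ≤ q := by rw [hq]; exact Fintype.card_pos
  rw [← hq]
  have hX : (Finset.univ.filter fun x => eval x F = 0).card ≤ Cc * q ^ (r + 1) := by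
    refine (count_X F hF.ne_zero).trans ?_
    rw [← hq]; gcongr
    calc F.totalDegree ≤ (d + 1) * 1 * 1 := by omega
      _ ≤ (d + 1) * (D + 1) * (r + 2 + d + D + 1) ^ r := by gcongr; omega; exact Nat.one_le_pow _ _ (by omega)
      _ ≤ Cc := hC
  induction n generalizing c with
  | zero => simp at hne ⊢; exact Or.inl hne
  | succ n ih =>
    have h1 := ih (fun t => c t * w 0 (monomial (μ t 0) 1)) (fun t j => μ t j.succ) (fun j => w j.succ)
      (fun t ht j => hμ t ht _) (fun j H hH => hw _ H hH) (by
        simp only [Fin.prod_univ_succ, ← mul_assoc] at hne; exact hne)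
    set Bad := (Finset.univ.filter fun x : Fin n → Fin (r + 2) → K => (∀ j, eval (x j) F = 0) ∧
      ∑ t ∈ s, c t * w 0 (monomial (μ t 0) 1) * ∏ j : Fin n, eval (x j) (monomial (μ t j.succ) 1) = 0) with hBad
    set Xn := (Finset.univ.filter fun x : Fin n → Fin (r + 2) → K => ∀ j, eval (x j) F = 0) with hXn
    set S := (Finset.univ.filter fun x : Fin (n + 1) → Fin (r + 2) → K => (∀ j, eval (x j) F = 0) ∧
      ∑ t ∈ s, c t * ∏ j, eval (x j) (monomial (μ t j) 1) = 0) with hS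
    have hXnc : Xn.card ≤ (Cc * q ^ (r + 1)) ^ n := by
      have : Xn = Fintype.piFinset fun _ : Fin n => Finset.univ.filter fun x => eval x F = 0 := by
        ext x; simp [hXn]
      rw [this, Fintype.card_piFinset, Finset.prod_const, Finset.card_univ, Fintype.card_fin]
      gcongr
    have hfib := Finset.card_eq_sum_card_fiberwise (s := S) (t := Xn) (f := Fin.tail) (by
      intro x hx; simp only [hS, hXn, Finset.coe_filter, Finset.mem_univ, true_and, Set.mem_ofPred_eq] at hx ⊢
      exact fun j => hx.1 j.succ)
    have hle : ∀ y ∈ Xn, (S.filter fun x => Fin.tail x = y).card * q ≤ (if y ∈ Bad then Cc * q ^ (r + 1) * q else 0) + Cc * q ^ (r + 1) := by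
      intro y hy
      let G : MvPolynomial (Fin (r + 2)) K := ∑ t ∈ s, monomial (μ t 0) (c t * ∏ j : Fin n, eval (y j) (monomial (μ t j.succ) 1))
      have hGe : ∀ t a, monomial (μ t 0) a = a • monomial (μ t 0) (1:K) := by intro t a; rw [smul_monomial, smul_eq_mul, mul_one]
      have hinj : (S.filter fun x => Fin.tail x = y).card ≤ (Finset.univ.filter fun x => eval x F = 0 ∧ eval x G = 0).card := by
        refine Finset.card_le_card_of_injOn (fun x => x 0) ?_ ?_
        · intro x hx
          simp only [hS, Finset.coe_filter, Finset.mem_filter, Finset.mem_univ, true_and, Set.mem_ofPred_eq] at hx ⊢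
          obtain ⟨⟨hx1, hx2⟩, rfl⟩ := hx
          refine ⟨hx1 0, ?_⟩
          rw [← hx2]
          simp only [G, map_sum]
          refine Finset.sum_congr rfl fun t _ => ?_
          rw [hGe, smul_eval, Fin.prod_univ_succ]; simp only [Fin.tail]; ring
        · intro x hx x' hx' h
          simp only [Finset.coe_filter, Set.mem_ofPred_eq] at hx hx'
          rw [← Fin.cons_self_tail x, ← Fin.cons_self_tail x', hx.2, hx'.2]
          simp only at h; rw [h]
      by_cases hyB : y ∈ Bad
      · rw [if_pos hyB]
        have : (Finset.univ.filter fun x => eval x F = 0 ∧ eval x G = 0).card ≤ (Finset.univ.filter fun x => eval x F = 0).card :=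
          Finset.card_le_card (Finset.monotone_filter_right _ fun x _ h => h.1)
        have := Nat.mul_le_mul_right q ((hinj.trans this).trans hX)
        omega
      · rw [if_neg hyB, zero_add]
        have hwG : w 0 G ≠ 0 := by
          intro h0
          apply hyB
          rw [hBad, Finset.mem_filter]
          refine ⟨Finset.mem_univ _, (by simpa [hXn] using hy), ?_⟩
          rw [← h0]
          simp only [G, map_sum]
          refine Finset.sum_congr rfl fun t _ => ?_
          rw [hGe t (c t * _), map_smul, smul_eq_mul]; ring
        have hG0 : G ≠ 0 := by intro h; rw [h, map_zero] at hwG; exact hwG rfl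
        have hGd : G.totalDegree ≤ D := by
          refine totalDegree_finsetSum_le fun t ht => (totalDegree_monomial_le _ _).trans ?_
          have := hμ t ht 0
          exact this
        have hnd : ¬ F ∣ G := by
          rintro ⟨H, hH⟩
          have hH0 : H ≠ 0 := by rintro rfl; simp at hH; exact hG0 hH
          have := totalDegree_mul_of_isDomain hF.ne_zero hH0
          rw [← hH] at this
          exact hwG (by rw [hH]; exact hw 0 H (by omega))
        have h3 := count_FG F G hF hnd (Finset.univ.filter fun x => eval x F = 0 ∧ eval x G = 0) (by simp)
        rw [← hq] at h3
        calc _ ≤ (d * D * ((r + 2) * q + d + D + 1) ^ r) * q := by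
              gcongr; refine hinj.trans (h3.trans ?_); gcongr
          _ ≤ ((d + 1) * (D + 1) * ((r + 2 + d + D + 1) * q) ^ r) * q := by gcongr; omega; omega; nlinarith
          _ = ((d + 1) * (D + 1) * (r + 2 + d + D + 1) ^ r) * q ^ (r + 1) := by rw [mul_pow, pow_succ]; ring
          _ ≤ _ := by gcongr
    rw [hfib, Finset.sum_mul]
    calc _ ≤ ∑ y ∈ Xn, ((if y ∈ Bad then Cc * q ^ (r + 1) * q else 0) + Cc * q ^ (r + 1)) := Finset.sum_le_sum hle
      _ ≤ Bad.card * (Cc * q ^ (r + 1) * q) + Xn.card * (Cc * q ^ (r + 1)) := by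
        rw [Finset.sum_add_distrib, Finset.sum_const, smul_eq_mul]
        gcongr
        rw [← Finset.sum_filter, Finset.sum_const, smul_eq_mul]
        gcongr
        intro y hy
        exact (Finset.mem_filter.1 hy).2
      _ = (Bad.card * q) * (Cc * q ^ (r + 1)) + Xn.card * (Cc * q ^ (r + 1)) := by ring
      _ ≤ (n * Cc ^ n * (q ^ (r + 1)) ^ n) * (Cc * q ^ (r + 1)) + (Cc * q ^ (r + 1)) ^ n * (Cc * q ^ (r + 1)) := by gcongr
      _ = _ := by push_cast; rw [mul_pow, pow_succ, pow_succ _ n]; ring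

lemma func_exists {ι : Type*} (s : Finset ι) (n : ℕ) (c : ι → ℂ) (v : ι → Fin n → ℂ) (h : ∑ t ∈ s, c t * ∏ j, v t j ≠ 0) :
    ∃ l : Fin n → (ℂ →ₗ[ℚ] ℚ), ∑ t ∈ s, c t * ∏ j, ((l j (v t j) : ℚ) : ℂ) ≠ 0 := by
  classical
  induction n generalizing c with
  | zero => exact ⟨fun j => j.elim0, by simpa using h⟩
  | succ n ih =>
    obtain ⟨l', hl'⟩ := ih (fun t => c t * v t 0) (fun t j => v t j.succ) (by
      simp only [Fin.prod_univ_succ, ← mul_assoc] at h; exact h)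
    suffices h2 : ∃ l0 : ℂ →ₗ[ℚ] ℚ, ∑ t ∈ s, (c t * ∏ j, ((l' j (v t j.succ) : ℚ) : ℂ)) * ((l0 (v t 0) : ℚ) : ℂ) ≠ 0 by
      obtain ⟨l0, h0⟩ := h2
      refine ⟨Fin.cons l0 l', ?_⟩
      refine fun h => h0 ?_
      rw [← h]
      refine Finset.sum_congr rfl fun t _ => ?_
      rw [Fin.prod_univ_succ]; simp only [Fin.cons_zero, Fin.cons_succ]; ring
    by_contra hc
    push Not at hc
    apply hl'
    let b := Module.Basis.ofVectorSpace ℚ ℂ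
    let I := s.biUnion fun t => (b.repr (v t 0)).support
    have hv : ∀ t ∈ s, v t 0 = ∑ i ∈ I, ((b.coord i (v t 0) : ℚ) : ℂ) * b i := by
      intro t ht
      conv_lhs => rw [← b.linearCombination_repr (v t 0), Finsupp.linearCombination_apply]
      rw [Finsupp.sum_of_support_subset (s := I) _ (Finset.subset_biUnion_of_mem (fun t => (b.repr (v t 0)).support) ht) _ (by simp)]
      refine Finset.sum_congr rfl fun i _ => ?_
      rw [Module.Basis.coord_apply, Rat.smul_def]
    calc _ = ∑ t ∈ s, ∑ i ∈ I, ((c t * ∏ j, ((l' j (v t j.succ) : ℚ) : ℂ)) * ((b.coord i (v t 0) : ℚ) : ℂ)) * b i := by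
          refine Finset.sum_congr rfl fun t ht => ?_
          conv_lhs => rw [hv t ht]
          rw [Finset.mul_sum, Finset.sum_mul]
          exact Finset.sum_congr rfl fun i _ => by ring
      _ = 0 := by
          rw [Finset.sum_comm]
          refine Finset.sum_eq_zero fun i _ => ?_
          rw [← Finset.sum_mul, hc, zero_mul]

lemma clear_fin {α : Type*} (S : Finset α) (w : α → ℚ) : ∃ Q : ℤ, Q ≠ 0 ∧ ∃ W : α → ℤ, ∀ a ∈ S, (W a : ℚ) = Q * w a := by
  obtain ⟨b, hb⟩ := IsLocalization.exist_integer_multiples (nonZeroDivisors ℤ) S w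
  refine ⟨b, nonZeroDivisors.ne_zero b.2, ?_⟩
  classical
  choose! W hW using hb
  exact ⟨W, fun a ha => by have := hW a ha; simpa [Algebra.smul_def] using this⟩

lemma eval_blocks {R : Type*} [CommRing R] {n m : ℕ} (φ : ℤ →+* R) (g : MvPolynomial (Fin n × Fin m) ℤ) (x : Fin n → Fin m → R) :
    eval (fun q => x q.1 q.2) (map φ g) = ∑ ν ∈ g.support, φ (coeff ν g) * ∏ j, eval (x j) (monomial (Finsupp.curry ν j) 1) := by
  rw [eval_map, eval₂_eq']
  refine Finset.sum_congr rfl fun ν _ => ?_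
  rw [Fintype.prod_prod_type]
  congr 1
  refine Finset.prod_congr rfl fun j _ => ?_
  rw [eval_monomial, one_mul, Finsupp.prod_fintype _ _ (by simp)]
  rfl

lemma F_prime_modp {r d M : ℕ} (hr : 1 ≤ r) (hd : d ≠ 0) (F : MvPolynomial (Fin (r + 2)) ℤ) (hF : F.IsHomogeneous d) (D0 : ℤ)
    (a : Fin (r + 2) → Fin (r + 2) → MvPolynomial (Fin (r + 2)) ℤ) (ha : ∀ j, C D0 * X j ^ M = ∑ i, a j i * pderiv i F)
    (p : ℕ) [Fact p.Prime] (hp : ¬ (p:ℤ) ∣ D0) : Prime (map (Int.castRingHom (ZMod p)) F) := by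
  refine F_prime (M := M) (by omega) _ (hF.map _) hd fun j => ?_
  have h := congrArg (map (Int.castRingHom (ZMod p))) (ha j)
  simp only [map_mul, map_pow, map_X, map_C, map_sum, ← pderiv_map] at h
  have hD : (D0 : ZMod p) ≠ 0 := by rwa [Ne, ZMod.intCast_zmod_eq_zero_iff_dvd]
  have h2 : (X j : MvPolynomial (Fin (r + 2)) (ZMod p)) ^ M = C ((D0 : ZMod p)⁻¹) * (C (D0 : ZMod p) * X j ^ M) := by
    rw [← mul_assoc, ← C_mul, inv_mul_cancel₀ hD, C_1, one_mul]
  rw [h2]; change C ((D0 : ZMod p)⁻¹) * (C (Int.castRingHom (ZMod p) D0) * X j ^ M) ∈ _; rw [h]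
  refine Ideal.mul_mem_left _ _ (Ideal.sum_mem _ fun i _ => Ideal.mul_mem_left _ _ (Ideal.subset_span ⟨i, rfl⟩))

theorem modp_bound {n r d M : ℕ} (hr : 1 ≤ r) (hd : d ≠ 0) (F : MvPolynomial (Fin (r + 2)) ℤ) (hF : F.IsHomogeneous d) (D0 : ℤ) (hD0 : D0 ≠ 0)
    (a : Fin (r + 2) → Fin (r + 2) → MvPolynomial (Fin (r + 2)) ℤ) (ha : ∀ j, C D0 * X j ^ M = ∑ i, a j i * pderiv i F)
    (g : MvPolynomial (Fin n × Fin (r + 2)) ℤ)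
    (z : Fin n → Fin (r + 2) → ℂ) (hzF : ∀ j, eval (z j) (map (Int.castRingHom ℂ) F) = 0)
    (hzg : eval (fun q => z q.1 q.2) (map (Int.castRingHom ℂ) g) ≠ 0) :
    ∃ E : ℤ, E ≠ 0 ∧ ∃ Cc : ℕ, ∀ p : ℕ, p.Prime → ¬ (p:ℤ) ∣ E → (D0 ∣ E) ∧
      Nat.card {x : Fin n → Fin (r + 2) → ZMod p | (∀ j, eval (x j) (map (Int.castRingHom (ZMod p)) F) = 0) ∧
        eval (fun q => x q.1 q.2) (map (Int.castRingHom (ZMod p)) g) = 0} * p ≤ Cc * (p ^ (r + 1)) ^ n := by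
  classical
  rw [eval_blocks] at hzg
  obtain ⟨l, hl⟩ := func_exists _ _ _ _ hzg
  obtain ⟨D, hD⟩ : ∃ D, D = g.totalDegree := ⟨_, rfl⟩
  let S : Finset (Fin (r + 2) →₀ ℕ) := (Finset.range (D + d + 1)).biUnion fun i => (Finset.univ : Finset (Fin (r + 2))).finsuppAntidiag i
  have hS : ∀ ν : Fin (r + 2) →₀ ℕ, ν ∈ S ↔ ν.degree ≤ D + d := by
    intro ν
    simp [S, Finset.mem_finsuppAntidiag, Finsupp.degree_eq_sum]
  obtain ⟨Q, hQ, W, hW⟩ := clear_fin ((Finset.univ : Finset (Fin n)) ×ˢ S) (fun q => l q.1 (eval (z q.1) (monomial q.2 1)))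
  have hW' : ∀ j ν, ν.degree ≤ D + d → (W (j, ν) : ℚ) = Q * l j (eval (z j) (monomial ν 1)) := by
    intro j ν hν
    exact hW (j, ν) (by simp [(hS ν).2 hν])
  have hμ : ∀ ν ∈ g.support, ∀ j, (Finsupp.curry ν j).degree ≤ D := by
    intro ν hν j
    rw [hD]
    refine le_trans ?_ (le_totalDegree hν)
    rw [Finsupp.degree_eq_sum, Finsupp.sum_fintype _ _ (by simp), Fintype.sum_prod_type]
    exact Finset.single_le_sum (f := fun j => ∑ i, ν (j, i)) (fun _ _ => Nat.zero_le _) (Finset.mem_univ j)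
  -- vanishing on multiples
  have hkill : ∀ j (κ : Fin (r + 2) →₀ ℕ), κ.degree ≤ D → ∑ ν ∈ F.support, coeff ν F * W (j, ν + κ) = 0 := by
    intro j κ hκ
    have h1 : ((∑ ν ∈ F.support, coeff ν F * W (j, ν + κ) : ℤ) : ℚ) = Q * l j (eval (z j) (monomial κ 1) * eval (z j) (map (Int.castRingHom ℂ) F)) := by
      rw [eval_map, eval₂_eq', Finset.mul_sum, map_sum, Finset.mul_sum, Int.cast_sum]
      refine Finset.sum_congr rfl fun ν hν => ?_
      have hνd : ν.degree = d := by
        have := hF (mem_support_iff.1 hν)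
        rwa [Finsupp.degree_eq_weight_one]
      rw [Int.cast_mul, hW' j (ν + κ) (by rw [map_add]; omega)]
      have e : eval (z j) (monomial κ 1) * ((Int.castRingHom ℂ) (coeff ν F) * ∏ i, z j i ^ ν i) = (coeff ν F : ℤ) • eval (z j) (monomial (ν + κ) 1) := by
        rw [eval_monomial, eval_monomial, Finsupp.prod_fintype _ _ (by simp), Finsupp.prod_fintype _ _ (by simp)]
        simp only [Finsupp.add_apply, pow_add, Finset.prod_mul_distrib, zsmul_eq_mul, eq_intCast]
        ring
      rw [e, map_zsmul, zsmul_eq_mul]; ring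
    rw [hzF, mul_zero, map_zero, mul_zero] at h1
    exact_mod_cast h1
  obtain ⟨E2, hE2⟩ : ∃ E2, E2 = ∑ ν ∈ g.support, coeff ν g * ∏ j, W (j, Finsupp.curry ν j) := ⟨_, rfl⟩
  have hE20 : E2 ≠ 0 := by
    intro h0
    apply hl
    have h1 : ((E2 : ℤ) : ℚ) = Q ^ n * ∑ ν ∈ g.support, coeff ν g * ∏ j, l j (eval (z j) (monomial (Finsupp.curry ν j) 1)) := by
      rw [hE2, Int.cast_sum, Finset.mul_sum]
      refine Finset.sum_congr rfl fun ν hν => ?_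
      rw [Int.cast_mul, Int.cast_prod, Finset.prod_congr rfl fun j _ => hW' j _ ((hμ ν hν j).trans (Nat.le_add_right _ _)),
        Finset.prod_mul_distrib, Finset.prod_const, Finset.card_univ, Fintype.card_fin]
      ring
    rw [h0, Int.cast_zero, eq_comm, mul_eq_zero] at h1
    have h2 := h1.resolve_left (pow_ne_zero _ (by exact_mod_cast hQ))
    have h3 := congrArg (fun q : ℚ => (q : ℂ)) h2
    simpa using h3
  refine ⟨D0 * E2, mul_ne_zero hD0 hE20, n * ((d + 1) * (D + 1) * (r + 2 + d + D + 1) ^ r) ^ n, ?_⟩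
  intro p hp hpE
  refine ⟨dvd_mul_right _ _, ?_⟩
  have : Fact p.Prime := ⟨hp⟩
  have hFp := F_prime_modp hr hd F hF D0 a ha p fun h => hpE (h.mul_right _)
  let w : Fin n → MvPolynomial (Fin (r + 2)) (ZMod p) →ₗ[ZMod p] ZMod p := fun j =>
    (basisMonomials (Fin (r + 2)) (ZMod p)).constr (ZMod p) (fun ν => (W (j, ν) : ZMod p))
  have hwm : ∀ j ν, w j (monomial ν 1) = (W (j, ν) : ZMod p) := by
    intro j ν
    have := (basisMonomials (Fin (r + 2)) (ZMod p)).constr_basis (ZMod p) (fun ν => (W (j, ν) : ZMod p)) ν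
    rwa [coe_basisMonomials] at this
  have hwm' : ∀ j ν t, w j (monomial ν t) = t * (W (j, ν) : ZMod p) := by
    intro j ν t
    rw [show monomial ν t = t • monomial ν (1 : ZMod p) by rw [smul_monomial, smul_eq_mul, mul_one], map_smul, hwm, smul_eq_mul]
  have hwkill : ∀ j (H : MvPolynomial (Fin (r + 2)) (ZMod p)), H.totalDegree ≤ D → w j (map (Int.castRingHom (ZMod p)) F * H) = 0 := by
    intro j H hH
    conv_lhs => rw [H.as_sum]
    rw [Finset.mul_sum, map_sum]
    refine Finset.sum_eq_zero fun κ hκ => ?_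
    have hκD : κ.degree ≤ D := (le_totalDegree hκ).trans hH
    conv_lhs => rw [F.as_sum]
    rw [map_sum, Finset.sum_mul, map_sum]
    have := congrArg (fun t : ℤ => coeff κ H * (t : ZMod p)) (hkill j κ hκD)
    simp only [Int.cast_zero, mul_zero] at this
    rw [← this, Int.cast_sum, Finset.mul_sum]
    refine Finset.sum_congr rfl fun ν _ => ?_
    rw [map_monomial, monomial_mul, hwm']
    simp; ring
  have := block_count (D := D) (map (Int.castRingHom (ZMod p)) F) hFp (hF.map _).totalDegree_le le_rfl g.support n
    (fun ν => (Int.castRingHom (ZMod p)) (coeff ν g)) (fun ν j => Finsupp.curry ν j) w hμ hwkill (by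
      simp only [hwm]
      have h1 : ((E2 : ℤ) : ZMod p) ≠ 0 := by
        rw [Ne, ZMod.intCast_zmod_eq_zero_iff_dvd]; exact fun h => hpE (h.mul_left _)
      rw [hE2] at h1
      simpa using h1)
  rw [ZMod.card] at this
  convert this using 2
  rw [Nat.card_eq_fintype_card, Fintype.card_subtype]
  congr 1
  ext x
  simp only [Finset.mem_filter, Finset.mem_univ, true_and, eval_blocks, Set.mem_ofPred_eq]

lemma fib_sum {n : ℕ} (q L : ℕ) (hq : 2 ≤ q) (K : Finset (Fin n → ℕ)) (hK : ∀ k ∈ K, ∑ j, k j ≤ L) (j1 : Fin n) :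
    ∑ k ∈ K, q ^ (∑ j, k j) ≤ 2 * q ^ L * (K.image fun k => Function.update k j1 0).card := by
  classical
  rw [← Finset.sum_fiberwise_of_maps_to (g := fun k => Function.update k j1 0) (fun k hk => Finset.mem_image_of_mem _ hk)]
  rw [mul_comm, ← smul_eq_mul]
  refine Finset.sum_le_card_nsmul _ _ _ fun b _ => ?_
  have hinj : Set.InjOn (fun k : Fin n → ℕ => ∑ j, k j) (K.filter fun k => Function.update k j1 0 = b) := by
    intro k hk k' hk' h
    simp only [Finset.coe_filter, Set.mem_ofPred_eq] at hk hk'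
    have e : ∀ j, j ≠ j1 → k j = k' j := by
      intro j hj
      have := congrFun (hk.2.trans hk'.2.symm) j
      simpa [hj] using this
    have h2 := h
    simp only [] at h2
    rw [← Finset.add_sum_erase _ _ (Finset.mem_univ j1), ← Finset.add_sum_erase _ k' (Finset.mem_univ j1),
      Finset.sum_congr rfl (g := k') fun j hj => e j (Finset.ne_of_mem_erase hj)] at h2
    funext j
    by_cases hj : j = j1
    · subst hj; exact Nat.add_right_cancel h2
    · exact e j hj
  rw [← Finset.sum_image (f := fun t => q ^ t) hinj]
  calc _ ≤ ∑ t ∈ Finset.range (L + 1), q ^ t := by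
        refine Finset.sum_le_sum_of_subset fun t ht => ?_
        obtain ⟨k, hk, rfl⟩ := Finset.mem_image.1 ht
        have := hK k (Finset.mem_filter.1 hk).1
        exact Finset.mem_range.2 (by omega)
    _ ≤ 2 * q ^ L := by
        rw [Finset.sum_range_succ, two_mul]
        gcongr
        exact (Nat.geomSum_lt hq (by simp)).le

def KK (n L : ℕ) : Finset (Fin n → ℕ) := (Fintype.piFinset fun _ => Finset.range (L + 1)).filter fun k => ∑ j, k j ≤ L

lemma mem_KK {n L : ℕ} (k : Fin n → ℕ) : k ∈ KK n L ↔ ∑ j, k j ≤ L := by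
  simp only [KK, Finset.mem_filter, Fintype.mem_piFinset, Finset.mem_range, and_iff_right_iff_imp]
  intro h j
  have := Finset.single_le_sum (f := k) (fun _ _ => Nat.zero_le _) (Finset.mem_univ j)
  omega

lemma KK_sum {n : ℕ} (q L H : ℕ) (hq : 2 ≤ q) (j0 j1 : Fin (n + 2)) (hj : j0 ≠ j1) :
    ∑ k ∈ (KK (n + 2) L).filter (fun k => k j0 < H), q ^ (∑ j, k j) ≤ 2 * q ^ L * ((L + 1) ^ n * H) := by
  classical
  refine (fib_sum q L hq _ (fun k hk => (mem_KK k).1 (Finset.mem_filter.1 hk).1) j1).trans ?_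
  gcongr
  let R : Fin (n + 2) → Finset ℕ := fun j => if j = j1 then {0} else if j = j0 then Finset.range H else Finset.range (L + 1)
  calc _ ≤ (Fintype.piFinset R).card := by
        refine Finset.card_le_card fun b hb => ?_
        obtain ⟨k, hk, rfl⟩ := Finset.mem_image.1 hb
        rw [Finset.mem_filter, mem_KK] at hk
        rw [Fintype.mem_piFinset]
        intro j
        simp only [R]
        split_ifs with h1 h2
        · simp [h1]
        · subst h2; simpa [h1] using hk.2
        · have := Finset.single_le_sum (f := k) (fun _ _ => Nat.zero_le _) (Finset.mem_univ j)
          simp [h1]; omega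
    _ = (L + 1) ^ n * H := by
        rw [Fintype.card_piFinset, ← Finset.mul_prod_erase _ _ (Finset.mem_univ j1),
          ← Finset.mul_prod_erase _ _ (Finset.mem_erase.2 ⟨hj, Finset.mem_univ j0⟩),
          Finset.prod_congr rfl (g := fun _ => L + 1), Finset.prod_const, Finset.card_erase_of_mem (Finset.mem_erase.2 ⟨hj, Finset.mem_univ j0⟩),
          Finset.card_erase_of_mem (Finset.mem_univ j1)]
        · simp [R, hj, mul_comm]
        · intro j hj'
          simp only [Finset.mem_erase] at hj'
          simp [R, hj'.1, hj'.2.1]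

lemma KK_sum_all {n : ℕ} (q L : ℕ) (hq : 2 ≤ q) : ∑ k ∈ KK (n + 2) L, q ^ (∑ j, k j) ≤ 2 * q ^ L * ((L + 1) ^ n * (L + 1)) := by
  refine le_trans (le_of_eq ?_) (KK_sum (n := n) q L (L + 1) hq 0 1 (by simp))
  rw [Finset.filter_true_of_mem]
  intro k hk
  have := (mem_KK k).1 hk
  have := Finset.single_le_sum (f := k) (fun _ _ => Nat.zero_le _) (Finset.mem_univ 0)
  omega

lemma sq_le_two (h : ℕ) : (h + 1) ^ 2 ≤ 4 * 2 ^ h := by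
  induction h with
  | zero => norm_num
  | succ h ih =>
    rcases Nat.lt_or_ge h 2 with h2 | h2
    · interval_cases h <;> norm_num
    · rw [pow_succ 2 h]; nlinarith

lemma final_sum (n q A E : ℕ) (hq : 2 ≤ q) (c : (Fin (n + 2) → ℕ) → ℝ) (C1 C2 : ℝ) (hC1 : 0 < C1) (hC2 : 0 ≤ C2)
    (h1 : ∀ k, c k ≤ C1 * q ^ (∑ j, k j))
    (h2 : ∀ p : ℕ, p.Prime → E < p → ∀ k, (∀ j, p ^ A ≤ 2 ^ k j) → c k ≤ C2 * q ^ (∑ j, k j) / p) :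
    ∃ C : ℝ, 0 < C ∧ ∀ L : ℕ, ∑ k ∈ KK (n + 2) L, c k ≤ C * q ^ L * ((L : ℝ) + 1) ^ ((n : ℝ) + 1 / 2) := by
  classical
  refine ⟨2 * C1 * (E + 2) + (2 * C2 + (n + 2) * (2 * C1 * (3 * A))), by positivity, ?_⟩
  intro L
  have hLn : ((L : ℝ) + 1) ^ n ≤ ((L : ℝ) + 1) ^ ((n : ℝ) + 1 / 2) := by
    rw [← Real.rpow_natCast]
    exact Real.rpow_le_rpow_of_exponent_le (by linarith [Nat.cast_nonneg (α := ℝ) L]) (by linarith)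
  have hall := KK_sum_all (n := n) q L hq
  have hallR : ∑ k ∈ KK (n + 2) L, (q : ℝ) ^ (∑ j, k j) ≤ 2 * q ^ L * (((L : ℝ) + 1) ^ n * (L + 1)) := by exact_mod_cast hall
  rcases Nat.lt_or_ge L (E + 1) with hL | hL
  · calc _ ≤ ∑ k ∈ KK (n + 2) L, C1 * (q : ℝ) ^ (∑ j, k j) := Finset.sum_le_sum fun k _ => h1 k
      _ = C1 * ∑ k ∈ KK (n + 2) L, (q : ℝ) ^ (∑ j, k j) := by rw [Finset.mul_sum]
      _ ≤ C1 * (2 * q ^ L * (((L : ℝ) + 1) ^ ((n : ℝ) + 1 / 2) * (E + 2))) := by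
          refine mul_le_mul_of_nonneg_left (hallR.trans ?_) hC1.le
          have : (L : ℝ) ≤ E := by exact_mod_cast Nat.lt_succ_iff.1 hL
          gcongr
          linarith
      _ = 2 * C1 * (E + 2) * q ^ L * ((L : ℝ) + 1) ^ ((n : ℝ) + 1 / 2) := by ring
      _ ≤ _ := by
          gcongr
          have : 0 ≤ (2 * C2 + (n + 2) * (2 * C1 * (3 * A)) : ℝ) := by positivity
          linarith
  · obtain ⟨p, hp, hp1, hp2⟩ := Nat.exists_prime_lt_and_le_two_mul L (by omega)
    obtain ⟨h, hh⟩ : ∃ h, h = Nat.log 2 (2 * L) := ⟨_, rfl⟩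
    have hh1 : 2 ^ h ≤ 2 * L := by rw [hh]; exact Nat.pow_log_le_self 2 (by omega)
    have hh2 : 2 * L < 2 ^ (h + 1) := by rw [hh]; exact Nat.lt_pow_succ_log_self (by norm_num) _
    have hsq : ((h : ℝ) + 1) ≤ 3 * ((L : ℝ) + 1) ^ ((1 : ℝ) / 2) := by
      have a1 : (h + 1) ^ 2 ≤ 8 * L := (sq_le_two h).trans (by omega)
      have a2 : ((h : ℝ) + 1) ^ 2 ≤ 8 * L := by exact_mod_cast a1
      rw [← Real.sqrt_eq_rpow]
      refine (sq_le_sq₀ (by positivity) (by positivity)).1 ?_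
      rw [mul_pow, Real.sq_sqrt (by positivity)]
      linarith [Nat.cast_nonneg (α := ℝ) L]
    obtain ⟨H, hH⟩ : ∃ H, H = A * (h + 1) := ⟨_, rfl⟩
    have hpA : p ^ A ≤ 2 ^ H := by
      rw [hH, mul_comm, pow_mul]
      exact Nat.pow_le_pow_left (by omega) _
    have hpt : ∀ k ∈ KK (n + 2) L, c k ≤ C2 / p * (q : ℝ) ^ (∑ j, k j) + ∑ j0, if k j0 < H then C1 * (q : ℝ) ^ (∑ j, k j) else 0 := by
      intro k _
      have hn : ∀ j0, 0 ≤ (if k j0 < H then C1 * (q : ℝ) ^ (∑ j, k j) else 0) := by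
        intro j0; split_ifs <;> positivity
      by_cases hk : ∃ j0, k j0 < H
      · obtain ⟨j0, hj0⟩ := hk
        have := Finset.single_le_sum (fun j _ => hn j) (Finset.mem_univ j0)
        rw [if_pos hj0] at this
        have h3 : 0 ≤ C2 / p * (q : ℝ) ^ (∑ j, k j) := by positivity
        linarith [h1 k]
      · push Not at hk
        have h3 := h2 p hp (by omega) k fun j => hpA.trans (Nat.pow_le_pow_right (by norm_num) (hk j))
        have h4 := Finset.sum_nonneg fun j (_ : j ∈ Finset.univ) => hn j
        rw [mul_div_right_comm] at h3
        linarith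
    have hp0 : (0 : ℝ) < p := by exact_mod_cast hp.pos
    have hpL : (L : ℝ) + 1 ≤ p := by exact_mod_cast hp1
    calc _ ≤ _ := Finset.sum_le_sum hpt
      _ = C2 / p * ∑ k ∈ KK (n + 2) L, (q : ℝ) ^ (∑ j, k j) +
          ∑ j0 : Fin (n + 2), C1 * ∑ k ∈ (KK (n + 2) L).filter (fun k => k j0 < H), (q : ℝ) ^ (∑ j, k j) := by
          rw [Finset.sum_add_distrib, Finset.mul_sum, Finset.sum_comm]
          congr 1
          refine Finset.sum_congr rfl fun j0 _ => ?_
          rw [Finset.mul_sum, Finset.sum_filter]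
      _ ≤ C2 / p * (2 * q ^ L * (((L : ℝ) + 1) ^ n * p)) + ∑ j0 : Fin (n + 2), C1 * (2 * q ^ L * (((L : ℝ) + 1) ^ n * H)) := by
          gcongr with j0
          · exact hallR.trans (by gcongr)
          · obtain ⟨j1, hj1⟩ := exists_ne j0
            exact_mod_cast KK_sum q L H hq j0 j1 hj1.symm
      _ = 2 * C2 * q ^ L * ((L : ℝ) + 1) ^ n + (n + 2) * (2 * C1 * A) * q ^ L * ((L : ℝ) + 1) ^ n * (h + 1) := by
          rw [Finset.sum_const, Finset.card_univ, Fintype.card_fin, hH]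
          push_cast
          field_simp
          simp; ring
      _ ≤ 2 * C2 * q ^ L * ((L : ℝ) + 1) ^ ((n : ℝ) + 1 / 2) +
          (n + 2) * (2 * C1 * A) * q ^ L * ((L : ℝ) + 1) ^ n * (3 * ((L : ℝ) + 1) ^ ((1 : ℝ) / 2)) := by gcongr
      _ = (2 * C2 + (n + 2) * (2 * C1 * (3 * A))) * q ^ L * ((L : ℝ) + 1) ^ ((n : ℝ) + 1 / 2) := by
          rw [Real.rpow_add (by positivity), Real.rpow_natCast]; ring
      _ ≤ _ := by
          have : 0 ≤ 2 * C1 * ((E : ℝ) + 2) := by positivity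
          refine mul_le_mul_of_nonneg_right (mul_le_mul_of_nonneg_right ?_ (by positivity)) (by positivity)
          linarith

open Classical in
def SS {n m : ℕ} (F : MvPolynomial (Fin m) ℤ) (g : MvPolynomial (Fin n × Fin m) ℤ) (k : Fin n → ℕ) : Finset (Fin n → Fin m → ℤ) :=
  (Fintype.piFinset fun j => bx m ((2 ^ (k j + 1) : ℕ) : ℝ)).filter fun x =>
    (∀ j, IsPrimitiveVec (x j) ∧ eval (x j) F = 0) ∧ eval (fun q => x q.1 q.2) g = 0

lemma eval_cast {σ R : Type*} [Fintype σ] [CommRing R] (G : MvPolynomial σ ℤ) (x : σ → ℤ) :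
    eval (fun i => (x i : R)) (map (Int.castRingHom R) G) = ((eval x G : ℤ) : R) := by
  rw [eval_map, ← eq_intCast (Int.castRingHom R), eval₂_eq', eval_eq']
  simp

lemma prim_pderiv {m M : ℕ} (F : MvPolynomial (Fin m) ℤ) (D0 : ℤ) (a : Fin m → Fin m → MvPolynomial (Fin m) ℤ)
    (ha : ∀ j, C D0 * X j ^ M = ∑ i, a j i * pderiv i F) (p : ℕ) (hp : p.Prime) (hpD : ¬ (p:ℤ) ∣ D0)
    (x : Fin m → ℤ) (hx : IsPrimitiveVec x) : ∃ i, ¬ (p:ℤ) ∣ eval x (pderiv i F) := by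
  by_contra hc
  push Not at hc
  have hpZ : Prime (p:ℤ) := Nat.prime_iff_prime_int.1 hp
  have h1 : (p:ℤ) ∣ Finset.gcd Finset.univ x := by
    refine Finset.dvd_gcd fun j _ => ?_
    have h := congrArg (eval x) (ha j)
    simp only [map_mul, map_pow, eval_X, eval_C, map_sum] at h
    have h2 : (p:ℤ) ∣ D0 * x j ^ M := h ▸ Finset.dvd_sum fun i _ => (hc i).mul_left _
    exact hpZ.dvd_of_dvd_pow ((hpZ.dvd_or_dvd h2).resolve_left hpD)
  rw [hx] at h1
  exact hpZ.not_isUnit (isUnit_of_dvd_one h1)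

lemma box_prod {n m d : ℕ} (hdm : d ≤ m) (C6 P : ℝ) (k : Fin n → ℕ) :
    ∏ j, (C6 * (((2 ^ (k j + 1) : ℕ) : ℝ) ^ m / ((2 ^ (k j + 1) : ℕ) : ℝ) ^ d) / P) =
      (C6 * 2 ^ (m - d)) ^ n * (((2 ^ (m - d) : ℕ) : ℝ)) ^ (∑ j, k j) / P ^ n := by
  have : ∀ j, (C6 * (((2 ^ (k j + 1) : ℕ) : ℝ) ^ m / ((2 ^ (k j + 1) : ℕ) : ℝ) ^ d) / P) = (C6 * 2 ^ (m - d)) * (((2 ^ (m - d) : ℕ) : ℝ)) ^ (k j) / P := by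
    intro j
    have h : (((2 ^ (k j + 1) : ℕ) : ℝ) ^ m / ((2 ^ (k j + 1) : ℕ) : ℝ) ^ d) = 2 ^ (m - d) * (((2 ^ (m - d) : ℕ) : ℝ)) ^ (k j) := by
      rw [← pow_sub_mul_pow ((2 ^ (k j + 1) : ℕ) : ℝ) hdm, mul_div_cancel_right₀ _ (by positivity)]
      push_cast
      rw [← pow_mul, ← pow_mul, ← pow_add]; congr 1; ring
    rw [h]; ring
  rw [Finset.prod_congr rfl fun j _ => this j]
  simp only [Finset.prod_div_distrib, Finset.prod_mul_distrib, Finset.prod_const, mul_pow, Finset.card_univ, Fintype.card_fin, Finset.prod_pow_eq_pow_sum]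

lemma SS_bounds {n r k : ℕ} (hr : 1 ≤ r) (F : MvPolynomial (Fin (r + 2)) ℤ) (hF : F.IsHomogeneous (k + 1 + 1))
    (hsmooth : ∀ z : Fin (r + 2) → ℂ, z ≠ 0 → eval z (map (Int.castRingHom ℂ) F) = 0 →
      ∃ i, eval z (pderiv i (map (Int.castRingHom ℂ) F)) ≠ 0)
    (hmk : 2 ^ (k + 1 + 1) * (k + 1) < r + 2) (hdm : k + 1 + 1 ≤ r + 2)
    (g : MvPolynomial (Fin n × Fin (r + 2)) ℤ)
    (z : Fin n → Fin (r + 2) → ℂ) (hzF : ∀ j, eval (z j) (map (Int.castRingHom ℂ) F) = 0)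
    (hzg : eval (fun q => z q.1 q.2) (map (Int.castRingHom ℂ) g) ≠ 0) :
    ∃ C1 C2 : ℝ, 0 < C1 ∧ 0 ≤ C2 ∧ ∃ A E : ℕ,
      (∀ K, ((SS F g K).card : ℝ) ≤ C1 * ((2 ^ (r + 2 - (k + 1 + 1)) : ℕ) : ℝ) ^ (∑ j, K j)) ∧
      ∀ p : ℕ, p.Prime → E < p → ∀ K, (∀ j, p ^ A ≤ 2 ^ K j) → ((SS F g K).card : ℝ) ≤ C2 * ((2 ^ (r + 2 - (k + 1 + 1)) : ℕ) : ℝ) ^ (∑ j, K j) / p := by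
  classical
  obtain ⟨C6, hC6, A, hcc⟩ := count_cong F hF hsmooth hmk
  obtain ⟨D0, hD0, M, -, a, ha, -⟩ := smooth_id F hF hsmooth
  obtain ⟨E, hE, Cc, hmod⟩ := modp_bound hr (by omega) F hF D0 hD0 a ha g z hzF hzg
  refine ⟨(C6 * 2 ^ (r + 2 - (k + 1 + 1))) ^ n, Cc * (C6 * 2 ^ (r + 2 - (k + 1 + 1))) ^ n, by positivity, by positivity, A, E.natAbs, ?_, ?_⟩
  · intro K
    have h1 : (SS F g K).card ≤ ∏ j, ((bx (r + 2) ((2 ^ (K j + 1) : ℕ) : ℝ)).filter fun x => eval x F = 0 ∧ ∀ i, ((1:ℕ):ℤ) ∣ x i - (0 : Fin (r + 2) → ℤ) i).card := by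
      rw [← Fintype.card_piFinset]
      refine Finset.card_le_card fun x hx => ?_
      simp only [SS, Finset.mem_filter, Fintype.mem_piFinset] at hx ⊢
      exact fun j => ⟨hx.1 j, (hx.2.1 j).2, by simp⟩
    calc ((SS F g K).card : ℝ) ≤ _ := Nat.cast_le.2 h1
      _ ≤ ∏ j, (C6 * (((2 ^ (K j + 1) : ℕ) : ℝ) ^ (r + 2) / ((2 ^ (K j + 1) : ℕ) : ℝ) ^ (k + 1 + 1)) / (1:ℕ) ^ (r + 2 - 1)) := by
          rw [Nat.cast_prod]
          refine Finset.prod_le_prod (fun _ _ => Nat.cast_nonneg _) fun j _ => ?_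
          exact hcc 1 0 (Or.inl rfl) (2 ^ (K j + 1)) Nat.one_le_two_pow (by rw [one_pow]; exact Nat.one_le_two_pow)
      _ = _ := by rw [box_prod hdm]; simp
  · intro p hp hpE K hpK
    have hpE' : ¬ (p:ℤ) ∣ E := by
      intro h
      have := Nat.le_of_dvd (Int.natAbs_pos.2 hE) (Int.natCast_dvd.1 h)
      omega
    have hfact : Fact p.Prime := ⟨hp⟩
    obtain ⟨hDE, hZ⟩ := hmod p hp hpE'
    have hpD : ¬ (p:ℤ) ∣ D0 := fun h => hpE' (h.trans hDE)
    obtain ⟨Z, hZd⟩ : ∃ Z : Finset (Fin n → Fin (r + 2) → ZMod p), Z = Finset.univ.filter fun x => (∀ j, eval (x j) (map (Int.castRingHom (ZMod p)) F) = 0) ∧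
        eval (fun q => x q.1 q.2) (map (Int.castRingHom (ZMod p)) g) = 0 := ⟨_, rfl⟩
    have hZc : Z.card * p ≤ Cc * (p ^ (r + 1)) ^ n := by
      refine le_trans (le_of_eq ?_) hZ
      rw [hZd, Nat.card_eq_fintype_card, Fintype.card_subtype]
      rfl
    obtain ⟨R, hR⟩ : ∃ R : (Fin n → Fin (r + 2) → ℤ) → (Fin n → Fin (r + 2) → ZMod p), R = fun x j i => (x j i : ZMod p) := ⟨_, rfl⟩
    have hmaps : ∀ x ∈ SS F g K, R x ∈ Z := by
      intro x hx
      simp only [SS, Finset.mem_filter, Fintype.mem_piFinset] at hx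
      rw [hZd, hR, Finset.mem_filter]
      refine ⟨Finset.mem_univ _, fun j => ?_, ?_⟩
      · rw [eval_cast, (hx.2.1 j).2, Int.cast_zero]
      · rw [eval_cast g (fun q => x q.1 q.2), hx.2.2, Int.cast_zero]
    obtain ⟨V, hV⟩ : ∃ V, V = ∏ j, (C6 * (((2 ^ (K j + 1) : ℕ) : ℝ) ^ (r + 2) / ((2 ^ (K j + 1) : ℕ) : ℝ) ^ (k + 1 + 1)) / (p:ℝ) ^ (r + 2 - 1)) := ⟨_, rfl⟩
    have hV0 : 0 ≤ V := by rw [hV]; positivity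
    have hfib : ∀ b ∈ Z, (((SS F g K).filter fun x => R x = b).card : ℝ) ≤ V := by
      intro b _
      rcases Finset.eq_empty_or_nonempty ((SS F g K).filter fun x => R x = b) with he | ⟨y, hy⟩
      · rw [he]; simpa using hV0
      · have h1 : ((SS F g K).filter fun x => R x = b).card ≤ ∏ j, ((bx (r + 2) ((2 ^ (K j + 1) : ℕ) : ℝ)).filter fun x => eval x F = 0 ∧ ∀ i, (p:ℤ) ∣ x i - y j i).card := by
          rw [← Fintype.card_piFinset]
          refine Finset.card_le_card fun x hx => ?_
          have hxy := (Finset.mem_filter.1 hx).2.trans (Finset.mem_filter.1 hy).2.symm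
          have hx := (Finset.mem_filter.1 hx).1
          simp only [SS, Finset.mem_filter, Fintype.mem_piFinset] at hx ⊢
          refine fun j => ⟨hx.1 j, (hx.2.1 j).2, fun i => ?_⟩
          have := congrFun (congrFun hxy j) i
          rw [hR] at this
          rw [← ZMod.intCast_zmod_eq_zero_iff_dvd, Int.cast_sub, sub_eq_zero]
          exact this
        refine (Nat.cast_le.2 h1).trans ?_
        rw [Nat.cast_prod, hV]
        refine Finset.prod_le_prod (fun _ _ => Nat.cast_nonneg _) fun j _ => ?_
        have hy := (Finset.mem_filter.1 hy).1
        simp only [SS, Finset.mem_filter] at hy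
        exact hcc p (y j) (Or.inr ⟨hp, prim_pderiv F D0 a ha p hp hpD _ (hy.2.1 j).1⟩) (2 ^ (K j + 1)) Nat.one_le_two_pow
          ((hpK j).trans (Nat.pow_le_pow_right (by norm_num) (by omega)))
    have hp0 : (0:ℝ) < p := by exact_mod_cast hp.pos
    have hZR : (Z.card : ℝ) * p ≤ Cc * ((p:ℝ) ^ (r + 1)) ^ n := by exact_mod_cast hZc
    rw [Finset.card_eq_sum_card_fiberwise hmaps, Nat.cast_sum]
    refine (Finset.sum_le_card_nsmul _ _ _ hfib).trans ?_
    rw [nsmul_eq_mul, hV, box_prod hdm, le_div_iff₀ hp0]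
    obtain ⟨U, hU⟩ : ∃ U, U = (C6 * 2 ^ (r + 2 - (k + 1 + 1))) ^ n * (((2 ^ (r + 2 - (k + 1 + 1)) : ℕ) : ℝ)) ^ (∑ j, K j) := ⟨_, rfl⟩
    have hU0 : 0 ≤ U := by rw [hU]; positivity
    rw [mul_assoc (Cc:ℝ), ← hU, show r + 2 - 1 = r + 1 by omega]
    calc _ = ((Z.card : ℝ) * p) * (U / ((p:ℝ) ^ (r + 1)) ^ n) := by ring
      _ ≤ (Cc * ((p:ℝ) ^ (r + 1)) ^ n) * (U / ((p:ℝ) ^ (r + 1)) ^ n) := by gcongr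
      _ = _ := by field_simp

/-- Let `N ≥ 2`, `d ≥ 2`, `n ≥ 2` with `N > 2^d(d−1)`, let `F ∈ ℤ[x₀,…,x_N]` be homogeneous
of degree `d` defining a smooth hypersurface `X`, and let `g` be a polynomial over `ℚ` in `n`
blocks of `N+1` variables, homogeneous in each block and not identically zero on `Xⁿ`.  Then
there are `γ ∈ [0,1)` and `C > 0` such that for all `B ≥ 2` the number of `n`-tuples of
primitive vectors in `ℤ^{N+1}` lying on `X`, annihilating `g`, and of anticanonical height
`∏_j ‖x⁽ʲ⁾‖∞^{N+1−d} ≤ B`, is at most `C·B·(log B)^{n−2+γ}`. -/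
theorem stmt9 (N d n : ℕ) (hN : 2 ≤ N) (hd : 2 ≤ d) (hn : 2 ≤ n)
    (hNd : 2 ^ d * (d - 1) < N)
    (F : MvPolynomial (Fin (N + 1)) ℤ) (hF : F.IsHomogeneous d)
    (hsmooth : ∀ z : Fin (N + 1) → ℂ, z ≠ 0 →
      eval z (MvPolynomial.map (Int.castRingHom ℂ) F) = 0 →
      ∃ i, eval z (pderiv i (MvPolynomial.map (Int.castRingHom ℂ) F)) ≠ 0)
    (g : MvPolynomial (Fin n × Fin (N + 1)) ℚ)
    (hhom : ∀ j : Fin n, ∃ ej : ℕ, ∀ m ∈ g.support, ∑ i : Fin (N + 1), m (j, i) = ej)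
    (hz : ∃ z : Fin n → Fin (N + 1) → ℂ,
      (∀ j, z j ≠ 0 ∧ eval (z j) (MvPolynomial.map (Int.castRingHom ℂ) F) = 0) ∧
      eval (fun q : Fin n × Fin (N + 1) => z q.1 q.2)
        (MvPolynomial.map (Rat.castHom ℂ) g) ≠ 0) :
    ∃ γ : ℝ, 0 ≤ γ ∧ γ < 1 ∧ ∃ C : ℝ, 0 < C ∧ ∀ B : ℝ, 2 ≤ B →
      (Nat.card {x : Fin n → Fin (N + 1) → ℤ |
        (∀ j, IsPrimitiveVec (x j) ∧ eval (x j) F = 0) ∧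
        (∏ j, ((supNorm (x j) : ℝ)) ^ (N + 1 - d)) ≤ B ∧
        eval (fun q : Fin n × Fin (N + 1) => ((x q.1 q.2 : ℚ))) g = 0} : ℝ)
      ≤ C * B * Real.log B ^ ((n : ℝ) - 2 + γ) := by
  classical
  obtain ⟨r, rfl⟩ : ∃ r, N = r + 1 := ⟨N - 1, by omega⟩
  obtain ⟨k, rfl⟩ : ∃ k, d = k + 1 + 1 := ⟨d - 2, by omega⟩
  obtain ⟨n, rfl⟩ : ∃ n', n = n' + 2 := ⟨n - 2, by omega⟩
  obtain ⟨z, hzF, hzg⟩ := hz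
  obtain ⟨D, hD, g', hg'⟩ := clear_den g
  rw [show k + 1 + 1 - 1 = k + 1 by omega] at hNd
  have hdN : k + 1 + 1 < r + 2 := by
    have : k + 1 ≤ 2 ^ (k + 1 + 1) * (k + 1) := Nat.le_mul_of_pos_left _ (by positivity)
    omega
  have hzg' : eval (fun q => z q.1 q.2) (map (Int.castRingHom ℂ) g') ≠ 0 := by
    have h1 : map (Int.castRingHom ℂ) g' = map (Rat.castHom ℂ) (map (Int.castRingHom ℚ) g') := by
      rw [map_map]; congr 1
    rw [h1, hg', map_mul, map_C, map_mul, eval_C]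
    exact mul_ne_zero (by simpa using hD) hzg
  obtain ⟨C1, C2, hC1, hC2, A, E, hb1, hb2⟩ := SS_bounds (by omega) F hF hsmooth (by omega) hdN.le g' z (fun j => (hzF j).2) hzg'
  obtain ⟨q, hq⟩ : ∃ q, q = 2 ^ (r + 2 - (k + 1 + 1)) := ⟨_, rfl⟩
  rw [← hq] at hb1 hb2
  have hq2 : 2 ≤ q := by
    rw [hq]; exact Nat.le_self_pow (by omega) 2
  obtain ⟨C3, hC3, hfin⟩ := final_sum n q A E hq2 (fun K => ((SS F g' K).card : ℝ)) C1 C2 hC1 hC2 hb1 hb2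
  refine ⟨1 / 2, by norm_num, by norm_num, C3 * 4 ^ ((n : ℝ) + 1 / 2), by positivity, ?_⟩
  intro B hB
  obtain ⟨L, hL⟩ : ∃ L, L = Nat.log q ⌊B⌋₊ := ⟨_, rfl⟩
  have hB1 : 1 ≤ ⌊B⌋₊ := Nat.le_floor (by push_cast; linarith)
  have hqL : (q : ℝ) ^ L ≤ B := by
    have : q ^ L ≤ ⌊B⌋₊ := by rw [hL]; exact Nat.pow_log_le_self q (by omega)
    have h2 : ((q ^ L : ℕ) : ℝ) ≤ ⌊B⌋₊ := Nat.cast_le.2 this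
    push_cast at h2
    exact h2.trans (Nat.floor_le (by linarith))
  have hsub : {x : Fin (n + 2) → Fin (r + 1 + 1) → ℤ |
        (∀ j, IsPrimitiveVec (x j) ∧ eval (x j) F = 0) ∧
        (∏ j, ((supNorm (x j) : ℝ)) ^ (r + 1 + 1 - (k + 1 + 1))) ≤ B ∧
        eval (fun q : Fin (n + 2) × Fin (r + 1 + 1) => ((x q.1 q.2 : ℚ))) g = 0} ⊆ ((KK (n + 2) L).biUnion fun K => SS F g' K : Finset _) := by
    rintro x ⟨hx1, hx2, hx3⟩
    rw [Finset.mem_coe, Finset.mem_biUnion]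
    have hpos : ∀ j, supNorm (x j) ≠ 0 := by
      intro j h0
      have h1 := (hx1 j).1
      have : Finset.gcd Finset.univ (x j) = 0 := by
        rw [Finset.gcd_eq_zero_iff]
        intro i hi
        have := Finset.le_sup (f := fun i => (x j i).natAbs) hi
        unfold supNorm at h0
        rw [h0] at this
        simpa using this
      rw [h1] at this
      exact one_ne_zero this
    refine ⟨fun j => Nat.log 2 (supNorm (x j)), ?_, ?_⟩
    · rw [mem_KK, hL]
      refine Nat.le_log_of_pow_le (by omega) (Nat.le_floor ?_)
      refine le_trans ?_ hx2
      rw [← Finset.prod_pow_eq_pow_sum, Nat.cast_prod]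
      refine Finset.prod_le_prod (fun _ _ => Nat.cast_nonneg _) fun j _ => ?_
      rw [hq, ← pow_mul, mul_comm, pow_mul, ← Nat.cast_pow, Nat.cast_le]
      exact Nat.pow_le_pow_left (Nat.pow_log_le_self 2 (hpos j)) _
    · rw [SS, Finset.mem_filter, Fintype.mem_piFinset]
      refine ⟨fun j => ?_, hx1, ?_⟩
      · rw [mem_bx]
        intro i
        have h1 : (x j i).natAbs ≤ supNorm (x j) := Finset.le_sup (f := fun i => (x j i).natAbs) (Finset.mem_univ i)
        have h2 : supNorm (x j) < 2 ^ (Nat.log 2 (supNorm (x j)) + 1) := Nat.lt_pow_succ_log_self (by norm_num) _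
        have h3 : (((x j i).natAbs : ℕ) : ℝ) ≤ ((2 ^ (Nat.log 2 (supNorm (x j)) + 1) : ℕ) : ℝ) := Nat.cast_le.2 (h1.trans h2.le)
        rwa [Nat.cast_natAbs, Int.cast_abs] at h3
      · have h1 := eval_cast (R := ℚ) g' (fun q => x q.1 q.2)
        rw [hg', map_mul, hx3, mul_zero] at h1
        exact_mod_cast h1.symm
  have hcard : (Nat.card {x : Fin (n + 2) → Fin (r + 1 + 1) → ℤ |
        (∀ j, IsPrimitiveVec (x j) ∧ eval (x j) F = 0) ∧
        (∏ j, ((supNorm (x j) : ℝ)) ^ (r + 1 + 1 - (k + 1 + 1))) ≤ B ∧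
        eval (fun q : Fin (n + 2) × Fin (r + 1 + 1) => ((x q.1 q.2 : ℚ))) g = 0}) ≤ ∑ K ∈ KK (n + 2) L, (SS F g' K).card := by
    refine (Nat.card_mono (Finset.finite_toSet _) hsub).trans ?_
    rw [Nat.card_coe_set_eq, Set.ncard_coe_finset]
    exact Finset.card_biUnion_le
  have hlog2 := Real.log_two_gt_d9
  have hlogB : Real.log 2 ≤ Real.log B := Real.log_le_log (by norm_num) hB
  have hL4 : (L : ℝ) + 1 ≤ 4 * Real.log B := by
    have h1 : (L : ℝ) * Real.log 2 ≤ Real.log B := by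
      rw [← Real.log_pow]
      refine Real.log_le_log (by positivity) (le_trans ?_ hqL)
      have : (2 : ℝ) ≤ q := by exact_mod_cast hq2
      gcongr
    have h2 : (L : ℝ) * (1 / 2) ≤ L * Real.log 2 := by
      refine mul_le_mul_of_nonneg_left (by linarith) (Nat.cast_nonneg _)
    linarith
  calc _ ≤ ((∑ K ∈ KK (n + 2) L, (SS F g' K).card : ℕ) : ℝ) := Nat.cast_le.2 hcard
    _ ≤ C3 * q ^ L * ((L : ℝ) + 1) ^ ((n : ℝ) + 1 / 2) := by rw [Nat.cast_sum]; exact hfin L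
    _ ≤ C3 * B * (4 * Real.log B) ^ ((n : ℝ) + 1 / 2) := by gcongr
    _ = _ := by
        rw [Real.mul_rpow (by norm_num) (by linarith), show (((n + 2 : ℕ) : ℝ) - 2 + 1 / 2) = (n : ℝ) + 1 / 2 by push_cast; ring]
        ring
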